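/- arXiv:2107.01911 — 4 statements merged into one kernel-verified Lean document; each statement's English description precedes it below -/
import Mathlib

section
/- Let 𝔽_q be a finite field, F = 𝔽_q(T), N a finite Galois extension of F with group G = Gal(N/F), and K, L intermediate fields of N/F with fixing subgroups H_K = Gal(N/K) and H_L = Gal(N/L). Suppose that for all but finitely many nonzero prime ideals 𝔭 of 𝔽_q[T], the number of prime ideals of O_K lying above 𝔭 equals the number of prime ideals of O_L lying above 𝔭 (split equivalence). Then H_K and H_L are Gassmann equivalent in G. -/
/-- Two subgroups `H` and `H'` of a group `G` are Gassmann equivalent if every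
`g : G` is conjugate to the same number of elements of `H` as of `H'`. -/
def IsGassmannEquiv {G : Type*} [Group G] (H H' : Subgroup G) : Prop :=
  ∀ g : G, Nat.card {h : H // IsConj g (h : G)} = Nat.card {h : H' // IsConj g (h : G)}

/-- The number of primes of `A` lying over `p : Ideal R` via `f : R →+* A`. -/
noncomputable def primesOverCount {R A : Type*} [CommRing R] [CommRing A] (f : R →+* A)
    (p : Ideal R) : ℕ :=
  Nat.card {Q : Ideal A // Q.IsPrime ∧ Q.comap f = p}

namespace Gass
open Polynomial

section deg
variable {k R : Type*} [Field k] [CommRing R] [Algebra k R]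

/-- degree of an ideal -/
noncomputable def dg (k : Type*) {R : Type*} [Field k] [CommRing R] [Algebra k R] (I : Ideal R) : ℕ :=
  Module.finrank k (R ⧸ I)

lemma dg_le_of_le {I J : Ideal R} (h : I ≤ J) [Module.Finite k (R ⧸ I)] : dg k J ≤ dg k I := by
  apply LinearMap.finrank_le_finrank_of_surjective (f := (Ideal.Quotient.factorₐ k h).toLinearMap)
  exact Ideal.Quotient.factor_surjective h

lemma dg_sum_le (s : Finset (Ideal R)) (hs : ∀ Q ∈ s, Q.IsMaximal) (I : Ideal R)
    (hI : ∀ Q ∈ s, I ≤ Q) [Module.Finite k (R ⧸ I)] : ∑ Q ∈ s, dg k Q ≤ dg k I := by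
  classical
  have fin : ∀ Q : s, Module.Finite k (R ⧸ Q.1) := fun Q =>
    Module.Finite.of_surjective (Ideal.Quotient.factorₐ k (hI _ Q.2)).toLinearMap
      (Ideal.Quotient.factor_surjective (hI _ Q.2))
  have h1 : ∑ Q ∈ s, dg k Q = Module.finrank k (∀ Q : s, R ⧸ Q.1) := by
    rw [Module.finrank_pi_fintype, ← Finset.sum_coe_sort]; rfl
  rw [h1]
  let φ : (R ⧸ I) →ₗ[k] (∀ Q : s, R ⧸ Q.1) :=
    LinearMap.pi fun Q => (Ideal.Quotient.factorₐ k (hI _ Q.2)).toLinearMap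
  apply LinearMap.finrank_le_finrank_of_surjective (f := φ)
  have hc : Pairwise (Function.onFun IsCoprime fun Q : s => Q.1) := by
    intro P Q h
    exact Ideal.isCoprime_iff_sup_eq.mpr
      ((hs _ P.2).coprime_of_ne (hs _ Q.2) (fun h' => h (Subtype.ext h')))
  intro y
  obtain ⟨x, hx⟩ := Ideal.pi_quotient_surjective hc y
  refine ⟨Ideal.Quotient.mk I x, ?_⟩
  ext Q
  exact hx Q

lemma card_quot (I : Ideal R) [Module.Finite k (R ⧸ I)] :
    Submodule.cardQuot I = Nat.card k ^ dg k I := by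
  rw [Submodule.cardQuot_apply]
  exact Module.natCard_eq_pow_finrank (K := k) (V := R ⧸ I)

lemma one_lt_q (k : Type*) [Field k] [Finite k] : 1 < Nat.card k := Finite.one_lt_card

lemma finq_poly (k : Type*) [Field k] [Finite k] : Ring.HasFiniteQuotients k[X] := by
  refine ⟨fun {I} hI => ?_⟩
  obtain ⟨f, rfl⟩ := (IsPrincipalIdealRing.principal I).principal
  have hf : f ≠ 0 := by rintro rfl; simp at hI
  have : Module.Finite k (k[X] ⧸ Ideal.span {f}) :=
    (AdjoinRoot.powerBasis hf).finite
  exact Module.finite_of_finite k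

lemma finite_quot (k : Type*) {R : Type*} [Field k] [CommRing R] [Algebra k R]
    [Ring.HasFiniteQuotients R] {I : Ideal R} (hI : I ≠ ⊥) : Module.Finite k (R ⧸ I) := by
  have := Ring.HasFiniteQuotients.finiteQuotient hI
  infer_instance

variable [IsDedekindDomain R] [Finite k] [Ring.HasFiniteQuotients R]

lemma dg_pow (P : Ideal R) [P.IsPrime] (hP : P ≠ ⊥) (i : ℕ) : dg k (P ^ i) = i * dg k P := by
  have h1 := finite_quot k hP
  have h2 := finite_quot k (I := P ^ i) (pow_ne_zero i hP)
  have := cardQuot_pow_of_prime hP (i := i)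
  rw [card_quot (k := k), card_quot (k := k), ← pow_mul] at this
  rw [mul_comm]
  exact Nat.pow_right_injective (one_lt_q k) this

lemma dg_mul_coprime (I J : Ideal R) (hI : I ≠ ⊥) (hJ : J ≠ ⊥) (h : IsCoprime I J) :
    dg k (I * J) = dg k I + dg k J := by
  have h1 := finite_quot k hI
  have h2 := finite_quot k hJ
  have h3 := finite_quot k (I := I * J) (mul_ne_zero hI hJ)
  have := cardQuot_mul_of_coprime h
  rw [card_quot (k := k), card_quot (k := k), card_quot (k := k), ← pow_add] at this
  exact Nat.pow_right_injective (one_lt_q k) this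

lemma dg_prod (s : Finset (Ideal R)) (hs : ∀ Q ∈ s, Q.IsPrime ∧ Q ≠ ⊥) (v : Ideal R → ℕ) :
    dg k (∏ Q ∈ s, Q ^ v Q) = ∑ Q ∈ s, v Q * dg k Q := by
  classical
  induction s using Finset.induction_on with
  | empty =>
    simp only [Finset.prod_empty, Finset.sum_empty]
    have : dg k (⊤ : Ideal R) = 0 := Module.finrank_zero_of_subsingleton
    rw [← Ideal.one_eq_top] at this
    exact this
  | insert a s ha ih =>
    rw [Finset.prod_insert ha, Finset.sum_insert ha]
    have ha' := hs a (by simp)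
    have hs' : ∀ Q ∈ s, Q.IsPrime ∧ Q ≠ ⊥ := fun Q hQ => hs Q (by simp [hQ])
    have := ha'.1
    rw [dg_mul_coprime, dg_pow _ ha'.2, ih hs']
    · exact pow_ne_zero _ ha'.2
    · exact Finset.prod_ne_zero_iff.mpr fun Q hQ => pow_ne_zero _ (hs' Q hQ).2
    · apply IsCoprime.prod_right
      intro Q hQ
      apply IsCoprime.pow
      have m1 : a.IsMaximal := ha'.1.isMaximal ha'.2
      have m2 : Q.IsMaximal := (hs' Q hQ).1.isMaximal (hs' Q hQ).2
      exact Ideal.isCoprime_iff_sup_eq.mpr (m1.coprime_of_ne m2 (by rintro rfl; exact ha hQ))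

/-- key factorization of degree -/
lemma dg_eq_sum (I : Ideal R) (hI : I ≠ ⊥) (s : Finset (Ideal R))
    (hs : ∀ Q ∈ s, Q.IsPrime ∧ Q ≠ ⊥) (hs2 : ∀ Q : Ideal R, Q.IsPrime → I ≤ Q → Q ∈ s)
    (D : ℕ) (hD : dg k I ≤ D) :
    dg k I = ∑ Q ∈ s, ∑ i ∈ Finset.Icc 1 D, open Classical in if I ≤ Q ^ i then dg k Q else 0 := by
  classical
  have hfac : I = ∏ Q ∈ s, Q ^ (UniqueFactorizationMonoid.normalizedFactors I).count Q := by
    conv_lhs => rw [← Ideal.prod_normalizedFactors_eq_self hI]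
    apply Finset.prod_multiset_count_of_subset
    intro Q hQ
    rw [Multiset.mem_toFinset] at hQ
    have hp := UniqueFactorizationMonoid.prime_of_normalized_factor _ hQ
    exact hs2 Q (Ideal.isPrime_of_prime hp)
      (Ideal.dvd_iff_le.mp (UniqueFactorizationMonoid.dvd_of_mem_normalizedFactors hQ))
  have h1 : dg k I = ∑ Q ∈ s, (UniqueFactorizationMonoid.normalizedFactors I).count Q * dg k Q := by
    conv_lhs => rw [hfac]
    exact dg_prod s hs _
  rw [h1]
  refine Finset.sum_congr rfl fun Q hQ => ?_
  obtain ⟨hp, hb⟩ := hs Q hQ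
  set c := (UniqueFactorizationMonoid.normalizedFactors I).count Q with hc
  have hiff : ∀ i, I ≤ Q ^ i ↔ i ≤ c := by
    intro i
    have := UniqueFactorizationMonoid.le_emultiplicity_iff_replicate_le_normalizedFactors
      (a := Q) (b := I) (n := i) (Ideal.prime_of_isPrime hb hp).irreducible hI
    rw [← pow_dvd_iff_le_emultiplicity, Ideal.dvd_iff_le, normalize_eq,
      ← Multiset.le_count_iff_replicate_le] at this
    exact this
  have hpos : 1 ≤ dg k Q := by
    have := finite_quot k hb
    have : Nontrivial (R ⧸ Q) := Ideal.Quotient.nontrivial_iff.mpr hp.ne_top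
    exact Module.finrank_pos
  have hcD : c ≤ D := by
    have : c * dg k Q ≤ dg k I := by
      rw [h1]; exact Finset.single_le_sum (f := fun Q => (UniqueFactorizationMonoid.normalizedFactors I).count Q * dg k Q) (fun _ _ => Nat.zero_le _) hQ
    nlinarith
  simp_rw [hiff]
  rw [← Finset.sum_filter, Finset.sum_const, smul_eq_mul]
  congr 1
  have : (Finset.Icc 1 D).filter (· ≤ c) = Finset.Icc 1 c := by
    ext i; simp; omega
  rw [this]; simp

end deg
end Gass

namespace Gass
open Polynomial
set_option linter.unusedSectionVars false

section box
variable {k O ι : Type*} [Field k] [CommRing O] [IsDomain O] [Algebra k[X] O] [Algebra k O]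
  [IsScalarTower k k[X] O] [Fintype ι] (b : Module.Basis ι k[X] O)

/-- elements with coordinates of degree less than n -/
def box (n : ℕ) : Submodule k O where
  carrier := {x | ∀ i, b.repr x i ∈ degreeLT k n}
  add_mem' := fun hx hy i => by
    rw [map_add]; exact Submodule.add_mem _ (hx i) (hy i)
  zero_mem' := fun i => by simp
  smul_mem' := fun c x hx i => by
    rw [← algebraMap_smul k[X] c x, map_smul, Finsupp.smul_apply, algebraMap_smul]
    exact Submodule.smul_mem _ _ (hx i)

lemma mem_box {n : ℕ} {x : O} : x ∈ box b n ↔ ∀ i, (b.repr x i).degree < n := by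
  simp only [← mem_degreeLT]; rfl

lemma box_mono {m n : ℕ} (h : m ≤ n) : box b m ≤ box b n := by
  intro x hx
  rw [mem_box] at *
  exact fun i => (hx i).trans_le (by exact_mod_cast h)

/-- coordinates of the box -/
noncomputable def boxEquiv (n : ℕ) : box b n ≃ₗ[k] (ι → degreeLT k n) where
  toFun x i := ⟨b.repr x.1 i, x.2 i⟩
  map_add' x y := by ext; simp
  map_smul' c x := by
    ext i
    simp [← algebraMap_smul k[X] c x.1]
  invFun f := ⟨b.equivFun.symm fun i => (f i).1, fun i => by
    rw [← b.equivFun_apply]; simp only [LinearEquiv.apply_symm_apply]; exact (f i).2⟩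
  left_inv x := by
    ext
    exact b.equivFun.symm_apply_apply x.1
  right_inv f := by
    ext i : 2
    simp only [← b.equivFun_apply, LinearEquiv.apply_symm_apply]

instance (n : ℕ) : Module.Finite k (degreeLT k n) := Module.Finite.equiv (degreeLTEquiv k n).symm

instance (n : ℕ) : Module.Finite k (box b n) := Module.Finite.equiv (boxEquiv b n).symm

lemma finrank_box (n : ℕ) : Module.finrank k (box b n) = n * Fintype.card ι := by
  rw [(boxEquiv b n).finrank_eq, Module.finrank_pi_fintype]
  simp [(degreeLTEquiv k n).finrank_eq, mul_comm]

lemma exists_mem_box (x : O) : ∃ n, x ∈ box b n := by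
  refine ⟨(Finset.univ.sup fun i => (b.repr x i).natDegree) + 1, ?_⟩
  rw [mem_box]
  intro i
  refine degree_le_natDegree.trans_lt ?_
  have := Finset.le_sup (f := fun i => (b.repr x i).natDegree) (Finset.mem_univ i)
  exact_mod_cast Nat.lt_succ_of_le this

lemma smul_mem_box {m n : ℕ} {f : k[X]} {x : O} (hf : f.degree < m) (hx : x ∈ box b n) :
    f • x ∈ box b (m + n) := by
  rw [mem_box] at *
  intro i
  rw [map_smul, Finsupp.smul_apply, smul_eq_mul, degree_mul]
  rcases eq_or_ne f 0 with rfl | h0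
  · simp
  rcases eq_or_ne (b.repr x i) 0 with h1 | h1
  · simp [h1]
  have h2 := hx i
  rw [degree_eq_natDegree h0, degree_eq_natDegree h1] at *
  norm_cast at *
  omega

lemma X_smul_mem_box {n : ℕ} {x : O} : (X : k[X]) • x ∈ box b (n + 1) ↔ x ∈ box b n := by
  rw [mem_box, mem_box]
  refine forall_congr' fun i => ?_
  rw [map_smul, Finsupp.smul_apply, smul_eq_mul, degree_mul, degree_X]
  rcases eq_or_ne (b.repr x i) 0 with h1 | h1
  · simp [h1]
  rw [degree_eq_natDegree h1]
  norm_cast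
  omega

lemma X_pow_smul_mem_box {n m : ℕ} {x : O} : (X ^ m : k[X]) • x ∈ box b (n + m) ↔ x ∈ box b n := by
  induction m generalizing n with
  | zero => simp
  | succ m ih => rw [pow_succ', mul_smul, ← add_assoc, X_smul_mem_box, ih]

lemma box_zero {x : O} (hx : x ∈ box b 0) : x = 0 := by
  rw [mem_box] at hx
  apply b.repr.injective
  rw [map_zero]
  ext1 i
  have := hx i
  rw [Nat.cast_zero] at this
  rw [Finsupp.zero_apply]
  by_contra h
  exact absurd (zero_le_degree_iff.mpr h) (not_le.mpr this)

lemma monic_ne_zero {n N : ℕ} {x : O} (hx : x ∈ box b n) (hN : n ≤ N) :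
    algebraMap k[X] O (X ^ N) + x ≠ 0 := by
  intro h
  have h1 : (X ^ N : k[X]) • (1 : O) ∈ box b (0 + N) := by
    have : (X ^ N : k[X]) • (1 : O) = -x := by
      rw [Algebra.smul_def, mul_one]; exact eq_neg_of_add_eq_zero_left h
    rw [this]
    exact Submodule.neg_mem _ (box_mono b (by omega) hx)
  rw [X_pow_smul_mem_box] at h1
  exact one_ne_zero (box_zero b h1)

lemma exists_mul_bound : ∃ c : ℕ, (1 : O) ∈ box b c ∧
    ∀ m n : ℕ, ∀ x ∈ box b m, ∀ y ∈ box b n, x * y ∈ box b (m + n + c) := by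
  choose f hf using fun ij : ι × ι => exists_mem_box b (b ij.1 * b ij.2)
  obtain ⟨c1, hc1⟩ := exists_mem_box b (1 : O)
  refine ⟨(Finset.univ.sup f) + c1, box_mono b (by omega) hc1, ?_⟩
  intro m n x hx y hy
  rw [← b.sum_repr x, ← b.sum_repr y, Finset.sum_mul_sum]
  refine Submodule.sum_mem _ fun i _ => Submodule.sum_mem _ fun j _ => ?_
  rw [smul_mul_smul_comm]
  refine box_mono b (m := m + n + f (i, j)) ?_ ?_
  · have := Finset.le_sup (f := f) (Finset.mem_univ (i, j))
    omega
  apply smul_mem_box b _ (hf (i, j))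
  rw [mem_box] at hx hy
  have h1 := hx i
  have h2 := hy j
  rcases eq_or_ne (b.repr x i) 0 with h0 | h0
  · simp [h0]
  rcases eq_or_ne (b.repr y j) 0 with h0' | h0'
  · simp [h0']
  rw [degree_mul]
  rw [degree_eq_natDegree h0, degree_eq_natDegree h0'] at *
  norm_cast at *
  omega

variable [Finite k] [Ring.HasFiniteQuotients O]

/-- projection from the box to the quotient -/
noncomputable def boxMap (I : Ideal O) (n : ℕ) : box b n →ₗ[k] O ⧸ I :=
  (Ideal.Quotient.mkₐ k I).toLinearMap.comp (box b n).subtype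

lemma boxMap_range_mono (I : Ideal O) {m n : ℕ} (h : m ≤ n) :
    LinearMap.range (boxMap b I m) ≤ LinearMap.range (boxMap b I n) := by
  rintro _ ⟨x, rfl⟩
  exact ⟨⟨x.1, box_mono b h x.2⟩, rfl⟩

lemma exists_boxMap_surj (I : Ideal O) (hI : I ≠ ⊥) : ∃ n, LinearMap.range (boxMap b I n) = ⊤ := by
  have := finite_quot k hI
  obtain ⟨n, hn⟩ := monotone_stabilizes_iff_noetherian.mpr (inferInstance : IsNoetherian k (O ⧸ I))
    ⟨fun n => LinearMap.range (boxMap b I n), fun m n h => boxMap_range_mono b I h⟩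
  refine ⟨n, ?_⟩
  rw [eq_top_iff]
  rintro y -
  obtain ⟨x, rfl⟩ := Ideal.Quotient.mk_surjective y
  obtain ⟨m, hm⟩ := exists_mem_box b x
  have h1 : Ideal.Quotient.mk I x ∈ LinearMap.range (boxMap b I (max m n)) :=
    ⟨⟨x, box_mono b (le_max_left _ _) hm⟩, rfl⟩
  have h2 := hn (max m n) (le_max_right _ _)
  change LinearMap.range (boxMap b I n) = LinearMap.range (boxMap b I (max m n)) at h2
  rw [h2]; exact h1

/-- upper bound of the degree of principal ideals -/
lemma dg_span_le {c : ℕ}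
    (hc : ∀ m n : ℕ, ∀ x ∈ box b m, ∀ y ∈ box b n, x * y ∈ box b (m + n + c))
    {n : ℕ} {x : O} (hx : x ∈ box b n) (hx0 : x ≠ 0) :
    dg k (Ideal.span {x}) ≤ (n + c) * Fintype.card ι := by
  have hI : Ideal.span {x} ≠ ⊥ := by simpa using hx0
  have := finite_quot k hI
  obtain ⟨m, hm⟩ := exists_boxMap_surj b (Ideal.span {x}) hI
  have hm' : LinearMap.range (boxMap b (Ideal.span {x}) (n + m + c)) = ⊤ :=
    eq_top_iff.mpr (hm ▸ boxMap_range_mono b _ (by omega))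
  have h1 := LinearMap.finrank_range_add_finrank_ker (boxMap b (Ideal.span {x}) (n + m + c))
  rw [hm', finrank_top, finrank_box] at h1
  let φ : box b m →ₗ[k] LinearMap.ker (boxMap b (Ideal.span {x}) (n + m + c)) :=
    { toFun := fun y => ⟨⟨x * y.1, hc n m x hx _ y.2⟩, by
        rw [LinearMap.mem_ker]
        exact Ideal.Quotient.eq_zero_iff_mem.mpr (Ideal.mul_mem_right _ _ (Ideal.mem_span_singleton_self x))⟩
      map_add' := fun y z => by ext; simp [mul_add]
      map_smul' := fun r y => by ext; simp }
  have hφ : Function.Injective φ := by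
    intro y z h
    have : x * y.1 = x * z.1 := congrArg (fun t => t.1.1) h
    exact Subtype.ext (mul_left_cancel₀ hx0 this)
  have h2 := LinearMap.finrank_le_finrank_of_injective hφ
  rw [finrank_box] at h2
  change dg k _ + _ = _ at h1
  nlinarith

/-- lower bound for monic-like elements -/
lemma le_dg_span {c : ℕ}
    (hc : ∀ m n : ℕ, ∀ x ∈ box b m, ∀ y ∈ box b n, x * y ∈ box b (m + n + c))
    {n N : ℕ} {x : O} (hx : x ∈ box b n) (hN : n + c + 1 ≤ N) :
    N * Fintype.card ι ≤ dg k (Ideal.span {algebraMap k[X] O (X ^ N) + x}) := by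
  have h0 := monic_ne_zero b hx (show n ≤ N by omega)
  set α := algebraMap k[X] O (X ^ N) + x with hα
  have hI : Ideal.span {α} ≠ ⊥ := by simpa using h0
  have := finite_quot k hI
  have hinj : Function.Injective (boxMap b (Ideal.span {α}) N) := by
    rw [← LinearMap.ker_eq_bot, eq_bot_iff]
    rintro ⟨z, hz⟩ hz'
    rw [LinearMap.mem_ker] at hz'
    have hz'' := Ideal.Quotient.eq_zero_iff_mem.mp hz'
    obtain ⟨y, rfl⟩ := Ideal.mem_span_singleton'.mp hz''
    have : y = 0 := by
      classical
      have hex := exists_mem_box b y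
      set m := Nat.find hex with hm
      have hym : y ∈ box b m := Nat.find_spec hex
      rcases Nat.eq_zero_or_pos m with h | h
      · rw [h] at hym
        exact box_zero b hym
      exfalso
      have h1 : x * y ∈ box b ((m - 1) + N) := box_mono b (by omega) (hc n m x hx y hym)
      have h2 : y * α ∈ box b ((m - 1) + N) := box_mono b (by omega) hz
      have h3 : (X ^ N : k[X]) • y ∈ box b ((m - 1) + N) := by
        have : (X ^ N : k[X]) • y = y * α - x * y := by
          rw [hα, Algebra.smul_def]; ring
        rw [this]
        exact Submodule.sub_mem _ h2 h1
      rw [X_pow_smul_mem_box] at h3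
      exact Nat.find_min hex (m := m - 1) (by omega) h3
    simp [this]
  have h2 := LinearMap.finrank_le_finrank_of_injective hinj
  rw [finrank_box] at h2
  exact h2

end box
end Gass

namespace Gass
open Polynomial
set_option linter.unusedSectionVars false

section surj
variable {k O ι : Type*} [Field k] [CommRing O] [IsDomain O] [Algebra k[X] O] [Algebra k O]
  [IsScalarTower k k[X] O] [Fintype ι] (b : Module.Basis ι k[X] O)
  [Finite k] [Ring.HasFiniteQuotients O]

/-- rank of the image of the box -/
noncomputable def rk (I : Ideal O) (n : ℕ) : ℕ := Module.finrank k (LinearMap.range (boxMap b I n))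

lemma rk_mono (I : Ideal O) {m n : ℕ} (h : m ≤ n) : rk b I m ≤ rk b I n :=
  Submodule.finrank_mono (boxMap_range_mono b I h)

lemma rk_of_lt {c : ℕ}
    (hc : ∀ m n : ℕ, ∀ x ∈ box b m, ∀ y ∈ box b n, x * y ∈ box b (m + n + c))
    (I : Ideal O) (n : ℕ) (h : (n + c) * Fintype.card ι < dg k I) :
    rk b I n = n * Fintype.card ι := by
  rw [rk, LinearMap.finrank_range_of_inj, finrank_box]
  rw [← LinearMap.ker_eq_bot, eq_bot_iff]
  rintro ⟨z, hz⟩ hz'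
  rw [LinearMap.mem_ker] at hz'
  have hz'' : z ∈ I := Ideal.Quotient.eq_zero_iff_mem.mp hz'
  by_contra h0
  have hz0 : z ≠ 0 := by rintro rfl; exact h0 rfl
  have h1 := dg_span_le b hc hz hz0
  have := finite_quot k (I := Ideal.span {z}) (by simpa using hz0)
  have h2 := dg_le_of_le (k := k) (I := Ideal.span {z}) (J := I)
    ((Ideal.span_singleton_le_iff_mem I).mpr hz'')
  omega

lemma box_decomp {m : ℕ} {x : O} (hx : x ∈ box b (m + 1)) :
    ∃ y ∈ box b m, ∃ z ∈ box b 1, x = (X : k[X]) • y + z := by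
  refine ⟨b.equivFun.symm fun i => (b.repr x i).divX, ?_,
    b.equivFun.symm fun i => C ((b.repr x i).coeff 0), ?_, ?_⟩
  · rw [mem_box] at *
    intro i
    rw [← b.equivFun_apply]; simp only [LinearEquiv.apply_symm_apply]
    rcases eq_or_ne (b.repr x i).divX 0 with h | h
    · rw [h]; simp
    have h1 := hx i
    have h0 : b.repr x i ≠ 0 := by rintro h0; simp [h0] at h
    rw [degree_eq_natDegree h0] at h1
    rw [degree_eq_natDegree h]
    have h2 := natDegree_divX_eq_natDegree_tsub_one (p := b.repr x i)
    have h3 : (b.repr x i).natDegree ≠ 0 := by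
      intro h3
      rw [eq_C_of_natDegree_eq_zero h3] at h
      simp at h
    norm_cast at *
    omega
  · rw [mem_box]
    intro i
    rw [← b.equivFun_apply]; simp only [LinearEquiv.apply_symm_apply]
    exact degree_C_le.trans_lt (by norm_num)
  · apply b.equivFun.injective
    rw [map_add, map_smul]
    simp only [LinearEquiv.apply_symm_apply]
    ext1 i
    rw [Pi.add_apply, Pi.smul_apply, smul_eq_mul, X_mul_divX_add]
    simp

lemma rk_step (I : Ideal O) (hI : I ≠ ⊥) (n : ℕ) :
    LinearMap.range (boxMap b I n) = ⊤ ∨ rk b I n + 1 ≤ rk b I (n + 1) := by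
  have := finite_quot k hI
  by_cases h : LinearMap.range (boxMap b I n) = LinearMap.range (boxMap b I (n + 1))
  · left
    have key : ∀ m, LinearMap.range (boxMap b I m) ≤ LinearMap.range (boxMap b I n) := by
      intro m
      induction m with
      | zero => exact boxMap_range_mono b I (Nat.zero_le _)
      | succ m ih =>
        rintro _ ⟨x, rfl⟩
        obtain ⟨y, hy, z, hz, hxyz⟩ := box_decomp b x.2
        obtain ⟨w, hw⟩ := ih ⟨⟨y, hy⟩, rfl⟩
        have hXw : (X : k[X]) • w.1 ∈ box b (n + 1) := (X_smul_mem_box b).mpr w.2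
        rw [h]
        refine ⟨⟨(X : k[X]) • w.1 + z, Submodule.add_mem _ hXw (box_mono b (by omega) hz)⟩, ?_⟩
        change Ideal.Quotient.mk I ((X : k[X]) • w.1 + z) = Ideal.Quotient.mk I x.1
        change Ideal.Quotient.mk I w.1 = Ideal.Quotient.mk I y at hw
        rw [hxyz, map_add, map_add, Algebra.smul_def, Algebra.smul_def, map_mul, map_mul, hw]
    obtain ⟨m, hm⟩ := exists_boxMap_surj b I hI
    exact eq_top_iff.mpr (hm ▸ key m)
  · right
    exact Submodule.finrank_lt_finrank_of_lt
      (lt_of_le_of_ne (boxMap_range_mono b I (Nat.le_succ n)) h)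

lemma box_surj {c : ℕ}
    (hc : ∀ m n : ℕ, ∀ x ∈ box b m, ∀ y ∈ box b n, x * y ∈ box b (m + n + c))
    (I : Ideal O) (hI : I ≠ ⊥) (n : ℕ) (hd : 0 < Fintype.card ι)
    (h : dg k I + (c + 1) * Fintype.card ι * Fintype.card ι ≤ n * Fintype.card ι) :
    LinearMap.range (boxMap b I n) = ⊤ := by
  have := finite_quot k hI
  set d := Fintype.card ι with hdd
  set δ := dg k I with hδ
  have hdiv := Nat.div_add_mod (δ - 1) d
  have hmod := Nat.mod_lt (δ - 1) hd
  set e := (δ - 1) / d with he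
  set n0 := e - c with hn0
  have hr0 : n0 * d ≤ rk b I n0 := by
    rcases Nat.eq_zero_or_pos n0 with h0 | h0
    · simp [h0]
    · refine (rk_of_lt b hc I n0 ?_).ge
      have : n0 + c = e := by omega
      rw [this, ← hdd, ← hδ, mul_comm]
      have : 0 < e := by omega
      have : 0 < d * e := Nat.mul_pos hd this
      omega
  have hup : δ ≤ n0 * d + (c + 1) * d := by
    have : e ≤ n0 + c := by omega
    have := Nat.mul_le_mul_left d this
    have h2 : n0 * d + (c + 1) * d = d * (n0 + c) + d := by ring
    omega
  have hlow : n0 * d ≤ δ := by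
    have : n0 ≤ e := Nat.sub_le _ _
    have := Nat.mul_le_mul_left d this
    have h3 : n0 * d = d * n0 := mul_comm _ _
    omega
  have hind : ∀ j, LinearMap.range (boxMap b I (n0 + j)) = ⊤ ∨ n0 * d + j ≤ rk b I (n0 + j) := by
    intro j
    induction j with
    | zero => right; simpa using hr0
    | succ j ih =>
      rcases ih with ih | ih
      · left; exact eq_top_iff.mpr (ih ▸ boxMap_range_mono b I (by omega))
      · rcases rk_step b I hI (n0 + j) with h' | h'
        · left; exact eq_top_iff.mpr (h' ▸ boxMap_range_mono b I (by omega))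
        · right; rw [← add_assoc n0 j 1]; omega
  have htop : LinearMap.range (boxMap b I (n0 + (c + 1) * d)) = ⊤ := by
    rcases hind ((c + 1) * d) with h' | h'
    · exact h'
    · apply Submodule.eq_top_of_finrank_eq
      apply le_antisymm (Submodule.finrank_le _)
      exact hup.trans h'
  have hle : n0 + (c + 1) * d ≤ n := by
    refine Nat.le_of_mul_le_mul_right (c := d) ?_ hd
    rw [add_mul]; omega
  exact eq_top_iff.mpr (htop ▸ boxMap_range_mono b I hle)

lemma rk_lower {c : ℕ}
    (hc : ∀ m n : ℕ, ∀ x ∈ box b m, ∀ y ∈ box b n, x * y ∈ box b (m + n + c))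
    (I : Ideal O) (n c2 : ℕ) (hd : 0 < Fintype.card ι)
    (h : n * Fintype.card ι < dg k I + c2) :
    n * Fintype.card ι ≤ rk b I n + (c + c2) * Fintype.card ι := by
  set d := Fintype.card ι with hdd
  by_cases hn : n ≤ c + c2
  · exact (Nat.mul_le_mul_right d hn).trans (Nat.le_add_left _ _)
  obtain ⟨n0, rfl⟩ := Nat.exists_eq_add_of_le (not_le.mp hn).le
  have h1 : rk b I n0 = n0 * d := by
    apply rk_of_lt b hc
    have : c2 ≤ c2 * d := Nat.le_mul_of_pos_right _ hd
    rw [← hdd]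
    nlinarith
  have h2 := rk_mono b I (show n0 ≤ c + c2 + n0 by omega)
  nlinarith

/-- number of elements of the translated box in I -/
noncomputable def cnt (I : Ideal O) (n : ℕ) (a : O) : ℕ := Nat.card {x : box b n // a + x.1 ∈ I}

instance (n : ℕ) : Finite (box b n) := Module.finite_of_finite k

lemma card_box (n : ℕ) : Nat.card (box b n) = Nat.card k ^ (n * Fintype.card ι) := by
  rw [← finrank_box b n]; exact Module.natCard_eq_pow_finrank

lemma cnt_of_nonempty (I : Ideal O) (n : ℕ) (a : O) (x0 : box b n) (h0 : a + x0.1 ∈ I) :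
    cnt b I n a * Nat.card k ^ rk b I n = Nat.card k ^ (n * Fintype.card ι) := by
  have h1 : cnt b I n a = Nat.card (LinearMap.ker (boxMap b I n)) := by
    refine Nat.card_congr
      { toFun := fun x => ⟨x.1 - x0, ?_⟩
        invFun := fun y => ⟨y.1 + x0, ?_⟩
        left_inv := fun x => by simp
        right_inv := fun y => by simp }
    · rw [LinearMap.mem_ker]
      refine Ideal.Quotient.eq_zero_iff_mem.mpr ?_
      have := I.sub_mem x.2 h0
      simpa using this
    · have : y.1.1 ∈ I := Ideal.Quotient.eq_zero_iff_mem.mp (LinearMap.mem_ker.mp y.2)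
      have := I.add_mem this h0
      have e : a + (y.1 + x0 : box b n).1 = y.1.1 + (a + x0.1) := by
        push_cast; ring
      rw [e]; exact this
  rw [h1, Module.natCard_eq_pow_finrank (K := k), ← pow_add, ← finrank_box b n,
    ← LinearMap.finrank_range_add_finrank_ker (boxMap b I n), add_comm]
  rfl

lemma cnt_le (I : Ideal O) (n : ℕ) (a : O) :
    cnt b I n a * Nat.card k ^ rk b I n ≤ Nat.card k ^ (n * Fintype.card ι) := by
  by_cases h : Nonempty {x : box b n // a + x.1 ∈ I}
  · obtain ⟨x0, h0⟩ := h
    exact (cnt_of_nonempty b I n a x0 h0).le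
  · rw [not_nonempty_iff] at h
    simp [cnt]

lemma cnt_eq (I : Ideal O) (n : ℕ) (a : O) (h : LinearMap.range (boxMap b I n) = ⊤) :
    cnt b I n a * Nat.card k ^ dg k I = Nat.card k ^ (n * Fintype.card ι) := by
  have : dg k I = rk b I n := by rw [rk, h, finrank_top]; rfl
  rw [this]
  obtain ⟨x, hx⟩ : Ideal.Quotient.mk I (-a) ∈ LinearMap.range (boxMap b I n) := h ▸ Submodule.mem_top
  refine cnt_of_nonempty b I n a x ?_
  have hx' : Ideal.Quotient.mk I x.1 = Ideal.Quotient.mk I (-a) := hx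
  have := (Ideal.Quotient.eq).mp hx'
  simpa [add_comm] using this

end surj
end Gass

namespace Gass
open Polynomial
set_option linter.unusedSectionVars false

section cheb
variable {k O ι : Type*} [Field k] [CommRing O] [IsDedekindDomain O] [Algebra k[X] O] [Algebra k O]
  [IsScalarTower k k[X] O] [Fintype ι]
  [Finite k] [Ring.HasFiniteQuotients O]

lemma cheb (j : ℕ) (s : Finset (Ideal k[X])) (hs : ∀ p ∈ s, p.IsPrime ∧ p ≠ ⊥ ∧ dg k p = j) :
    s.card * j ≤ Nat.card k ^ j := by
  rcases Nat.eq_zero_or_pos j with rfl | hj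
  · simp
  have hq := one_lt_q k
  have hnd := FiniteField.X_pow_card_pow_sub_X_natDegree_eq k (p := Nat.card k) hj.ne' hq
  set f : k[X] := X ^ Nat.card k ^ j - X with hf
  have hdg : dg k (Ideal.span {f}) = Nat.card k ^ j := by
    rw [← hnd]; exact finrank_quotient_span_eq_natDegree
  have hf0 : f ≠ 0 := by
    intro h; rw [h] at hnd; simp at hnd
    exact absurd hnd (by positivity)
  have := finq_poly k
  have := finite_quot k (I := Ideal.span {f}) (by simpa using hf0)
  have hle := dg_sum_le (k := k) s (fun p hp => (hs p hp).1.isMaximal (hs p hp).2.1) (Ideal.span {f}) (by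
    intro p hp
    obtain ⟨h1, h2, h3⟩ := hs p hp
    rw [Ideal.span_singleton_le_iff_mem, ← Ideal.Quotient.eq_zero_iff_mem]
    have := h1.isMaximal h2
    let _ := Ideal.Quotient.field p
    have := finite_quot k h2
    have : Finite (k[X] ⧸ p) := Module.finite_of_finite k
    let _ := Fintype.ofFinite (k[X] ⧸ p)
    have hc : Fintype.card (k[X] ⧸ p) = Nat.card k ^ j := by
      rw [← Nat.card_eq_fintype_card, ← h3]
      exact Module.natCard_eq_pow_finrank (K := k)
    rw [hf, map_sub, map_pow, ← hc, FiniteField.pow_card, sub_self])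
  rw [hdg, Finset.sum_congr rfl (fun p hp => (hs p hp).2.2)] at hle
  simpa using hle

lemma dg_pos {Q : Ideal O} (hp : Q.IsPrime) (hb : Q ≠ ⊥) : 1 ≤ dg k Q := by
  have := finite_quot k hb
  have : Nontrivial (O ⧸ Q) := Ideal.Quotient.nontrivial_iff.mpr hp.ne_top
  exact Module.finrank_pos

/-- degree of the prime below -/
noncomputable def ud (k : Type*) {O : Type*} [Field k] [CommRing O] [Algebra k[X] O]
    (Q : Ideal O) : ℕ := dg k (Q.under k[X])

lemma under_ne_bot [Module.Finite k[X] O] {Q : Ideal O} (hb : Q ≠ ⊥) : Q.under k[X] ≠ ⊥ :=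
  Ideal.IsIntegral.comap_ne_bot k[X] hb

lemma ud_dvd [Module.Finite k[X] O] {Q : Ideal O} (hp : Q.IsPrime) (hb : Q ≠ ⊥) : ud k Q ∣ dg k Q := by
  have h1 := hp.isMaximal hb
  have h2 := under_ne_bot (k := k) hb
  have h3 : (Q.under k[X]).IsMaximal := Ideal.IsMaximal.under k[X] Q
  have := Ideal.cardQuot_pow_inertiaDeg (Q.under k[X]) Q
  have := finq_poly k
  have := finite_quot k hb
  have := finite_quot k h2
  rw [card_quot (k := k), card_quot (k := k), ← pow_mul] at *
  exact ⟨_, (Nat.pow_right_injective (one_lt_q k) ‹_›).symm⟩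

lemma ud_pos [Module.Finite k[X] O] {Q : Ideal O} (hp : Q.IsPrime) (hb : Q ≠ ⊥) : 1 ≤ ud k Q := by
  have := finq_poly k
  exact dg_pos (hp.under k[X]) (under_ne_bot hb)

lemma sum_over_le (b : Module.Basis ι k[X] O) (p : Ideal k[X]) (hp0 : p ≠ ⊥) (s : Finset (Ideal O))
    (hs : ∀ Q ∈ s, Q.IsPrime ∧ Q ≠ ⊥ ∧ Q.under k[X] = p) :
    ∑ Q ∈ s, dg k Q ≤ Fintype.card ι * dg k p := by
  obtain ⟨f, rfl⟩ := (IsPrincipalIdealRing.principal p).principal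
  have hf : f ≠ 0 := by rintro rfl; simp at hp0
  have hinj : algebraMap k[X] O f ≠ 0 := by
    have : Nonempty ι := by
      by_contra h
      rw [not_nonempty_iff] at h
      have := b.repr.toEquiv.subsingleton
      exact not_subsingleton O this
    have := b.linearIndependent
    intro h
    rw [Fintype.linearIndependent_iff] at this
    exact hf (this (fun _ => f) (by simp [Algebra.smul_def, h]) (Classical.arbitrary ι))
  have h1 : dg k (Ideal.span {algebraMap k[X] O f}) = Fintype.card ι * dg k (Ideal.span {f}) := by
    have h2 := finrank_quotient_span_eq_natDegree_norm b hinj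
    rw [Algebra.norm_algebraMap_of_basis b, natDegree_pow] at h2
    have h3 : dg k (Ideal.span {f}) = f.natDegree := finrank_quotient_span_eq_natDegree
    rw [h3]; exact h2
  have := finite_quot k (I := Ideal.span {algebraMap k[X] O f}) (by simpa using hinj)
  change _ ≤ _ * dg k (Ideal.span {f})
  rw [← h1]
  refine dg_sum_le s (fun Q hQ => (hs Q hQ).1.isMaximal (hs Q hQ).2.1) _ fun Q hQ => ?_
  rw [Ideal.span_singleton_le_iff_mem]
  have : f ∈ Q.under k[X] := by rw [(hs Q hQ).2.2]; exact Ideal.mem_span_singleton_self f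
  exact this

lemma sum_le_j (b : Module.Basis ι k[X] O) (s : Finset (Ideal O)) (hs : ∀ Q ∈ s, Q.IsPrime ∧ Q ≠ ⊥) (J : Finset ℕ)
    (hJ : ∀ Q ∈ s, ud k Q ∈ J) (g : ℕ → ℝ) (hg : ∀ j, 0 ≤ g j) :
    ∑ Q ∈ s, (dg k Q : ℝ) * g (ud k Q) ≤ Fintype.card ι * ∑ j ∈ J, (Nat.card k : ℝ) ^ j * g j := by
  classical
  have : Module.Finite k[X] O := Module.Finite.of_basis b
  set t := s.image (fun Q => Q.under k[X]) with ht
  have e1 : ∑ Q ∈ s, (dg k Q : ℝ) * g (ud k Q) =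
      ∑ p ∈ t, ∑ Q ∈ s with Q.under k[X] = p, (dg k Q : ℝ) * g (ud k Q) :=
    (Finset.sum_fiberwise_of_maps_to (fun Q hQ => Finset.mem_image_of_mem _ hQ) _).symm
  have ht' : ∀ p ∈ t, p.IsPrime ∧ p ≠ ⊥ ∧ dg k p ∈ J := by
    intro p hp
    obtain ⟨Q, hQ, rfl⟩ := Finset.mem_image.mp hp
    have := (hs Q hQ).1
    exact ⟨this.under k[X], under_ne_bot (hs Q hQ).2, hJ Q hQ⟩
  have e2 : ∑ Q ∈ s, (dg k Q : ℝ) * g (ud k Q) ≤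
      ∑ p ∈ t, Fintype.card ι * (dg k p * g (dg k p)) := by
    rw [e1]
    refine Finset.sum_le_sum fun p hp => ?_
    have h1 : ∑ Q ∈ s with Q.under k[X] = p, (dg k Q : ℝ) * g (ud k Q) =
        ((∑ Q ∈ s with Q.under k[X] = p, dg k Q : ℕ) : ℝ) * g (dg k p) := by
      push_cast
      rw [Finset.sum_mul]
      refine Finset.sum_congr rfl fun Q hQ => ?_
      rw [Finset.mem_filter] at hQ
      rw [ud, hQ.2]
    rw [h1, ← mul_assoc]
    refine mul_le_mul_of_nonneg_right ?_ (hg _)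
    have := sum_over_le b p (ht' p hp).2.1 (s.filter (fun Q => Q.under k[X] = p)) (by
      intro Q hQ
      rw [Finset.mem_filter] at hQ
      exact ⟨(hs Q hQ.1).1, (hs Q hQ.1).2, hQ.2⟩)
    exact_mod_cast this
  refine e2.trans ?_
  rw [← Finset.mul_sum]
  refine mul_le_mul_of_nonneg_left ?_ (by positivity)
  rw [← Finset.sum_fiberwise_of_maps_to (s := t) (t := J) (g := fun p => dg k p)
    (fun p hp => (ht' p hp).2.2)]
  refine Finset.sum_le_sum fun j hj => ?_
  have h1 : ∑ p ∈ t with dg k p = j, (dg k p : ℝ) * g (dg k p) =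
      (((t.filter (fun p => dg k p = j)).card * j : ℕ) : ℝ) * g j := by
    rw [Finset.sum_congr rfl (g := fun _ => (j : ℝ) * g j)]
    · simp [mul_assoc]
    · intro p hp
      rw [(Finset.mem_filter.mp hp).2]
  rw [h1]
  refine mul_le_mul_of_nonneg_right ?_ (hg _)
  have := cheb (k := k) j (t.filter (fun p => dg k p = j)) (by
    intro p hp
    rw [Finset.mem_filter] at hp
    exact ⟨(ht' p hp.1).1, (ht' p hp.1).2.1, hp.2⟩)
  exact_mod_cast this

lemma finite_dg_le (M : ℕ) : {Q : Ideal O | Q ≠ ⊥ ∧ dg k Q ≤ M}.Finite := by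
  refine (Ring.HasFiniteQuotients.finite_cardQuot_le (R := O) (Nat.card k ^ M)).subset ?_
  rintro Q ⟨h1, h2⟩
  have := finite_quot k h1
  change Submodule.cardQuot Q ≤ _
  rw [card_quot (k := k)]
  exact Nat.pow_le_pow_right (one_lt_q k).le h2

end cheb
end Gass

namespace Gass
open Polynomial
set_option linter.unusedSectionVars false

section mertens
variable {k O ι : Type*} [Field k] [CommRing O] [IsDedekindDomain O] [Algebra k[X] O] [Algebra k O]
  [IsScalarTower k k[X] O] [Fintype ι]
  [Finite k] [Ring.HasFiniteQuotients O]

/-- shifted element -/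
noncomputable def al (k : Type*) {O : Type*} [Field k] [CommRing O] [Algebra k[X] O] (N : ℕ) (x : O) : O :=
  algebraMap k[X] O (X ^ N) + x

lemma al_le (b : Module.Basis ι k[X] O) {c : ℕ} (h1c : (1 : O) ∈ box b c)
    (hc : ∀ m n : ℕ, ∀ x ∈ box b m, ∀ y ∈ box b n, x * y ∈ box b (m + n + c)) (n : ℕ)
    (x : box b n) : dg k (Ideal.span {al k (n + c + 1) x.1}) ≤
      n * Fintype.card ι + (2 + 3 * c) * Fintype.card ι := by
  have h0 := monic_ne_zero b x.2 (show n ≤ n + c + 1 by omega)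
  have h1 : al k (n + c + 1) x.1 ∈ box b (c + (n + c + 1) + 1) := by
    refine Submodule.add_mem _ ?_ (box_mono b (by omega) x.2)
    have := (X_pow_smul_mem_box b (m := n + c + 1)).mpr h1c
    rw [Algebra.smul_def, mul_one] at this
    exact box_mono b (by omega) this
  have := dg_span_le b hc h1 h0
  refine this.trans (le_of_eq ?_)
  ring

lemma count_identity (b : Module.Basis ι k[X] O) (n N D : ℕ) (hnN : n ≤ N)
    (hD : ∀ x : box b n, dg k (Ideal.span {al k N x.1}) ≤ D) (s : Finset (Ideal O))
    (hs : ∀ Q, Q ∈ s ↔ Q.IsPrime ∧ Q ≠ ⊥ ∧ dg k Q ≤ D) [Fintype (box b n)] :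
    ∑ x : box b n, dg k (Ideal.span {al k N x.1}) =
      ∑ Q ∈ s, ∑ i ∈ Finset.Icc 1 D, dg k Q * cnt b (Q ^ i) n (algebraMap k[X] O (X ^ N)) := by
  classical
  have h1 : ∀ x : box b n, dg k (Ideal.span {al k N x.1}) =
      ∑ Q ∈ s, ∑ i ∈ Finset.Icc 1 D, if Ideal.span {al k N x.1} ≤ Q ^ i then dg k Q else 0 := by
    intro x
    have h0 : Ideal.span {al k N x.1} ≠ ⊥ := by
      have := monic_ne_zero b x.2 hnN
      simpa [al] using this
    have := finite_quot k h0
    convert dg_eq_sum (k := k) (Ideal.span {al k N x.1}) h0 s (fun Q hQ => ⟨((hs Q).mp hQ).1, ((hs Q).mp hQ).2.1⟩)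
      ?_ D (hD x)
    intro Q hQ hle
    exact (hs Q).mpr ⟨hQ, fun h => h0 (le_bot_iff.mp (h ▸ hle)), (dg_le_of_le hle).trans (hD x)⟩
  rw [Finset.sum_congr rfl (fun x _ => h1 x), Finset.sum_comm]
  refine Finset.sum_congr rfl fun Q hQ => ?_
  rw [Finset.sum_comm]
  refine Finset.sum_congr rfl fun i hi => ?_
  rw [← Finset.sum_filter, Finset.sum_const, smul_eq_mul, mul_comm]
  congr 1
  rw [cnt, Nat.card_eq_fintype_card, Fintype.card_subtype]
  congr 1
  ext x
  simp only [Finset.mem_filter, Finset.mem_univ, true_and, Ideal.span_singleton_le_iff_mem, al]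

/-- normalized count -/
noncomputable def wt (b : Module.Basis ι k[X] O) (n N : ℕ) (I : Ideal O) : ℝ :=
  cnt b I n (algebraMap k[X] O (X ^ N)) / (Nat.card k : ℝ) ^ (n * Fintype.card ι)

lemma qpos (k : Type*) [Field k] [Finite k] : (0 : ℝ) < Nat.card k := by
  exact_mod_cast (one_lt_q k).trans' one_pos

lemma wt_nonneg (b : Module.Basis ι k[X] O) (n N : ℕ) (I : Ideal O) : 0 ≤ wt b n N I := by
  unfold wt; positivity

lemma wt_eq (b : Module.Basis ι k[X] O) {c : ℕ}
    (hc : ∀ m n : ℕ, ∀ x ∈ box b m, ∀ y ∈ box b n, x * y ∈ box b (m + n + c)) (n N : ℕ)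
    (hd : 0 < Fintype.card ι) (I : Ideal O) (hI : I ≠ ⊥)
    (h : dg k I + (c + 1) * Fintype.card ι * Fintype.card ι ≤ n * Fintype.card ι) :
    wt b n N I = ((Nat.card k : ℝ)⁻¹) ^ dg k I := by
  have hq := qpos k
  have h1 := cnt_eq b I n (algebraMap k[X] O (X ^ N)) (box_surj b hc I hI n hd h)
  have h2 : (cnt b I n (algebraMap k[X] O (X ^ N)) : ℝ) * (Nat.card k : ℝ) ^ dg k I =
    (Nat.card k : ℝ) ^ (n * Fintype.card ι) := by exact_mod_cast h1
  rw [wt, ← h2, inv_pow]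
  have h3 : (cnt b I n (algebraMap k[X] O (X ^ N)) : ℝ) ≠ 0 := by
    intro h3; rw [h3, zero_mul] at h2
    exact (pow_pos hq _).ne h2
  field_simp

/-- the constant -/
noncomputable def CC (k : Type*) (c d : ℕ) : ℝ :=
  (Nat.card k : ℝ) ^ ((2 + 3 * c) * d + (c + (c + 1) * d * d) * d)

lemma wt_le (b : Module.Basis ι k[X] O) {c : ℕ} (h1c : (1 : O) ∈ box b c)
    (hc : ∀ m n : ℕ, ∀ x ∈ box b m, ∀ y ∈ box b n, x * y ∈ box b (m + n + c)) (n : ℕ)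
    (hd : 0 < Fintype.card ι) (I : Ideal O) (hI : I ≠ ⊥) :
    wt b n (n + c + 1) I ≤ CC k c (Fintype.card ι) * ((Nat.card k : ℝ)⁻¹) ^ dg k I := by
  have hq := qpos k
  have hq1 : (1 : ℝ) ≤ Nat.card k := by exact_mod_cast (one_lt_q k).le
  set d := Fintype.card ι with hdd
  by_cases h1 : dg k I + (c + 1) * d * d ≤ n * d
  · rw [wt_eq b hc n _ hd I hI h1]
    exact le_mul_of_one_le_left (by positivity) (one_le_pow₀ hq1)
  by_cases h2 : dg k I ≤ n * d + (2 + 3 * c) * d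
  · have h3 := rk_lower b hc I n ((c + 1) * d * d) hd (by rw [← hdd]; omega)
    have h4 := cnt_le b I n (algebraMap k[X] O (X ^ (n + c + 1)))
    have h5 : (cnt b I n (algebraMap k[X] O (X ^ (n + c + 1))) : ℝ) * (Nat.card k : ℝ) ^ rk b I n ≤
      (Nat.card k : ℝ) ^ (n * d) := by exact_mod_cast h4
    rw [wt, ← hdd, inv_pow, CC, div_le_iff₀ (by positivity), ← div_eq_mul_inv, div_mul_eq_mul_div,
      le_div_iff₀ (by positivity)]
    have h6 : (Nat.card k : ℝ) ^ dg k I ≤ (Nat.card k : ℝ) ^ rk b I n *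
        (Nat.card k : ℝ) ^ ((2 + 3 * c) * d + (c + (c + 1) * d * d) * d) := by
      rw [← pow_add]
      refine pow_le_pow_right₀ hq1 ?_
      rw [← hdd] at h3
      omega
    calc _ ≤ (cnt b I n (algebraMap k[X] O (X ^ (n + c + 1))) : ℝ) * _ :=
          mul_le_mul_of_nonneg_left h6 (by positivity)
      _ = (cnt b I n (algebraMap k[X] O (X ^ (n + c + 1))) : ℝ) * (Nat.card k : ℝ) ^ rk b I n *
        (Nat.card k : ℝ) ^ ((2 + 3 * c) * d + (c + (c + 1) * d * d) * d) := by ring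
      _ ≤ _ := by
        rw [mul_comm ((Nat.card k : ℝ) ^ _)]
        exact mul_le_mul_of_nonneg_right h5 (by positivity)
  · have : cnt b I n (algebraMap k[X] O (X ^ (n + c + 1))) = 0 := by
      have : IsEmpty {x : box b n // algebraMap k[X] O (X ^ (n + c + 1)) + x.1 ∈ I} := by
        refine ⟨fun x => h2 ?_⟩
        refine le_trans ?_ (al_le b h1c hc n x.1)
        have h0 := monic_ne_zero b x.1.2 (show n ≤ n + c + 1 by omega)
        have := finite_quot k (I := Ideal.span {al k (n + c + 1) x.1.1}) (by simpa [al] using h0)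
        exact dg_le_of_le ((Ideal.span_singleton_le_iff_mem I).mpr x.2)
      rw [cnt]; exact Nat.card_of_isEmpty
    rw [wt, this]
    have : 0 ≤ CC k c d := by unfold CC; positivity
    simp only [Nat.cast_zero, zero_div]
    positivity

lemma total (b : Module.Basis ι k[X] O) {c : ℕ} (h1c : (1 : O) ∈ box b c)
    (hc : ∀ m n : ℕ, ∀ x ∈ box b m, ∀ y ∈ box b n, x * y ∈ box b (m + n + c)) (n : ℕ)
    (s : Finset (Ideal O))
    (hs : ∀ Q, Q ∈ s ↔ Q.IsPrime ∧ Q ≠ ⊥ ∧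
      dg k Q ≤ n * Fintype.card ι + (2 + 3 * c) * Fintype.card ι) :
    (n * Fintype.card ι : ℝ) ≤ ∑ Q ∈ s, ∑ i ∈ Finset.Icc 1 (n * Fintype.card ι + (2 + 3 * c) * Fintype.card ι),
        (dg k Q : ℝ) * wt b n (n + c + 1) (Q ^ i) ∧
    ∑ Q ∈ s, ∑ i ∈ Finset.Icc 1 (n * Fintype.card ι + (2 + 3 * c) * Fintype.card ι),
        (dg k Q : ℝ) * wt b n (n + c + 1) (Q ^ i) ≤
        ((n * Fintype.card ι + (2 + 3 * c) * Fintype.card ι : ℕ) : ℝ) := by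
  classical
  let _ : Fintype (box b n) := Fintype.ofFinite _
  have hq := qpos k
  set d := Fintype.card ι with hdd
  set D := n * d + (2 + 3 * c) * d with hD
  have hid := count_identity b n (n + c + 1) D (by omega) (al_le b h1c hc n) s hs
  have hcard : Fintype.card (box b n) = Nat.card k ^ (n * d) := by
    rw [← Nat.card_eq_fintype_card]; exact card_box b n
  have hup : ∑ x : box b n, dg k (Ideal.span {al k (n + c + 1) x.1}) ≤ Nat.card k ^ (n * d) * D := by
    rw [← hcard]
    have := Finset.sum_le_card_nsmul Finset.univ _ D (fun x _ => al_le b h1c hc n x)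
    simpa using this
  have hlo : Nat.card k ^ (n * d) * (n * d) ≤ ∑ x : box b n, dg k (Ideal.span {al k (n + c + 1) x.1}) := by
    rw [← hcard]
    have := Finset.card_nsmul_le_sum Finset.univ
      (fun x : box b n => dg k (Ideal.span {al k (n + c + 1) x.1})) (n * d)
      (fun x _ => le_trans (Nat.mul_le_mul_right _ (by omega)) (le_dg_span b hc x.2 le_rfl))
    simpa using this
  have hS : ∑ Q ∈ s, ∑ i ∈ Finset.Icc 1 D, (dg k Q : ℝ) * wt b n (n + c + 1) (Q ^ i) =
      ((∑ x : box b n, dg k (Ideal.span {al k (n + c + 1) x.1}) : ℕ) : ℝ) / (Nat.card k : ℝ) ^ (n * d) := by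
    rw [hid]
    simp only [Nat.cast_sum, Nat.cast_mul]
    simp_rw [Finset.sum_div]
    refine Finset.sum_congr rfl fun Q _ => Finset.sum_congr rfl fun i _ => ?_
    rw [wt, mul_div_assoc]
  rw [hS]
  constructor
  · rw [le_div_iff₀ (by positivity), mul_comm]
    exact_mod_cast hlo
  · rw [div_le_iff₀ (by positivity), mul_comm]
    exact_mod_cast hup

end mertens
end Gass

namespace Gass
open Polynomial
set_option linter.unusedSectionVars false

lemma geom_tail (y : ℝ) (h0 : 0 ≤ y) (h1 : y ≤ 1 / 2) (D : ℕ) :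
    ∑ i ∈ Finset.Icc 1 D, y ^ i ≤ 2 * y := by
  have : ∀ D : ℕ, ∑ i ∈ Finset.Icc 1 D, y ^ i ≤ 2 * y * (1 - (1/2) ^ D) := by
    intro D
    induction D with
    | zero => simp
    | succ D ih =>
      rw [Finset.sum_Icc_succ_top (by omega)]
      have : y ^ D ≤ (1 / 2) ^ D := pow_le_pow_left₀ h0 h1 D
      have := mul_le_mul_of_nonneg_left this h0
      rw [pow_succ, pow_succ]
      nlinarith
  have h3 : (0:ℝ) ≤ (1/2) ^ D := by positivity
  nlinarith [this D, mul_nonneg h0 h3]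

section mertens
variable {k O ι : Type*} [Field k] [CommRing O] [IsDedekindDomain O] [Algebra k[X] O] [Algebra k O]
  [IsScalarTower k k[X] O] [Fintype ι]
  [Finite k] [Ring.HasFiniteQuotients O]

lemma inv_q_le (k : Type*) [Field k] [Finite k] : (Nat.card k : ℝ)⁻¹ ≤ 1 / 2 := by
  rw [one_div]
  have : (2 : ℝ) ≤ Nat.card k := by exact_mod_cast one_lt_q k
  exact inv_anti₀ (by norm_num) this

lemma CC_pos (k : Type*) [Field k] [Finite k] (c d : ℕ) : 1 ≤ CC k c d := by
  have hq1 : (1 : ℝ) ≤ Nat.card k := by exact_mod_cast (one_lt_q k).le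
  exact one_le_pow₀ hq1

/-- bound per prime -/
lemma per_prime (b : Module.Basis ι k[X] O) {c : ℕ} (h1c : (1 : O) ∈ box b c)
    (hc : ∀ m n : ℕ, ∀ x ∈ box b m, ∀ y ∈ box b n, x * y ∈ box b (m + n + c)) (n D : ℕ)
    (hd : 0 < Fintype.card ι) (Q : Ideal O) (hQ : Q.IsPrime) (hQ0 : Q ≠ ⊥) :
    ∑ i ∈ Finset.Icc 1 D, wt b n (n + c + 1) (Q ^ i) ≤
      (if dg k Q = ud k Q then wt b n (n + c + 1) Q else 0) +
        2 * CC k c (Fintype.card ι) * ((Nat.card k : ℝ)⁻¹) ^ (2 * ud k Q) := by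
  have hq := qpos k
  have : Module.Finite k[X] O := Module.Finite.of_basis b
  set x := (Nat.card k : ℝ)⁻¹ with hx
  have hx0 : 0 < x := by positivity
  have hx2 : x ≤ 1 / 2 := inv_q_le k
  set C := CC k c (Fintype.card ι) with hC
  have hC1 : 1 ≤ C := CC_pos k c _
  have hwt : ∀ i, wt b n (n + c + 1) (Q ^ i) ≤ C * (x ^ dg k Q) ^ i := by
    intro i
    have := wt_le b h1c hc n hd (Q ^ i) (pow_ne_zero i hQ0)
    rwa [dg_pow Q hQ0, mul_comm i, pow_mul] at this
  have hdg := dg_pos (k := k) hQ hQ0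
  have hud := ud_pos (k := k) hQ hQ0
  have hy0 : 0 ≤ x ^ dg k Q := by positivity
  have hy : x ^ dg k Q ≤ 1 / 2 :=
    (pow_le_of_le_one hx0.le (hx2.trans (by norm_num)) (by omega)).trans hx2
  split_ifs with h
  · rcases Nat.eq_zero_or_pos D with rfl | hD
    · have := wt_nonneg b n (n + c + 1) Q
      simp only [Nat.lt_one_iff, Finset.Icc_eq_empty_of_lt, Finset.sum_empty]
      positivity
    rw [← Finset.add_sum_Ioc_eq_sum_Icc (by omega), pow_one]
    gcongr
    have e : Finset.Ioc 1 D = (Finset.Icc 1 (D - 1)).image (· + 1) := by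
      ext i; simp only [Finset.mem_Ioc, Finset.mem_image, Finset.mem_Icc]
      constructor
      · intro hi; exact ⟨i - 1, by omega, by omega⟩
      · rintro ⟨a, ha, rfl⟩; omega
    rw [e, Finset.sum_image (by intro a _ b _ h; simpa using h)]
    calc _ ≤ ∑ i ∈ Finset.Icc 1 (D - 1), C * x ^ dg k Q * (x ^ dg k Q) ^ i :=
          Finset.sum_le_sum fun i _ => (hwt (i + 1)).trans (le_of_eq (by ring))
      _ = C * x ^ dg k Q * ∑ i ∈ Finset.Icc 1 (D - 1), (x ^ dg k Q) ^ i := by rw [Finset.mul_sum]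
      _ ≤ C * x ^ dg k Q * (2 * x ^ dg k Q) :=
          mul_le_mul_of_nonneg_left (geom_tail _ hy0 hy _) (by positivity)
      _ = _ := by rw [h]; ring
  · rw [zero_add]
    obtain ⟨f, hf⟩ := ud_dvd (k := k) hQ hQ0
    have hf2 : 2 ≤ f := by
      rcases f with _ | _ | f
      · omega
      · omega
      · omega
    have h2 : 2 * ud k Q ≤ dg k Q := by rw [hf]; nlinarith
    calc _ ≤ ∑ i ∈ Finset.Icc 1 D, C * (x ^ dg k Q) ^ i := Finset.sum_le_sum fun i _ => hwt i
      _ = C * ∑ i ∈ Finset.Icc 1 D, (x ^ dg k Q) ^ i := by rw [Finset.mul_sum]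
      _ ≤ C * (2 * x ^ dg k Q) := mul_le_mul_of_nonneg_left (geom_tail _ hy0 hy _) (by positivity)
      _ = 2 * C * x ^ dg k Q := by ring
      _ ≤ _ := by
        refine mul_le_mul_of_nonneg_left ?_ (by positivity)
        exact pow_le_pow_of_le_one hx0.le (hx2.trans (by norm_num)) h2

/-- Mertens type estimate -/
theorem mertens (b : Module.Basis ι k[X] O) : ∃ C : ℝ, ∀ (M : ℕ) (T : Finset (Ideal O)),
    (∀ Q, Q ∈ T ↔ Q.IsPrime ∧ Q ≠ ⊥ ∧ dg k Q = ud k Q ∧ dg k Q ≤ M) →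
    |∑ Q ∈ T, (dg k Q : ℝ) * ((Nat.card k : ℝ)⁻¹) ^ dg k Q - M| ≤ C := by
  classical
  obtain ⟨c, h1c, hc⟩ := exists_mul_bound b
  have hq := qpos k
  have : Module.Finite k[X] O := Module.Finite.of_basis b
  have hd : 0 < Fintype.card ι := by
    rw [Fintype.card_pos_iff]
    by_contra h
    rw [not_nonempty_iff] at h
    have := b.repr.toEquiv.subsingleton
    exact not_subsingleton O this
  set d := Fintype.card ι with hdd
  set x := (Nat.card k : ℝ)⁻¹ with hx
  have hqx : (Nat.card k : ℝ) * x = 1 := by rw [hx]; field_simp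
  have hx0 : 0 < x := by positivity
  have hx2 : x ≤ 1 / 2 := inv_q_le k
  set C := CC k c d with hC
  have hC1 : 1 ≤ C := CC_pos k c _
  set c2 := (c + 1) * d * d with hc2
  set c4 := (2 + 3 * c) * d with hc4
  have tot := total b h1c hc
  refine ⟨(c2 + d + c4) + (d + 2 * C * d + C * d * (c2 + c4)), fun M T hT => ?_⟩
  set B := ∑ Q ∈ T, (dg k Q : ℝ) * x ^ dg k Q with hB
  have hsfin : ∀ n, ∃ s : Finset (Ideal O), ∀ Q, Q ∈ s ↔ Q.IsPrime ∧ Q ≠ ⊥ ∧ dg k Q ≤ n * d + c4 := by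
    intro n
    refine ⟨(Set.Finite.subset (t := {Q | Q.IsPrime ∧ Q ≠ ⊥ ∧ dg k Q ≤ n * d + c4})
      (finite_dg_le (k := k) (O := O) (n * d + c4)) (fun Q h => h.2)).toFinset, ?_⟩
    intro Q; simp
  have hupper : B ≤ M + (c2 + d + c4) := by
    set n := (M + c2) / d + 1 with hn
    have e1 : M + c2 ≤ n * d := by
      have h1 := Nat.div_add_mod (M + c2) d
      have h2 := Nat.mod_lt (M + c2) hd
      have h3 : n * d = d * ((M + c2) / d) + d := by rw [hn]; ring
      omega
    have e2 : n * d ≤ M + c2 + d := by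
      have h1 := Nat.div_mul_le_self (M + c2) d
      rw [hn, add_mul, one_mul]
      omega
    obtain ⟨s, hs⟩ := hsfin n
    have h1 : ∑ Q ∈ s, ∑ i ∈ Finset.Icc 1 (n * d + c4), (dg k Q : ℝ) * wt b n (n + c + 1) (Q ^ i) ≤
        ((n * d + c4 : ℕ) : ℝ) := (tot n s hs).2
    have h2 : B ≤ ∑ Q ∈ s, ∑ i ∈ Finset.Icc 1 (n * d + c4), (dg k Q : ℝ) * wt b n (n + c + 1) (Q ^ i) := by
      have hTs : T ⊆ s := by
        intro Q hQ
        obtain ⟨a1, a2, a3, a4⟩ := (hT Q).mp hQ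
        exact (hs Q).mpr ⟨a1, a2, by omega⟩
      have hnn : ∀ Q : Ideal O, ∀ i : ℕ, 0 ≤ (dg k Q : ℝ) * wt b n (n + c + 1) (Q ^ i) := fun Q i =>
        mul_nonneg (by positivity) (wt_nonneg b _ _ _)
      refine le_trans ?_ (Finset.sum_le_sum_of_subset_of_nonneg hTs
        (fun Q _ _ => Finset.sum_nonneg fun i _ => hnn Q i))
      refine Finset.sum_le_sum fun Q hQ => ?_
      obtain ⟨a1, a2, a3, a4⟩ := (hT Q).mp hQ
      have h3 : (dg k Q : ℝ) * x ^ dg k Q = (dg k Q : ℝ) * wt b n (n + c + 1) (Q ^ 1) := by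
        rw [pow_one, wt_eq b hc n _ hd Q a2 ((Nat.add_le_add_right a4 c2).trans e1)]
      rw [h3]
      have := dg_pos (k := k) a1 a2
      exact Finset.single_le_sum (f := fun i => (dg k Q : ℝ) * wt b n (n + c + 1) (Q ^ i))
        (fun i _ => hnn Q i) (Finset.mem_Icc.mpr ⟨le_rfl, by omega⟩)
    have h3 : ((n * d + c4 : ℕ) : ℝ) ≤ ((M + (c2 + d + c4) : ℕ) : ℝ) := by
      exact_mod_cast (by omega)
    push_cast at h3
    push_cast at h1
    linarith
  have hlower : (M : ℝ) ≤ B + (d + 2 * C * d + C * d * (c2 + c4)) := by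
    set n := M / d with hn
    have e1 : n * d ≤ M := Nat.div_mul_le_self M d
    have e2 : M ≤ n * d + d := by
      have h1 := Nat.div_add_mod M d
      have h2 := Nat.mod_lt M hd
      have h3 : d * (M / d) = n * d := mul_comm _ _
      omega
    obtain ⟨s, hs⟩ := hsfin n
    have h1 : (n * d : ℝ) ≤ ∑ Q ∈ s, ∑ i ∈ Finset.Icc 1 (n * d + c4), (dg k Q : ℝ) * wt b n (n + c + 1) (Q ^ i) :=
        (tot n s hs).1
    have hsp : ∀ Q ∈ s, Q.IsPrime ∧ Q ≠ ⊥ := fun Q hQ => ⟨((hs Q).mp hQ).1, ((hs Q).mp hQ).2.1⟩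
    have hudle : ∀ Q ∈ s, ud k Q ≤ dg k Q := fun Q hQ =>
      Nat.le_of_dvd (dg_pos (hsp Q hQ).1 (hsp Q hQ).2) (ud_dvd (hsp Q hQ).1 (hsp Q hQ).2)
    have h2 : ∑ Q ∈ s, ∑ i ∈ Finset.Icc 1 (n * d + c4), (dg k Q : ℝ) * wt b n (n + c + 1) (Q ^ i) ≤
        ∑ Q ∈ s, ((if dg k Q = ud k Q ∧ dg k Q + c2 ≤ n * d then (dg k Q : ℝ) * x ^ dg k Q else 0) +
          (if dg k Q = ud k Q ∧ ¬ (dg k Q + c2 ≤ n * d) then (dg k Q : ℝ) * (C * x ^ ud k Q) else 0) +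
          (dg k Q : ℝ) * (2 * C * x ^ (2 * ud k Q))) := by
      refine Finset.sum_le_sum fun Q hQ => ?_
      rw [← Finset.mul_sum]
      refine (mul_le_mul_of_nonneg_left (per_prime b h1c hc n (n * d + c4) hd Q (hsp Q hQ).1 (hsp Q hQ).2)
        (by positivity)).trans ?_
      rw [mul_add]
      gcongr
      by_cases g1 : dg k Q = ud k Q
      · by_cases g2 : dg k Q + c2 ≤ n * d
        · rw [if_pos g1, if_pos ⟨g1, g2⟩, if_neg (by tauto), wt_eq b hc n _ hd Q (hsp Q hQ).2 g2, add_zero]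
        · rw [if_pos g1, if_neg (by tauto), if_pos ⟨g1, g2⟩, zero_add, ← g1]
          exact mul_le_mul_of_nonneg_left (wt_le b h1c hc n hd Q (hsp Q hQ).2) (by positivity)
      · rw [if_neg g1, if_neg (by tauto), if_neg (by tauto)]; simp
    rw [Finset.sum_add_distrib, Finset.sum_add_distrib] at h2
    have p1 : ∑ Q ∈ s, (if dg k Q = ud k Q ∧ dg k Q + c2 ≤ n * d then (dg k Q : ℝ) * x ^ dg k Q else 0) ≤ B := by
      rw [← Finset.sum_filter]
      refine Finset.sum_le_sum_of_subset_of_nonneg ?_ (fun Q _ _ => by positivity)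
      intro Q hQ
      rw [Finset.mem_filter] at hQ
      exact (hT Q).mpr ⟨(hsp Q hQ.1).1, (hsp Q hQ.1).2, hQ.2.1, by omega⟩
    have p2 : ∑ Q ∈ s, (if dg k Q = ud k Q ∧ ¬ (dg k Q + c2 ≤ n * d) then (dg k Q : ℝ) * (C * x ^ ud k Q) else 0)
        ≤ C * d * (c2 + c4) := by
      rw [← Finset.sum_filter]
      refine (sum_le_j b _ (fun Q hQ => hsp Q (Finset.mem_filter.mp hQ).1)
        (Finset.Ioc (n * d - c2) (n * d + c4)) ?_ (fun j => C * x ^ j) (fun j => by positivity)).trans ?_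
      · intro Q hQ
        rw [Finset.mem_filter] at hQ
        have := ((hs Q).mp hQ.1).2.2
        have := ud_pos (k := k) (hsp Q hQ.1).1 (hsp Q hQ.1).2
        rw [Finset.mem_Ioc]; omega
      · have : ∀ j, (Nat.card k : ℝ) ^ j * (C * x ^ j) = C := by
          intro j
          have : (Nat.card k : ℝ) ^ j * x ^ j = 1 := by rw [← mul_pow, hqx, one_pow]
          linear_combination C * this
        simp_rw [this]
        rw [Finset.sum_const, Nat.card_Ioc, nsmul_eq_mul]
        have hh : ((n * d + c4 - (n * d - c2) : ℕ) : ℝ) ≤ c2 + c4 := by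
          exact_mod_cast (by omega)
        have : (d : ℝ) * (((n * d + c4 - (n * d - c2) : ℕ) : ℝ) * C) ≤ d * ((c2 + c4) * C) := by gcongr
        refine this.trans (le_of_eq (by ring))
    have p3 : ∑ Q ∈ s, (dg k Q : ℝ) * (2 * C * x ^ (2 * ud k Q)) ≤ 2 * C * d := by
      refine (sum_le_j b s hsp (Finset.Icc 1 (n * d + c4)) ?_ (fun j => 2 * C * x ^ (2 * j))
        (fun j => by positivity)).trans ?_
      · intro Q hQ
        have h3 := ((hs Q).mp hQ).2.2
        have h4 := hudle Q hQ
        exact Finset.mem_Icc.mpr ⟨ud_pos (hsp Q hQ).1 (hsp Q hQ).2, by omega⟩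
      · have : ∀ j, (Nat.card k : ℝ) ^ j * (2 * C * x ^ (2 * j)) = 2 * C * x ^ j := by
          intro j
          have : (Nat.card k : ℝ) ^ j * x ^ j = 1 := by rw [← mul_pow, hqx, one_pow]
          rw [two_mul j, pow_add]
          linear_combination 2 * C * x ^ j * this
        simp_rw [this]
        rw [← Finset.mul_sum]
        have h5 := geom_tail x hx0.le hx2 (n * d + c4)
        have : ∑ i ∈ Finset.Icc 1 (n * d + c4), x ^ i ≤ 1 := by linarith
        calc (d : ℝ) * (2 * C * ∑ i ∈ Finset.Icc 1 (n * d + c4), x ^ i) ≤ d * (2 * C * 1) := by gcongr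
          _ = _ := by ring
    have h3 : (M : ℝ) ≤ n * d + d := by exact_mod_cast e2
    linarith
  have n1 : (0:ℝ) ≤ c2 + d + c4 := by positivity
  have n2 : (0:ℝ) ≤ d + 2 * C * d + C * d * (c2 + c4) := by positivity
  rw [abs_le]
  constructor <;> linarith

end mertens
end Gass

namespace Gass
open Polynomial
set_option linter.unusedSectionVars false
open scoped Pointwise

section loc
variable {k R B Γ : Type*} [Field k] [Finite k] [CommRing R] [IsDedekindDomain R] [Algebra k R]
  [Ring.HasFiniteQuotients R]
  [CommRing B] [IsDedekindDomain B] [Algebra k B] [Ring.HasFiniteQuotients B]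
  [Algebra R B] [FaithfulSMul R B] [Module.Finite R B] [Group Γ] [Finite Γ] [MulSemiringAction Γ B]
  [IsGaloisGroup Γ R B]

lemma stab_card {P : Ideal B} (hp : P.IsPrime) (hb : P ≠ ⊥)
    (hg : ∀ g : Γ, g ≠ 1 → ∃ x : B, g • x - x ∉ P) :
    Nat.card (MulAction.stabilizer Γ P) * dg k (P.under R) = dg k P := by
  have h1 := hp.isMaximal hb
  have h2 : P.under R ≠ ⊥ := Ideal.IsIntegral.comap_ne_bot R hb
  have h3 : (P.under R).IsMaximal := Ideal.IsMaximal.under R P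
  have := finite_quot k hb
  have := finite_quot k h2
  have hf : Finite (R ⧸ P.under R) := Module.finite_of_finite k
  have : Finite (P.under R).ResidueField :=
    Finite.of_surjective _ (Ideal.bijective_algebraMap_quotient_residueField (P.under R)).2
  have e := Ideal.card_stabilizer_eq_card_inertia_mul_finrank (G := Γ) (P.under R) P
  have hi : Nat.card (Ideal.inertia Γ P) = 1 := by
    rw [Subgroup.card_eq_one, eq_bot_iff]
    intro g hgi
    by_contra hne
    obtain ⟨x, hx⟩ := hg g hne
    exact hx (AddSubgroup.mem_inertia.mp hgi x)
  rw [hi, one_mul] at e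
  have := Ideal.cardQuot_pow_inertiaDeg (P.under R) P
  rw [card_quot (k := k), card_quot (k := k), ← pow_mul] at this
  rw [e, mul_comm]
  exact Nat.pow_right_injective (one_lt_q k) this

lemma fiber_sum (Q : Ideal R) (hQ : Q.IsPrime) (s : Finset (Ideal B))
    (hs : ∀ P, P ∈ s ↔ P.IsPrime ∧ P.under R = Q) :
    ∑ P ∈ s, Nat.card (MulAction.stabilizer Γ P) = Nat.card Γ := by
  have hinj : RingHom.ker (algebraMap R B) ≤ Q := by
    rw [(RingHom.injective_iff_ker_eq_bot _).mp (FaithfulSMul.algebraMap_injective R B)]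
    exact bot_le
  obtain ⟨P0, hP0, e0⟩ := Ideal.exists_ideal_over_prime_of_isIntegral_of_isDomain (S := B) Q hinj
  have : P0.LiesOver Q := ⟨e0.symm⟩
  have h1 := Algebra.IsInvariant.orbit_eq_primesOver R B Γ Q P0
  have h2 : (s : Set (Ideal B)) = MulAction.orbit Γ P0 := by
    rw [h1]
    ext P
    simp only [Finset.mem_coe, hs, Ideal.primesOver, Set.mem_ofPred_eq]
    exact and_congr_right fun _ => ⟨fun h => ⟨h.symm⟩, fun h => h.over.symm⟩
  have h3 : ∀ P ∈ s, Nat.card (MulAction.stabilizer Γ P) = Nat.card (MulAction.stabilizer Γ P0) := by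
    intro P hP
    have : P ∈ MulAction.orbit Γ P0 := by rw [← h2]; exact hP
    exact Nat.card_congr (MulAction.stabilizerEquivStabilizerOfOrbitRel this).toEquiv
  rw [Finset.sum_congr rfl h3, Finset.sum_const, smul_eq_mul]
  have h4 := Nat.card_congr (MulAction.orbitProdStabilizerEquivGroup Γ P0)
  rw [Nat.card_prod, ← h2] at h4
  simpa using h4

end loc

section good
variable {B G : Type*} [CommRing B] [IsDedekindDomain B]
  [Ring.HasFiniteQuotients B]
  [Group G] [Finite G] [MulSemiringAction G B]

/-- unramified primes -/
def good (G : Type*) {B : Type*} [CommRing B] [Group G] [MulSemiringAction G B] (P : Ideal B) : Prop :=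
  P.IsPrime ∧ P ≠ ⊥ ∧ ∀ g : G, g ≠ 1 → ∃ x : B, g • x - x ∉ P

lemma good_smul {P : Ideal B} (h : G) (hg : good G P) : good G (h • P) := by
  obtain ⟨h1, h2, h3⟩ := hg
  refine ⟨Ideal.IsPrime.smul h , ?_, ?_⟩
  · intro e
    apply h2
    rw [eq_inv_smul_iff.mpr e]
    simp 
  · intro g hg
    obtain ⟨x, hx⟩ := h3 (h⁻¹ * g * h) (by
      intro e
      apply hg
      have : g = h * (h⁻¹ * g * h) * h⁻¹ := by group
      rw [this, e]; simp)
    refine ⟨h • x, fun hm => hx ?_⟩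
    rw [Ideal.mem_pointwise_smul_iff_inv_smul_mem] at hm
    simpa [smul_sub, mul_smul] using hm

lemma bad_finite (k : Type*) [Field k] [Finite k] [Algebra k[X] B] [Algebra k B]
    [IsScalarTower k k[X] B] [FaithfulSMul G B] :
    {P : Ideal B | P.IsPrime ∧ P ≠ ⊥ ∧ ¬ good G P}.Finite := by
  have : ∀ g : G, g ≠ 1 → ∃ x : B, g • x - x ≠ 0 := by
    intro g hg
    by_contra h
    push Not at h
    exact hg (FaithfulSMul.eq_of_smul_eq_smul (α := B) fun x => by
      rw [one_smul]; exact sub_eq_zero.mp (h x))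
  choose! f hf using this
  have hfin : (⋃ g ∈ {g : G | g ≠ 1}, {P : Ideal B | P ≠ ⊥ ∧ dg k P ≤ dg k (Ideal.span {g • f g - f g})}).Finite :=
    Set.Finite.biUnion (Set.toFinite _) fun g _ => finite_dg_le _
  refine hfin.subset ?_
  rintro P ⟨h1, h2, h3⟩
  simp only [good, h1, h2, true_and, not_false_eq_true, ne_eq, not_forall, not_exists, not_not] at h3
  obtain ⟨g, hg, hx⟩ := h3
  simp only [Set.mem_iUnion]
  refine ⟨g, hg, h2, ?_⟩
  have := finite_quot k (I := Ideal.span {g • f g - f g}) (by simpa using hf g hg)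
  exact dg_le_of_le (by rw [Ideal.span_singleton_le_iff_mem]; exact hx _)

end good
end Gass

namespace Gass
open Polynomial
set_option linter.unusedSectionVars false
open scoped Pointwise

section perH
variable {k R B G ι : Type*} [Field k] [Finite k] [CommRing R] [IsDedekindDomain R] [Algebra k R]
  [Algebra k[X] R] [IsScalarTower k k[X] R] [Ring.HasFiniteQuotients R]
  [CommRing B] [IsDedekindDomain B] [Algebra k B] [Algebra k[X] B] [IsScalarTower k k[X] B]
  [Ring.HasFiniteQuotients B] [Module.Finite k[X] B] [FaithfulSMul k[X] B]
  [Algebra R B] [FaithfulSMul R B] [Module.Finite R B] [IsScalarTower k[X] R B]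
  [Group G] [Finite G] [MulSemiringAction G B]
  [IsGaloisGroup G k[X] B] {H : Subgroup G} [IsGaloisGroup H R B] [Fintype ι]

lemma stab_sub (P : Ideal B) : Nat.card (MulAction.stabilizer H P) =
    Nat.card (MulAction.stabilizer G P ⊓ H : Subgroup G) := by
  have : MulAction.stabilizer H P = (MulAction.stabilizer G P).subgroupOf H := by
    ext h
    rfl
  rw [this, ← Subgroup.subgroupOf_map_subtype]
  exact (Subgroup.card_map_of_injective H.subtype_injective).symm

lemma ud_under (P : Ideal B) : ud k (P.under R) = ud k P := by
  rw [ud, ud, Ideal.under_under]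

lemma good_key {P : Ideal B} (hP : good G P) :
    dg k (P.under R) = ud k (P.under R) ↔ MulAction.stabilizer G P ≤ H := by
  obtain ⟨h1, h2, h3⟩ := hP
  have := finq_poly k
  have e1 : Nat.card (MulAction.stabilizer G P) * ud k P = dg k P := stab_card h1 h2 h3
  have e2 : Nat.card (MulAction.stabilizer H P) * dg k (P.under R) = dg k P :=
    stab_card h1 h2 (fun g hg => h3 g (by simpa using hg))
  rw [stab_sub] at e2
  have hu : 1 ≤ ud k P := ud_pos h1 h2
  rw [ud_under]
  constructor
  · intro h
    rw [h, ← e1] at e2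
    have := Nat.eq_of_mul_eq_mul_right hu e2
    have := Subgroup.eq_of_le_of_card_ge (inf_le_left : MulAction.stabilizer G P ⊓ H ≤ _) this.ge
    exact inf_eq_left.mp this
  · intro h
    rw [inf_eq_left.mpr h, ← e1] at e2
    exact Nat.eq_of_mul_eq_mul_left Nat.card_pos e2

lemma exists_over (Q : Ideal R) (hQ : Q.IsPrime) : ∃ P : Ideal B, P.IsPrime ∧ P.under R = Q := by
  have hinj : RingHom.ker (algebraMap R B) ≤ Q := by
    rw [(RingHom.injective_iff_ker_eq_bot _).mp (FaithfulSMul.algebraMap_injective R B)]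
    exact bot_le
  obtain ⟨P0, hP0, e0⟩ := Ideal.exists_ideal_over_prime_of_isIntegral_of_isDomain (S := B) Q hinj
  exact ⟨P0, hP0, e0⟩

variable (G) in
theorem sum_H (b : Module.Basis ι k[X] R) (H : Subgroup G) [IsGaloisGroup H R B] :
    ∃ C : ℝ, ∀ (M : ℕ) (S : Finset (Ideal B)),
      (∀ P, P ∈ S ↔ good G P ∧ ud k P ≤ M ∧ MulAction.stabilizer G P ≤ H) →
      |∑ P ∈ S, (Nat.card (MulAction.stabilizer G P) : ℝ) *
        (ud k P * ((Nat.card k : ℝ)⁻¹) ^ ud k P) - Nat.card H * M| ≤ C := by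
  classical
  obtain ⟨C, hC⟩ := mertens b
  have : FaithfulSMul G B := IsGaloisGroup.faithful k[X]
  have : Module.Finite k[X] R := Module.Finite.of_basis b
  set E : Finset (Ideal R) := (bad_finite (G := G) (B := B) k).toFinset.image (fun P => P.under R) with hE
  set w : Ideal R → ℝ := fun Q => (dg k Q : ℝ) * ((Nat.card k : ℝ)⁻¹) ^ dg k Q with hw
  have hw0 : ∀ Q, 0 ≤ w Q := fun Q => by positivity
  refine ⟨Nat.card H * (C + ∑ Q ∈ E, w Q), fun M S hS => ?_⟩
  have hTf : {Q : Ideal R | Q.IsPrime ∧ Q ≠ ⊥ ∧ dg k Q = ud k Q ∧ dg k Q ≤ M}.Finite :=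
    (finite_dg_le (k := k) (O := R) M).subset fun Q hQ => ⟨hQ.2.1, hQ.2.2.2⟩
  set T := hTf.toFinset with hTdef
  have hT : ∀ Q, Q ∈ T ↔ Q.IsPrime ∧ Q ≠ ⊥ ∧ dg k Q = ud k Q ∧ dg k Q ≤ M := by simp [hTdef]
  have hb := hC M T hT
  set T' := S.image (fun P => P.under R) with hT'
  have hsub : T' ⊆ T := by
    intro Q hQ
    obtain ⟨P, hP, rfl⟩ := Finset.mem_image.mp hQ
    obtain ⟨h1, h2, h3⟩ := (hS P).mp hP
    have h4 := (good_key (k := k) (R := R) h1).mpr h3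
    have := h1.1
    exact (hT _).mpr ⟨this.under R, Ideal.IsIntegral.comap_ne_bot R h1.2.1, h4,
      by rw [h4, ud_under]; exact h2⟩
  have hdiff : T \ T' ⊆ E := by
    intro Q hQ
    rw [Finset.mem_sdiff] at hQ
    obtain ⟨hQ1, hQ2⟩ := hQ
    obtain ⟨q1, q2, q3, q4⟩ := (hT Q).mp hQ1
    obtain ⟨P, hP, rfl⟩ := exists_over (B := B) Q q1
    have hPb : P ≠ ⊥ := by
      rintro rfl
      apply q2
      rw [eq_bot_iff]
      intro r hr
      have : algebraMap R B r = 0 := hr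
      simpa using this
    refine Finset.mem_image.mpr ⟨P, ?_, rfl⟩
    simp only [Set.Finite.mem_toFinset, Set.mem_ofPred_eq]
    refine ⟨hP, hPb, fun hg => hQ2 (Finset.mem_image.mpr ⟨P, ?_, rfl⟩)⟩
    refine (hS P).mpr ⟨hg, ?_, (good_key (k := k) (R := R) hg).mp q3⟩
    rw [← ud_under (R := R), ← q3]; exact q4
  have hsum : ∑ P ∈ S, (Nat.card (MulAction.stabilizer G P) : ℝ) *
        (ud k P * ((Nat.card k : ℝ)⁻¹) ^ ud k P) = Nat.card H * ∑ Q ∈ T', w Q := by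
    rw [← Finset.sum_fiberwise_of_maps_to (s := S) (t := T') (g := fun P => P.under R)
      (fun P hP => Finset.mem_image_of_mem _ hP), Finset.mul_sum]
    refine Finset.sum_congr rfl fun Q hQ => ?_
    have hQ' := (hT Q).mp (hsub hQ)
    have hf := fiber_sum (B := B) (Γ := H) Q hQ'.1 (S.filter (fun P => P.under R = Q)) (by
      intro P
      rw [Finset.mem_filter]
      constructor
      · rintro ⟨h1, h2⟩
        exact ⟨((hS P).mp h1).1.1, h2⟩
      · rintro ⟨h1, h2⟩
        refine ⟨?_, h2⟩
        obtain ⟨P0, hP0, e0⟩ := Finset.mem_image.mp hQ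
        have hg0 := ((hS P0).mp hP0).1
        have := hg0.1
        obtain ⟨h, hh⟩ := Algebra.IsInvariant.exists_smul_of_under_eq R B H P0 P (e0.trans h2.symm)
        have hg : good G P := by
          rw [hh]; exact good_smul (h : G) hg0
        refine (hS P).mpr ⟨hg, ?_, ?_⟩
        · rw [← ud_under (R := R), h2, ← hQ'.2.2.1]; exact hQ'.2.2.2
        · rw [← good_key (k := k) (R := R) hg, h2]; exact hQ'.2.2.1)
    have hf2 : ∑ P ∈ S with P.under R = Q, Nat.card (MulAction.stabilizer H P) = Nat.card H := hf
    rw [← hf2, Nat.cast_sum, Finset.sum_mul]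
    refine Finset.sum_congr rfl fun P hP => ?_
    rw [Finset.mem_filter] at hP
    rw [stab_sub, inf_eq_left.mpr ((hS P).mp hP.1).2.2, hw, ← ud_under (R := R) P, hP.2]
    simp only [hQ'.2.2.1]
  have hsplit := Finset.sum_sdiff (f := w) hsub
  have h5 : ∑ Q ∈ T \ T', w Q ≤ ∑ Q ∈ E, w Q :=
    Finset.sum_le_sum_of_subset_of_nonneg hdiff fun Q _ _ => hw0 Q
  have h6 : 0 ≤ ∑ Q ∈ T \ T', w Q := Finset.sum_nonneg fun Q _ => hw0 Q
  rw [hsum, ← mul_sub, abs_mul, Nat.abs_cast]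
  refine mul_le_mul_of_nonneg_left ?_ (by positivity)
  change |∑ Q ∈ T, w Q - M| ≤ C at hb
  rw [abs_le] at hb ⊢
  constructor <;> linarith

end perH
end Gass

namespace Gass
open Polynomial
set_option linter.unusedSectionVars false
open scoped Pointwise

section fixedring
variable {k B G : Type*} [Field k] [Finite k]
  [CommRing B] [IsDedekindDomain B] [Algebra k B] [Algebra k[X] B] [IsScalarTower k k[X] B]
  [Ring.HasFiniteQuotients B] [Module.Finite k[X] B] [FaithfulSMul k[X] B]
  [Group G] [Finite G] [MulSemiringAction G B]
  [IsGaloisGroup G k[X] B]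

lemma fixed_ic (H : Subgroup G) : IsIntegrallyClosed (FixedPoints.subalgebra k[X] B H) := by
  set R := FixedPoints.subalgebra k[X] B H with hR
  have hRd : IsDomain R := inferInstance
  let _ := FractionRing.liftAlgebra R (FractionRing B)
  rw [isIntegrallyClosed_iff (FractionRing R)]
  intro z hz
  obtain ⟨a, b, rfl⟩ := IsLocalization.exists_mk'_eq (nonZeroDivisors R) z
  have h1 : IsIntegral R (algebraMap (FractionRing R) (FractionRing B) (IsLocalization.mk' _ a b)) :=
    hz.algebraMap
  have h2 : IsIntegral B (algebraMap (FractionRing R) (FractionRing B) (IsLocalization.mk' _ a b)) :=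
    h1.tower_top
  obtain ⟨y, hy⟩ := IsIntegrallyClosed.isIntegral_iff.mp h2
  have h3 : y * (b : R) = (a : B) := by
    apply IsFractionRing.injective B (FractionRing B)
    rw [map_mul, hy]
    have e := IsLocalization.mk'_spec (FractionRing R) a b
    have e' := congrArg (algebraMap (FractionRing R) (FractionRing B)) e
    rw [map_mul, ← IsScalarTower.algebraMap_apply, ← IsScalarTower.algebraMap_apply,
      IsScalarTower.algebraMap_apply R B (FractionRing B),
      IsScalarTower.algebraMap_apply R B (FractionRing B)] at e'
    exact e'
  have hb0 : ((b : R) : B) ≠ 0 := by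
    have := nonZeroDivisors.coe_ne_zero b
    simpa using this
  have hfix : ∀ h : H, h • y = y := by
    intro h
    have ha : h • (a : B) = a := a.2 h
    have hb : h • ((b : R) : B) = (b : R) := (b : R).2 h
    have := congrArg (fun t => h • t) h3
    simp only [smul_mul'] at this
    rw [ha, hb, ← h3] at this
    exact mul_right_cancel₀ hb0 this
  refine ⟨⟨y, hfix⟩, ?_⟩
  rw [IsLocalization.eq_mk'_iff_mul_eq, ← map_mul]
  congr 1
  exact Subtype.ext h3

variable (k) in
theorem sum_all (H : Subgroup G) :
    ∃ C : ℝ, ∀ (M : ℕ) (S : Finset (Ideal B)),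
      (∀ P, P ∈ S ↔ good G P ∧ ud k P ≤ M ∧ MulAction.stabilizer G P ≤ H) →
      |∑ P ∈ S, (Nat.card (MulAction.stabilizer G P) : ℝ) *
        (ud k P * ((Nat.card k : ℝ)⁻¹) ^ ud k P) - Nat.card H * M| ≤ C := by
  have := fixed_ic (k := k) (B := B) H
  have hfin : Module.Finite k[X] (FixedPoints.subalgebra k[X] B H) := 
    inferInstanceAs (Module.Finite k[X] (Subalgebra.toSubmodule (FixedPoints.subalgebra k[X] B H)))
  have := finq_poly k
  have : Module.IsTorsionFree k[X] B := by
    rw [Module.isTorsionFree_iff_faithfulSMul]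
    infer_instance
  have : Module.IsTorsionFree k[X] (FixedPoints.subalgebra k[X] B H) := 
    inferInstanceAs (Module.IsTorsionFree k[X] (Subalgebra.toSubmodule (FixedPoints.subalgebra k[X] B H)))
  have : Ring.HasFiniteQuotients (FixedPoints.subalgebra k[X] B H) :=
    Ring.HasFiniteQuotients.of_module_finite k[X] _
  have : IsNoetherianRing (FixedPoints.subalgebra k[X] B H) := IsNoetherianRing.of_finite k[X] _
  have : IsDedekindDomain (FixedPoints.subalgebra k[X] B H) := {}
  have : Module.Finite (FixedPoints.subalgebra k[X] B H) B := Module.Finite.of_restrictScalars_finite k[X] _ _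
  exact sum_H (R := FixedPoints.subalgebra k[X] B H) G (Module.finBasis k[X] (FixedPoints.subalgebra k[X] B H)) H

end fixedring
end Gass

namespace Gass
open Polynomial
set_option linter.unusedSectionVars false
open scoped Pointwise

open Classical in
lemma mobius_bound {G : Type*} [Group G] [Finite G] [Fintype (Subgroup G)] (a : Subgroup G → ℕ → ℝ)
    (h : ∀ H : Subgroup G, ∃ C : ℝ, ∀ M : ℕ, |∑ D with D ≤ H, a D M - Nat.card H * M| ≤ C)
    (H : Subgroup G) : ∃ C : ℝ, ∀ M : ℕ,
      |a H M - Nat.card {g : G // Subgroup.zpowers g = H} * M| ≤ C := by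
  have := Fintype.ofFinite G
  have hc : ∀ H : Subgroup G, (Nat.card H : ℝ) =
      ∑ D with D ≤ H, (Nat.card {g : G // Subgroup.zpowers g = D} : ℝ) := by
    intro H
    have h1 : Nat.card H = ∑ D with D ≤ H, Nat.card {g : G // Subgroup.zpowers g = D} := by
      have h2 : Nat.card H = (Finset.univ.filter (fun g : G => g ∈ H)).card := by
        rw [Nat.card_eq_fintype_card, Fintype.card_subtype]
      rw [h2, Finset.card_eq_sum_card_fiberwise (f := fun g => Subgroup.zpowers g)
        (t := Finset.univ.filter (fun D => D ≤ H))]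
      · refine Finset.sum_congr rfl fun D hD => ?_
        rw [Nat.card_eq_fintype_card, Fintype.card_subtype]
        congr 1
        ext g
        simp only [Finset.mem_filter, Finset.mem_univ, true_and, and_iff_right_iff_imp] at hD ⊢
        rintro rfl
        exact hD (Subgroup.mem_zpowers g)
      · intro g hg
        simpa using hg
    rw [h1]; push_cast; rfl
  induction H using WellFoundedLT.induction with
  | ind H ih =>
    choose! C hC using ih
    obtain ⟨C0, hC0⟩ := h H
    refine ⟨C0 + ∑ D with D < H, C D, fun M => ?_⟩
    have hins : (Finset.univ.filter (fun D => D ≤ H)) = insert H (Finset.univ.filter (fun D => D < H)) := by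
      ext D
      simp [le_iff_eq_or_lt]
    have h1 := hC0 M
    rw [hc, hins, Finset.sum_insert (by simp), Finset.sum_insert (by simp)] at h1
    have h2 : |∑ D with D < H, (a D M - Nat.card {g : G // Subgroup.zpowers g = D} * M)| ≤
        ∑ D with D < H, C D :=
      (Finset.abs_sum_le_sum_abs _ _).trans
        (Finset.sum_le_sum fun D hD => hC D (Finset.mem_filter.mp hD).2 M)
    rw [Finset.sum_sub_distrib, ← Finset.sum_mul] at h2
    rw [abs_le] at h1 h2 ⊢
    constructor <;> linarith [h1.1, h1.2, h2.1, h2.2]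

section main
variable {k B G : Type*} [Field k] [Finite k]
  [CommRing B] [IsDedekindDomain B] [Algebra k B] [Algebra k[X] B] [IsScalarTower k k[X] B]
  [Ring.HasFiniteQuotients B] [Module.Finite k[X] B] [FaithfulSMul k[X] B]
  [Group G] [Finite G] [MulSemiringAction G B]
  [IsGaloisGroup G k[X] B]

lemma fin_good (M : ℕ) : {P : Ideal B | good G P ∧ ud k P ≤ M}.Finite := by
  refine (finite_dg_le (k := k) (O := B) (Nat.card G * M)).subset ?_
  rintro P ⟨⟨h1, h2, h3⟩, h4⟩
  refine ⟨h2, ?_⟩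
  have := finq_poly k
  have e1 : Nat.card (MulAction.stabilizer G P) * ud k P = dg k P := stab_card h1 h2 h3
  rw [← e1]
  exact Nat.mul_le_mul (Subgroup.card_le_card_group _) h4

theorem infinite_stab {B G : Type*} (k : Type*) [Field k] [Finite k]
    [CommRing B] [IsDedekindDomain B] [Algebra k B] [Algebra k[X] B] [IsScalarTower k k[X] B]
    [Ring.HasFiniteQuotients B] [Module.Finite k[X] B] [FaithfulSMul k[X] B]
    [Group G] [Finite G] [MulSemiringAction G B] [IsGaloisGroup G k[X] B] (σ : G) :
    {P : Ideal B | good G P ∧ MulAction.stabilizer G P = Subgroup.zpowers σ}.Infinite := by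
  classical
  intro hfin
  have := Fintype.ofFinite (Subgroup G)
  set f : Ideal B → ℝ := fun P => (Nat.card (MulAction.stabilizer G P) : ℝ) *
        (ud k P * ((Nat.card k : ℝ)⁻¹) ^ ud k P) with hf
  have hf0 : ∀ P, 0 ≤ f P := fun P => by positivity
  set PP : ℕ → Finset (Ideal B) := fun M => (fin_good (k := k) (B := B) (G := G) M).toFinset with hPP
  set a : Subgroup G → ℕ → ℝ := fun D M => ∑ P ∈ PP M with MulAction.stabilizer G P = D, f P with ha
  obtain ⟨C, hC⟩ := mobius_bound a (by
    intro H
    obtain ⟨C, hC⟩ := sum_all (B := B) k H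
    refine ⟨C, fun M => ?_⟩
    have := hC M ((PP M).filter (fun P => MulAction.stabilizer G P ≤ H)) (by
      intro P; simp [hPP, and_assoc])
    rw [← Finset.sum_fiberwise_of_maps_to (g := fun P => MulAction.stabilizer G P)
      (t := Finset.univ.filter (fun D => D ≤ H))] at this
    · refine le_of_eq_of_le ?_ this
      congr 2
      refine Finset.sum_congr rfl fun D hD => ?_
      refine Finset.sum_congr ?_ fun _ _ => rfl
      ext P
      simp only [Finset.mem_filter, Finset.mem_univ, true_and] at hD ⊢
      constructor
      · rintro ⟨h1, rfl⟩
        exact ⟨⟨h1, hD⟩, rfl⟩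
      · rintro ⟨⟨h1, _⟩, h2⟩
        exact ⟨h1, h2⟩
    · intro P hP
      simpa using (Finset.mem_filter.mp hP).2) (Subgroup.zpowers σ)
  have hle : ∀ M, a (Subgroup.zpowers σ) M ≤ ∑ P ∈ hfin.toFinset, f P := by
    intro M
    refine Finset.sum_le_sum_of_subset_of_nonneg ?_ fun P _ _ => hf0 P
    intro P hP
    simp only [hPP, Finset.mem_filter, Set.Finite.mem_toFinset, Set.mem_ofPred_eq] at hP ⊢
    exact ⟨hP.1.1, hP.2⟩
  have hone : 1 ≤ Nat.card {g : G // Subgroup.zpowers g = Subgroup.zpowers σ} := by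
    have : Nonempty {g : G // Subgroup.zpowers g = Subgroup.zpowers σ} := ⟨⟨σ, rfl⟩⟩
    exact Nat.card_pos
  obtain ⟨M, hM⟩ := exists_nat_gt (∑ P ∈ hfin.toFinset, f P + C)
  have h1 := (abs_le.mp (hC M)).1
  have h2 := hle M
  have h3 : (M : ℝ) ≤ Nat.card {g : G // Subgroup.zpowers g = Subgroup.zpowers σ} * M := by
    have : (1 : ℝ) ≤ Nat.card {g : G // Subgroup.zpowers g = Subgroup.zpowers σ} := by exact_mod_cast hone
    nlinarith [Nat.cast_nonneg (α := ℝ) M]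
  linarith

/-- avoiding a finite set of primes below -/
theorem exists_stab (σ : G) (s : Set (Ideal k[X])) (hs : s.Finite) :
    ∃ P : Ideal B, P.IsPrime ∧ P ≠ ⊥ ∧ MulAction.stabilizer G P = Subgroup.zpowers σ ∧
      P.under k[X] ∉ s := by
  by_contra hcon
  push Not at hcon
  apply infinite_stab (B := B) k σ
  obtain ⟨M, hM⟩ := (hs.image (fun p => dg k p)).bddAbove
  refine (fin_good (k := k) (B := B) (G := G) M).subset ?_
  rintro P ⟨h1, h2⟩
  exact ⟨h1, hM ⟨_, hcon P h1.1 h1.2.1 h2, rfl⟩⟩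

end main
end Gass

namespace Gass
open Polynomial
set_option linter.unusedSectionVars false
open scoped Pointwise

section grp
variable {G : Type*} [Group G] [Finite G]

/-- number of conjugators taking `x` into `H` -/
noncomputable def bet (H : Subgroup G) (x : G) : ℕ := Nat.card {g : G // g * x * g⁻¹ ∈ H}

lemma bet_congr (H : Subgroup G) {x y : G} (h : Subgroup.zpowers x = Subgroup.zpowers y) :
    bet H x = bet H y := by
  have key : ∀ x y : G, Subgroup.zpowers x = Subgroup.zpowers y → ∀ g : G,
      g * x * g⁻¹ ∈ H → g * y * g⁻¹ ∈ H := by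
    intro x y h g hg
    have : y ∈ Subgroup.zpowers x := by rw [h]; exact Subgroup.mem_zpowers y
    obtain ⟨n, rfl⟩ := Subgroup.mem_zpowers_iff.mp this
    rw [← conj_zpow]
    exact H.zpow_mem hg n
  exact Nat.card_congr (Equiv.subtypeEquivRight fun g => ⟨key x y h g, key y x h.symm g⟩)

lemma bet_one (H : Subgroup G) : bet H 1 = Nat.card G := by
  unfold bet
  simp [H.one_mem]

lemma bet_eq (H : Subgroup G) (g : G) :
    bet H g = Nat.card {h : H // IsConj g (h : G)} * Nat.card {x : G // x * g * x⁻¹ = g} := by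
  let f : {x : G // x * g * x⁻¹ ∈ H} → {h : H // IsConj g (h : G)} := fun x =>
    ⟨⟨x.1 * g * x.1⁻¹, x.2⟩, isConj_iff.mpr ⟨x.1, rfl⟩⟩
  have e1 : bet H g = Nat.card (Σ y, {x // f x = y}) := Nat.card_congr (Equiv.sigmaFiberEquiv f).symm
  have e2 : ∀ y, Nat.card {x // f x = y} = Nat.card {x : G // x * g * x⁻¹ = g} := by
    rintro ⟨h, hc⟩
    obtain ⟨y, hy⟩ := isConj_iff.mp hc
    refine Nat.card_congr ⟨fun x => ⟨y⁻¹ * x.1.1, ?_⟩, fun z => ⟨⟨y * z.1, ?_⟩, ?_⟩, ?_, ?_⟩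
    · have h1 : x.1.1 * g * x.1.1⁻¹ = h := congrArg (fun t => ((t.1 : H) : G)) x.2
      rw [← hy] at h1
      have : y⁻¹ * x.1.1 * g * (y⁻¹ * x.1.1)⁻¹ = y⁻¹ * (x.1.1 * g * x.1.1⁻¹) * y := by group
      rw [this, h1]; group
    · have : y * z.1 * g * (y * z.1)⁻¹ = y * (z.1 * g * z.1⁻¹) * y⁻¹ := by group
      rw [this, z.2, hy]; exact h.2
    · apply Subtype.ext; apply Subtype.ext
      have : y * z.1 * g * (y * z.1)⁻¹ = y * (z.1 * g * z.1⁻¹) * y⁻¹ := by group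
      change y * z.1 * g * (y * z.1)⁻¹ = h
      rw [this, z.2, hy]
    · intro x; apply Subtype.ext; apply Subtype.ext; simp
    · intro z; apply Subtype.ext; simp
  have := Fintype.ofFinite {h : H // IsConj g (h : G)}
  rw [e1, Nat.card_sigma, Finset.sum_congr rfl (fun y _ => e2 y), Finset.sum_const, smul_eq_mul,
    Finset.card_univ, ← Nat.card_eq_fintype_card]

lemma gassmann_of_bet (H H' : Subgroup G) (h : ∀ g, bet H g = bet H' g) (g : G) :
    Nat.card {h : H // IsConj g (h : G)} = Nat.card {h : H' // IsConj g (h : G)} := by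
  have h1 := h g
  rw [bet_eq, bet_eq] at h1
  have : Nonempty {x : G // x * g * x⁻¹ = g} := ⟨⟨1, by simp⟩⟩
  exact Nat.eq_of_mul_eq_mul_right Nat.card_pos h1

open Classical in
lemma bet_ind [Fintype G] (H H' : Subgroup G)
    (h : ∀ σ : G, ∃ n : ℕ,
      n * Nat.card H * Nat.card (Subgroup.zpowers σ) = ∑ d with d ∈ Subgroup.zpowers σ, bet H d ∧
      n * Nat.card H' * Nat.card (Subgroup.zpowers σ) = ∑ d with d ∈ Subgroup.zpowers σ, bet H' d)
    (σ : G) : bet H σ = bet H' σ := by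
  have hcard : Nat.card H = Nat.card H' := by
    obtain ⟨n, h1, h2⟩ := h 1
    have e : (Finset.univ.filter (fun d : G => d ∈ Subgroup.zpowers (1 : G))) = {1} := by
      ext d; simp
    rw [e, Finset.sum_singleton, bet_one] at h1 h2
    simp only [Subgroup.zpowers_one_eq_bot, Subgroup.card_bot, mul_one] at h1 h2
    have hn : 0 < n := by
      rcases Nat.eq_zero_or_pos n with rfl | hn
      · have : 0 < Nat.card G := Nat.card_pos
        omega
      · exact hn
    exact Nat.eq_of_mul_eq_mul_left hn (h1.trans h2.symm)
  have hsum : ∀ σ : G, ∑ d with d ∈ Subgroup.zpowers σ, bet H d =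
      ∑ d with d ∈ Subgroup.zpowers σ, bet H' d := by
    intro σ
    obtain ⟨n, h1, h2⟩ := h σ
    rw [← h1, ← h2, hcard]
  suffices ∀ D : Subgroup G, ∀ σ, Subgroup.zpowers σ = D → bet H σ = bet H' σ from this _ σ rfl
  intro D
  induction D using WellFoundedLT.induction with
  | ind D ih =>
    rintro σ rfl
    have h1 := hsum σ
    rw [← Finset.sum_filter_add_sum_filter_not _ (fun d => Subgroup.zpowers d = Subgroup.zpowers σ),
      ← Finset.sum_filter_add_sum_filter_not (Finset.univ.filter (fun d => d ∈ Subgroup.zpowers σ))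
        (fun d => Subgroup.zpowers d = Subgroup.zpowers σ) (f := fun d => bet H' d)] at h1
    have h2 : ∑ d ∈ (Finset.univ.filter (fun d => d ∈ Subgroup.zpowers σ)) with
        ¬ Subgroup.zpowers d = Subgroup.zpowers σ, bet H d =
        ∑ d ∈ (Finset.univ.filter (fun d => d ∈ Subgroup.zpowers σ)) with
        ¬ Subgroup.zpowers d = Subgroup.zpowers σ, bet H' d := by
      refine Finset.sum_congr rfl fun d hd => ?_
      simp only [Finset.mem_filter, Finset.mem_univ, true_and] at hd
      exact ih _ (lt_of_le_of_ne (by simpa using hd.1) hd.2) d rfl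
    rw [h2] at h1
    have h3 := Nat.add_right_cancel h1
    rw [Finset.sum_congr rfl (fun d hd => bet_congr H (Finset.mem_filter.mp hd).2),
      Finset.sum_congr rfl (fun d hd => bet_congr H' (Finset.mem_filter.mp hd).2)] at h3
    simp only [Finset.sum_const, smul_eq_mul] at h3
    refine Nat.eq_of_mul_eq_mul_left (Finset.card_pos.mpr ⟨σ, ?_⟩) h3
    simp

open Classical in
lemma sum_stab [Fintype G] {X : Type*} [MulAction G X] (H : Subgroup G) (P : X) :
    ∑ g : G, Nat.card (MulAction.stabilizer H (g • P)) =
      ∑ d with d ∈ MulAction.stabilizer G P, bet H d := by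
  have e1 : ∀ g : G, Nat.card (MulAction.stabilizer H (g • P)) =
      ∑ d with d ∈ MulAction.stabilizer G P, if g * d * g⁻¹ ∈ H then 1 else 0 := by
    intro g
    rw [Finset.sum_boole, Finset.filter_filter, Nat.cast_id, ← Fintype.card_subtype,
      ← Nat.card_eq_fintype_card]
    refine Nat.card_congr ⟨fun h => ⟨g⁻¹ * h.1.1 * g, ?_, ?_⟩, fun d => ⟨⟨g * d.1 * g⁻¹, d.2.2⟩, ?_⟩, ?_, ?_⟩
    · have : (h.1.1) • g • P = g • P := h.2
      rw [MulAction.mem_stabilizer_iff, mul_smul, mul_smul, this, inv_smul_smul]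
    · have : g * (g⁻¹ * h.1.1 * g) * g⁻¹ = h.1.1 := by group
      rw [this]; exact h.1.2
    · have h1 : d.1 • P = P := d.2.1
      change (g * d.1 * g⁻¹) • g • P = g • P
      rw [mul_smul, inv_smul_smul, mul_smul, h1]
    · intro h; apply Subtype.ext; apply Subtype.ext; simp; group
    · intro d; apply Subtype.ext; simp; group
  rw [Finset.sum_congr rfl (fun g _ => e1 g), Finset.sum_comm]
  refine Finset.sum_congr rfl fun d _ => ?_
  rw [Finset.sum_boole, bet, Nat.cast_id, Nat.card_eq_fintype_card, Fintype.card_subtype]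

open Classical in
lemma sum_orbit [Fintype G] {X : Type*} [MulAction G X] (P : X) (s : Finset X)
    (hs : (s : Set X) = MulAction.orbit G P) (f : X → ℕ) :
    ∑ g : G, f (g • P) = (∑ x ∈ s, f x) * Nat.card (MulAction.stabilizer G P) := by
  rw [← Finset.sum_fiberwise_of_maps_to (s := Finset.univ) (t := s) (g := fun g : G => g • P)
    (fun g _ => by rw [← Finset.mem_coe, hs]; exact ⟨g, rfl⟩), Finset.sum_mul]
  refine Finset.sum_congr rfl fun x hx => ?_
  rw [Finset.sum_congr rfl (g := fun _ => f x) (fun g hg => by rw [(Finset.mem_filter.mp hg).2]),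
    Finset.sum_const, smul_eq_mul, mul_comm]
  congr 1
  rw [← Fintype.card_subtype, ← Nat.card_eq_fintype_card]
  have : x ∈ MulAction.orbit G P := by rw [← hs]; exact hx
  obtain ⟨y, rfl⟩ := this
  refine Nat.card_congr ⟨fun g => ⟨y⁻¹ * g.1, ?_⟩, fun d => ⟨y * d.1, ?_⟩, ?_, ?_⟩
  · have : g.1 • P = y • P := g.2
    rw [MulAction.mem_stabilizer_iff, mul_smul, this, inv_smul_smul]
  · have : d.1 • P = P := d.2
    rw [mul_smul, this]
  · intro g; apply Subtype.ext; simp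
  · intro g; apply Subtype.ext; simp

end grp
end Gass

namespace Gass
open Polynomial
set_option linter.unusedSectionVars false
open scoped Pointwise

lemma fiber_sum_inv {R B Γ : Type*} [CommRing R] [CommRing B] [IsDomain B] [Algebra R B]
    [FaithfulSMul R B] [Group Γ] [Finite Γ] [MulSemiringAction Γ B] [SMulCommClass Γ R B]
    [Algebra.IsInvariant R B Γ]
    (Q : Ideal R) (hQ : Q.IsPrime) (s : Finset (Ideal B))
    (hs : ∀ P, P ∈ s ↔ P.IsPrime ∧ P.under R = Q) :
    s.Nonempty ∧ ∑ P ∈ s, Nat.card (MulAction.stabilizer Γ P) = Nat.card Γ := by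
  have hinj : RingHom.ker (algebraMap R B) ≤ Q := by
    rw [(RingHom.injective_iff_ker_eq_bot _).mp (FaithfulSMul.algebraMap_injective R B)]
    exact bot_le
  have : Algebra.IsIntegral R B := Algebra.IsInvariant.isIntegral R B Γ
  obtain ⟨P0, hP0, e0⟩ := Ideal.exists_ideal_over_prime_of_isIntegral_of_isDomain (S := B) Q hinj
  refine ⟨⟨P0, (hs P0).mpr ⟨hP0, e0⟩⟩, ?_⟩
  have : P0.LiesOver Q := ⟨e0.symm⟩
  have h1 := Algebra.IsInvariant.orbit_eq_primesOver R B Γ Q P0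
  have h2 : (s : Set (Ideal B)) = MulAction.orbit Γ P0 := by
    rw [h1]
    ext P
    simp only [Finset.mem_coe, hs, Ideal.primesOver, Set.mem_ofPred_eq]
    exact and_congr_right fun _ => ⟨fun h => ⟨h.symm⟩, fun h => h.over.symm⟩
  have h3 : ∀ P ∈ s, Nat.card (MulAction.stabilizer Γ P) = Nat.card (MulAction.stabilizer Γ P0) := by
    intro P hP
    have : P ∈ MulAction.orbit Γ P0 := by rw [← h2]; exact hP
    exact Nat.card_congr (MulAction.stabilizerEquivStabilizerOfOrbitRel this).toEquiv
  rw [Finset.sum_congr rfl h3, Finset.sum_const, smul_eq_mul]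
  have h4 := Nat.card_congr (MulAction.orbitProdStabilizerEquivGroup Γ P0)
  rw [Nat.card_prod, ← h2] at h4
  simpa using h4

open Classical in
theorem count {A R B G : Type*} [CommRing A] [CommRing R] [CommRing B] [IsDomain B] [Algebra A R]
    [Algebra R B] [Algebra A B] [IsScalarTower A R B] [Group G] [Fintype G] [MulSemiringAction G B]
    (H : Subgroup G) [SMulCommClass G A B] [Algebra.IsInvariant A B G]
    [SMulCommClass H R B] [Algebra.IsInvariant R B H] [FaithfulSMul R B]
    (P0 : Ideal B) (h0 : P0.IsPrime) (D : Subgroup G) (hD : MulAction.stabilizer G P0 = D) :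
    primesOverCount (algebraMap A R) (P0.under A) * Nat.card H * Nat.card D =
      ∑ d with d ∈ D, bet H d := by
  have hfin : (MulAction.orbit G P0).Finite := Set.finite_range _
  set s := hfin.toFinset with hsdef
  have hs : (s : Set (Ideal B)) = MulAction.orbit G P0 := by simp [hsdef]
  have hs' : ∀ P, P ∈ s ↔ P.IsPrime ∧ P.under A = P0.under A := by
    intro P
    rw [← Finset.mem_coe, hs, Algebra.IsInvariant.orbit_eq_primesOver A B G (P0.under A) P0]
    simp only [Ideal.primesOver, Set.mem_ofPred_eq]
    exact and_congr_right fun _ => ⟨fun h => h.over.symm, fun h => ⟨h.symm⟩⟩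
  have e0 : ∑ d with d ∈ D, bet H d = ∑ g : G, Nat.card (MulAction.stabilizer H (g • P0)) := by
    rw [sum_stab]
    refine Finset.sum_congr ?_ fun _ _ => rfl
    ext d
    simp only [Finset.mem_filter, ← hD]
  rw [e0, ← hD, sum_orbit P0 s hs (fun P => Nat.card (MulAction.stabilizer H P))]
  congr 1
  set T := s.image (fun P => P.under R) with hT
  have hfib : ∀ Q : Ideal R, Q.IsPrime → Q.under A = P0.under A →
      (s.filter (fun P => P.under R = Q)).Nonempty ∧
      ∑ P ∈ s with P.under R = Q, Nat.card (MulAction.stabilizer H P) = Nat.card H := by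
    intro Q hQ hQA
    refine fiber_sum_inv (Γ := H) Q hQ _ fun P => ?_
    rw [Finset.mem_filter, hs']
    constructor
    · rintro ⟨⟨h1, _⟩, h2⟩; exact ⟨h1, h2⟩
    · rintro ⟨h1, h2⟩
      refine ⟨⟨h1, ?_⟩, h2⟩
      rw [← hQA, ← h2, Ideal.under_under]
  have hTm : ∀ Q, Q ∈ T ↔ Q.IsPrime ∧ Q.comap (algebraMap A R) = P0.under A := by
    intro Q
    constructor
    · intro hQ
      obtain ⟨P, hP, rfl⟩ := Finset.mem_image.mp hQ
      obtain ⟨h1, h2⟩ := (hs' P).mp hP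
      exact ⟨h1.under R, by rw [← h2]; exact Ideal.under_under P⟩
    · rintro ⟨h1, h2⟩
      obtain ⟨P, hP⟩ := (hfib Q h1 h2).1
      rw [Finset.mem_filter] at hP
      exact Finset.mem_image.mpr ⟨P, hP⟩
  have hcnt : primesOverCount (algebraMap A R) (P0.under A) = T.card := by
    unfold primesOverCount
    rw [← Nat.card_eq_finsetCard T]
    exact Nat.card_congr (Equiv.subtypeEquivRight fun Q => (hTm Q).symm)
  rw [hcnt, ← Finset.sum_fiberwise_of_maps_to (s := s) (t := T) (g := fun P => P.under R)
      (fun P hP => Finset.mem_image_of_mem _ hP),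
    Finset.sum_congr rfl (fun Q hQ => (hfib Q ((hTm Q).mp hQ).1 ((hTm Q).mp hQ).2).2)]
  simp

theorem abstract_main {k B G RK RL : Type*} [Field k] [Finite k]
    [CommRing B] [IsDedekindDomain B] [Algebra k B] [Algebra k[X] B] [IsScalarTower k k[X] B]
    [Ring.HasFiniteQuotients B] [Module.Finite k[X] B] [FaithfulSMul k[X] B]
    [Group G] [Finite G] [MulSemiringAction G B] [IsGaloisGroup G k[X] B]
    [CommRing RK] [CommRing RL] [Algebra k[X] RK] [Algebra k[X] RL] [Algebra RK B] [Algebra RL B]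
    [IsScalarTower k[X] RK B] [IsScalarTower k[X] RL B] [FaithfulSMul RK B] [FaithfulSMul RL B]
    (HK HL : Subgroup G) [SMulCommClass HK RK B] [SMulCommClass HL RL B]
    [Algebra.IsInvariant RK B HK] [Algebra.IsInvariant RL B HL]
    (hfin : {p : Ideal k[X] | p.IsPrime ∧ p ≠ ⊥ ∧ primesOverCount (algebraMap k[X] RK) p ≠
      primesOverCount (algebraMap k[X] RL) p}.Finite) :
    IsGassmannEquiv HK HL := by
  classical
  have := Fintype.ofFinite G
  intro g
  refine gassmann_of_bet HK HL (fun σ => bet_ind HK HL (fun σ => ?_) σ) g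
  obtain ⟨P, h1, h2, h3, h4⟩ := exists_stab (k := k) (B := B) σ _ hfin
  have h5 : primesOverCount (algebraMap k[X] RK) (P.under k[X]) =
      primesOverCount (algebraMap k[X] RL) (P.under k[X]) := by
    by_contra hne
    exact h4 ⟨h1.under k[X], under_ne_bot h2, hne⟩
  have e1 := count (A := k[X]) (R := RK) HK P h1 _ h3
  have e2 := count (A := k[X]) (R := RL) HL P h1 _ h3
  rw [← h5] at e2
  exact ⟨_, e1, e2⟩

end Gass

namespace Gass
open Polynomial
set_option linter.unusedSectionVars false
open scoped Pointwise

section fin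
variable {A F N : Type*} [CommRing A] [Field F] [Field N] [Algebra A F] [Algebra F N] [Algebra A N]
  [IsScalarTower A F N]

lemma comm_int (K : Type*) [Field K] [Algebra K N] [Algebra A K] [IsScalarTower A K N]
    [SMulCommClass (N ≃ₐ[F] N) A N] (H : Subgroup (N ≃ₐ[F] N))
    (hK : ∀ x : N, (∀ h ∈ H, h x = x) ↔ x ∈ Set.range (algebraMap K N)) :
    letI : Algebra (integralClosure A K) (integralClosure A N) :=
      (AlgHom.mapIntegralClosure (IsScalarTower.toAlgHom A K N)).toRingHom.toAlgebra
    IsScalarTower A (integralClosure A K) (integralClosure A N) ∧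
    FaithfulSMul (integralClosure A K) (integralClosure A N) ∧
    SMulCommClass H (integralClosure A K) (integralClosure A N) ∧
    Algebra.IsInvariant (integralClosure A K) (integralClosure A N) H := by
  letI : Algebra (integralClosure A K) (integralClosure A N) :=
      (AlgHom.mapIntegralClosure (IsScalarTower.toAlgHom A K N)).toRingHom.toAlgebra
  have hmap : ∀ z : integralClosure A K,
      ((algebraMap (integralClosure A K) (integralClosure A N) z : integralClosure A N) : N) =
        algebraMap K N (z : K) := fun z => rfl
  refine ⟨IsScalarTower.of_algebraMap_eq fun a => ?_, ?_, ⟨fun h z b => ?_⟩, ⟨fun b hb => ?_⟩⟩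
  · exact ((AlgHom.mapIntegralClosure (IsScalarTower.toAlgHom A K N)).commutes a).symm
  · rw [faithfulSMul_iff_algebraMap_injective]
    intro z w hzw
    apply Subtype.ext
    apply (algebraMap K N).injective
    rw [← hmap, ← hmap, hzw]
  · rw [Algebra.smul_def, Algebra.smul_def, smul_mul']
    congr 1
    apply Subtype.ext
    change (h : N ≃ₐ[F] N) (algebraMap K N (z : K)) = algebraMap K N (z : K)
    exact (hK _).mpr ⟨_, rfl⟩ h h.2
  · obtain ⟨z, hz⟩ := (hK (b : N)).mp fun h hh => congrArg Subtype.val (hb ⟨h, hh⟩)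
    have hzi : IsIntegral A z := by
      rw [← isIntegral_algebraMap_iff (algebraMap K N).injective, hz]
      exact b.2
    exact ⟨⟨z, hzi⟩, Subtype.ext hz⟩

end fin

theorem final {k N : Type} [Field k] [Finite k] [Field N] [Algebra (RatFunc k) N]
    [FiniteDimensional (RatFunc k) N] [IsGalois (RatFunc k) N]
    [Algebra k[X] N] [IsScalarTower k[X] (RatFunc k) N]
    (K L : Type) [Field K] [Algebra K N] [Algebra k[X] K] [IsScalarTower k[X] K N]
    [Field L] [Algebra L N] [Algebra k[X] L] [IsScalarTower k[X] L N]
    (HK HL : Subgroup (N ≃ₐ[RatFunc k] N))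
    (hK : ∀ x : N, (∀ h ∈ HK, h x = x) ↔ x ∈ Set.range (algebraMap K N))
    (hL : ∀ x : N, (∀ h ∈ HL, h x = x) ↔ x ∈ Set.range (algebraMap L N))
    (hfin : {p : Ideal k[X] | p.IsPrime ∧ p ≠ ⊥ ∧
      primesOverCount (algebraMap k[X] (integralClosure k[X] K)) p ≠
      primesOverCount (algebraMap k[X] (integralClosure k[X] L)) p}.Finite) :
    IsGassmannEquiv HK HL := by
  have hc : SMulCommClass (N ≃ₐ[RatFunc k] N) k[X] N := ⟨fun g a x => by
    rw [← algebraMap_smul (RatFunc k) a x, ← algebraMap_smul (RatFunc k) a (g • x), smul_comm]⟩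
  have : IsDedekindDomain (integralClosure k[X] N) :=
    integralClosure.isDedekindDomain k[X] (RatFunc k) N
  have : Module.Finite k[X] (integralClosure k[X] N) :=
    IsIntegralClosure.finite k[X] (RatFunc k) N (integralClosure k[X] N)
  have : FaithfulSMul k[X] N := by
    rw [faithfulSMul_iff_algebraMap_injective, IsScalarTower.algebraMap_eq k[X] (RatFunc k) N]
    exact (algebraMap (RatFunc k) N).injective.comp (IsFractionRing.injective k[X] (RatFunc k))
  have : FaithfulSMul k[X] (integralClosure k[X] N) := by
    rw [faithfulSMul_iff_algebraMap_injective]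
    intro a b hab
    exact FaithfulSMul.algebraMap_injective k[X] N (congrArg Subtype.val hab)
  have : Module.IsTorsionFree k[X] (integralClosure k[X] N) := by
    rw [Module.isTorsionFree_iff_faithfulSMul]
    infer_instance
  have := finq_poly k
  have : Ring.HasFiniteQuotients (integralClosure k[X] N) :=
    Ring.HasFiniteQuotients.of_module_finite k[X] _
  have : IsFractionRing (integralClosure k[X] N) N :=
    integralClosure.isFractionRing_of_finite_extension (RatFunc k) N
  have : IsGaloisGroup (N ≃ₐ[RatFunc k] N) k[X] (integralClosure k[X] N) :=
    IsGaloisGroup.of_isFractionRing _ k[X] (integralClosure k[X] N) (RatFunc k) N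
  letI : Algebra k (integralClosure k[X] N) :=
    ((algebraMap k[X] (integralClosure k[X] N)).comp (algebraMap k k[X])).toAlgebra
  have : IsScalarTower k k[X] (integralClosure k[X] N) := IsScalarTower.of_algebraMap_eq fun _ => rfl
  letI : Algebra (integralClosure k[X] K) (integralClosure k[X] N) :=
      (AlgHom.mapIntegralClosure (IsScalarTower.toAlgHom k[X] K N)).toRingHom.toAlgebra
  letI : Algebra (integralClosure k[X] L) (integralClosure k[X] N) :=
      (AlgHom.mapIntegralClosure (IsScalarTower.toAlgHom k[X] L N)).toRingHom.toAlgebra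
  obtain ⟨_, _, _, _⟩ := comm_int (A := k[X]) K HK hK
  obtain ⟨_, _, _, _⟩ := comm_int (A := k[X]) L HL hL
  exact abstract_main (k := k) (B := integralClosure k[X] N) HK HL hfin

lemma fix_mem {F N : Type*} [Field F] [Field N] [Algebra F N] [FiniteDimensional F N] [IsGalois F N]
    (K : IntermediateField F N) (x : N) :
    (∀ h ∈ K.fixingSubgroup, h x = x) ↔ x ∈ Set.range (algebraMap K N) := by
  have h1 : x ∈ Set.range (algebraMap K N) ↔ x ∈ K := by simp
  rw [h1]
  conv_rhs => rw [← IsGalois.fixedField_fixingSubgroup K]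
  simp [IntermediateField.mem_fixedField_iff]

end Gass

set_option synthInstance.maxHeartbeats 1000000 in
/-- Split equivalence implies Gassmann equivalence: if, for all but finitely many nonzero
primes `p` of `𝔽_q[T]`, the number of primes of `O_K` above `p` equals the number of primes
of `O_L` above `p`, then the fixing subgroups of `K` and `L` in `G = Gal(N/𝔽_q(T))` are
Gassmann equivalent. -/
theorem gassmann_equiv_of_split_equiv
    (Fq : Type) [Field Fq] [Fintype Fq]
    (N : Type) [Field N] [Algebra (RatFunc Fq) N] [FiniteDimensional (RatFunc Fq) N]
    [IsGalois (RatFunc Fq) N]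
    (K L : IntermediateField (RatFunc Fq) N) :
    letI : Algebra (Polynomial Fq) K :=
      ((algebraMap (RatFunc Fq) K).comp (algebraMap (Polynomial Fq) (RatFunc Fq))).toAlgebra
    letI : Algebra (Polynomial Fq) L :=
      ((algebraMap (RatFunc Fq) L).comp (algebraMap (Polynomial Fq) (RatFunc Fq))).toAlgebra
    {p : Ideal (Polynomial Fq) | p.IsPrime ∧ p ≠ ⊥ ∧
      primesOverCount (algebraMap (Polynomial Fq) (integralClosure (Polynomial Fq) K)) p ≠
      primesOverCount (algebraMap (Polynomial Fq) (integralClosure (Polynomial Fq) L)) p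
      }.Finite →
    IsGassmannEquiv K.fixingSubgroup L.fixingSubgroup := by
  intro hfin
  let iK : Algebra (Polynomial Fq) K :=
    ((algebraMap (RatFunc Fq) K).comp (algebraMap (Polynomial Fq) (RatFunc Fq))).toAlgebra
  let iL : Algebra (Polynomial Fq) L :=
    ((algebraMap (RatFunc Fq) L).comp (algebraMap (Polynomial Fq) (RatFunc Fq))).toAlgebra
  letI iN : Algebra (Polynomial Fq) N :=
    ((algebraMap (RatFunc Fq) N).comp (algebraMap (Polynomial Fq) (RatFunc Fq))).toAlgebra
  have t0 : IsScalarTower (Polynomial Fq) (RatFunc Fq) N := IsScalarTower.of_algebraMap_eq fun _ => rfl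
  have tK : @IsScalarTower (Polynomial Fq) K N iK.toSMul _ iN.toSMul :=
    @IsScalarTower.of_algebraMap_eq (Polynomial Fq) K N _ _ _ iK _ iN (fun _ => rfl)
  have tL : @IsScalarTower (Polynomial Fq) L N iL.toSMul _ iN.toSMul :=
    @IsScalarTower.of_algebraMap_eq (Polynomial Fq) L N _ _ _ iL _ iN (fun _ => rfl)
  exact @Gass.final Fq N _ _ _ _ _ _ iN t0 K L _ _ iK tK _ _ iL tL _ _
    (Gass.fix_mem K) (Gass.fix_mem L) hfin
end

section
/- Let F = 𝔽_2(T) and let f_K(X) = X⁸ + TX⁶ + TX⁵ + (T⁵+T⁴+T³+T²+T+1)X⁴ + TX³ + (T⁷+T⁵+T³+T²)X² + (T⁷+T⁴)X + (T¹⁰+T⁸+T⁶) ∈ F[X]. Then the Galois group of the splitting field N of f_K over F has order 32 and is isomorphic to the semidirect product C₈ ⋊ (ℤ/8ℤ)ˣ of a cyclic group of order 8 by its full automorphism group (ℤ/8ℤ)ˣ ≅ V₄ acting naturally (the holomorph of ℤ/8ℤ, the transitive group 8T15). -/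
open Polynomial

/-- `T` in `𝔽₂(T)`. -/
noncomputable def T2 : RatFunc (ZMod 2) := RatFunc.X

/-- The polynomial defining the field `K`. -/
noncomputable def fK : Polynomial (RatFunc (ZMod 2)) :=
  X ^ 8 + C T2 * X ^ 6 + C T2 * X ^ 5
    + C (T2 ^ 5 + T2 ^ 4 + T2 ^ 3 + T2 ^ 2 + T2 + 1) * X ^ 4 + C T2 * X ^ 3
    + C (T2 ^ 7 + T2 ^ 5 + T2 ^ 3 + T2 ^ 2) * X ^ 2 + C (T2 ^ 7 + T2 ^ 4) * X
    + C (T2 ^ 10 + T2 ^ 8 + T2 ^ 6)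

/-- The natural action of `(ℤ/8ℤ)ˣ ≅ V₄` on the cyclic group `ℤ/8ℤ` (written
multiplicatively), defining the holomorph of `ℤ/8ℤ`. -/
noncomputable def hol8Phi : (ZMod 8)ˣ →* MulAut (Multiplicative (ZMod 8)) where
  toFun u := AddEquiv.toMultiplicative (DistribMulAction.toAddAut (ZMod 8)ˣ (ZMod 8) u)
  map_one' := by ext x; simp
  map_mul' u v := by ext x; simp [mul_smul]

def hstep {K : Type*} [Field K] (T a b : K) (p : K × K × K) : K × K × K :=
  (p.1 + 1, p.2.1 + a + p.1, p.2.2 + p.2.1 * (a + p.1 + 1) + T * a + b)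

def hsol {K : Type*} [Field K] (T : K) (p : K × K × K) : Prop :=
  p.1 ^ 2 + p.1 = 1 ∧ p.2.1 ^ 2 + p.2.1 = p.1 * T ∧
    p.2.2 ^ 2 + p.2.2 = T * p.2.1 * (p.1 + T)

section
variable {K : Type*} [Field K] {T a b : K}

theorem hsol_root (h2 : (2 : K) = 0) {p : K × K × K} (h : hsol T p) :
    p.2.2 ^ 8 + T * p.2.2 ^ 6 + T * p.2.2 ^ 5
    + (T ^ 5 + T ^ 4 + T ^ 3 + T ^ 2 + T + 1) * p.2.2 ^ 4 + T * p.2.2 ^ 3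
    + (T ^ 7 + T ^ 5 + T ^ 3 + T ^ 2) * p.2.2 ^ 2 + (T ^ 7 + T ^ 4) * p.2.2
    + (T ^ 10 + T ^ 8 + T ^ 6) = 0 := by
  obtain ⟨g, d, x⟩ := p
  obtain ⟨h3, h4, h5⟩ := h
  simp only at *
  grind

theorem hstep_sol (h2 : (2 : K) = 0) {p : K × K × K} (ha : a ^ 2 + a = T + 1) (hb : b ^ 2 + b = T ^ 3 + T ^ 2)
    (h : hsol T p) : hsol T (hstep T a b p) := by
  obtain ⟨g, d, x⟩ := p
  obtain ⟨h3, h4, h5⟩ := h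
  simp only [hsol, hstep] at *
  refine ⟨?_, ?_, ?_⟩ <;> grind

theorem hstep_two (h2 : (2 : K) = 0) (p : K × K × K) : (hstep T a b)^[2] p =
    (p.1, p.2.1 + 1, p.2.2 + p.2.1 + (a + p.1) ^ 2) := by
  obtain ⟨g, d, x⟩ := p
  simp only [hstep, Function.iterate_succ, Function.iterate_zero, Function.comp, id, Prod.mk.injEq]
  refine ⟨?_, ?_, ?_⟩ <;> grind

theorem hstep_four (h2 : (2 : K) = 0) (p : K × K × K) : (hstep T a b)^[4] p = (p.1, p.2.1, p.2.2 + 1) := by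
  rw [show 4 = 2 + 2 from rfl, Function.iterate_add_apply, hstep_two h2, hstep_two h2]
  simp only [Prod.mk.injEq]
  refine ⟨?_, ?_, ?_⟩ <;> grind

theorem hstep_eight (h2 : (2 : K) = 0) (p : K × K × K) : (hstep T a b)^[8] p = p := by
  rw [show 8 = 4 + 4 from rfl, Function.iterate_add_apply, hstep_four h2, hstep_four h2]
  obtain ⟨g, d, x⟩ := p
  simp only [Prod.mk.injEq]
  refine ⟨?_, ?_, ?_⟩ <;> grind

theorem hstep_b (h2 : (2 : K) = 0) (p : K × K × K) : hstep T a (b + 1) p = (hstep T a b)^[5] p := by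
  rw [show 5 = 4 + 1 from rfl, Function.iterate_add_apply, hstep_four h2]
  obtain ⟨g, d, x⟩ := p
  simp only [hstep, Function.iterate_succ, Function.iterate_zero, Function.comp, id, Prod.mk.injEq]
  refine ⟨?_, ?_, ?_⟩ <;> grind

theorem hstep_ab (h2 : (2 : K) = 0) (ha : a ^ 2 + a = T + 1) {p : K × K × K} (h : hsol T p) :
    hstep T (a + 1) (b + 1) p = (hstep T a b)^[3] p := by
  rw [show 3 = 2 + 1 from rfl, Function.iterate_add_apply, hstep_two h2]
  obtain ⟨g, d, x⟩ := p
  obtain ⟨h3, h4, h5⟩ := h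
  simp only [hstep, Function.iterate_succ, Function.iterate_zero, Function.comp, id, Prod.mk.injEq] at *
  refine ⟨?_, ?_, ?_⟩ <;> grind

theorem hstep_a (h2 : (2 : K) = 0) (ha : a ^ 2 + a = T + 1) {p : K × K × K} (h : hsol T p) :
    hstep T (a + 1) b p = (hstep T a b)^[7] p := by
  rw [show 7 = 4 + (2 + 1) from rfl, Function.iterate_add_apply, hstep_four h2,
    Function.iterate_add_apply, hstep_two h2]
  obtain ⟨g, d, x⟩ := p
  obtain ⟨h3, h4, h5⟩ := h
  simp only [hstep, Function.iterate_succ, Function.iterate_zero, Function.comp, id, Prod.mk.injEq] at *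
  refine ⟨?_, ?_, ?_⟩ <;> grind

theorem as_cases (h2 : (2 : K) = 0) {x y c : K} (hx : x ^ 2 + x = c) (hy : y ^ 2 + y = c) : y = x ∨ y = x + 1 := by
  have : (y - x) * (y - (x + 1)) = 0 := by grind
  rcases mul_eq_zero.1 this with h | h
  · left; exact sub_eq_zero.1 h
  · right; exact sub_eq_zero.1 h

theorem hsol_exists (h2 : (2 : K) = 0) (ha : a ^ 2 + a = T + 1) (hb : b ^ 2 + b = T ^ 3 + T ^ 2)
    {p q : K × K × K} (hp : hsol T p) (hq : hsol T q) : ∃ k, q = (hstep T a b)^[k] p := by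
  -- first adjust parity
  have key : ∀ p : K × K × K, hsol T p → q.1 = p.1 → ∃ k, q = (hstep T a b)^[k] p := by
    have key2 : ∀ p : K × K × K, hsol T p → q.1 = p.1 → q.2.1 = p.2.1 →
        ∃ k, q = (hstep T a b)^[k] p := by
      intro p hp h1 h3
      have hx := hp.2.2
      rw [← h1, ← h3] at hx
      rcases as_cases h2 hx hq.2.2 with h | h
      · exact ⟨0, Prod.ext h1 (Prod.ext h3 h)⟩
      · exact ⟨4, by rw [hstep_four h2]; exact Prod.ext h1 (Prod.ext h3 h)⟩
    intro p hp h1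
    have hx := hp.2.1
    rw [← h1] at hx
    rcases as_cases h2 hx hq.2.1 with h | h
    · exact key2 p hp h1 h
    · obtain ⟨k, hk⟩ := key2 ((hstep T a b)^[2] p)
        (hstep_sol h2 ha hb (hstep_sol h2 ha hb hp))
        (by rw [hstep_two h2]; exact h1) (by rw [hstep_two h2]; exact h)
      exact ⟨k + 2, by rw [Function.iterate_add_apply]; exact hk⟩
  rcases as_cases h2 hp.1 hq.1 with h | h
  · exact key p hp h
  · obtain ⟨k, hk⟩ := key (hstep T a b p) (hstep_sol h2 ha hb hp) h
    exact ⟨k + 1, by rw [Function.iterate_add_apply]; exact hk⟩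

theorem hstep_fst (p : K × K × K) (k : ℕ) : ((hstep T a b)^[k] p).1 = p.1 + k := by
  induction k with
  | zero => simp
  | succ n ih => rw [Function.iterate_succ_apply']; simp only [hstep, ih]; push_cast; ring

theorem hstep_mod (h2 : (2 : K) = 0) (p : K × K × K) (k : ℕ) :
    (hstep T a b)^[k] p = (hstep T a b)^[k % 8] p := by
  have : ∀ m : ℕ, (hstep T a b)^[8 * m] p = p := by
    intro m
    induction m with
    | zero => rfl
    | succ n ih => rw [Nat.mul_succ, Function.iterate_add_apply, hstep_eight h2, ih]
  conv_lhs => rw [← Nat.mod_add_div k 8, Function.iterate_add_apply, this]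
end

theorem char_surj {F Ω : Type*} [Field F] [Field Ω] [Algebra F Ω] [IsGalois F Ω]
    (h2 : (2 : Ω) = 0) (c : ZMod 2 →+* F) (A : Fin 3 → F) (w : Fin 3 → Ω)
    (hw : ∀ i, w i ^ 2 + w i = algebraMap F Ω (A i))
    (hA : ∀ e : Fin 3 → ZMod 2, e ≠ 0 → ∀ z : F, z ^ 2 + z ≠ ∑ i, c (e i) * A i)
    (e : Fin 3 → ZMod 2) :
    ∃ τ : Ω ≃ₐ[F] Ω, ∀ i, τ (w i) = w i + algebraMap F Ω (c (e i)) := by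
  let H : AddSubgroup (Fin 3 → ZMod 2) :=
    { carrier := {e | ∃ τ : Ω ≃ₐ[F] Ω, ∀ i, τ (w i) = w i + algebraMap F Ω (c (e i))}
      zero_mem' := ⟨1, fun i => by simp⟩
      add_mem' := by
        rintro e e' ⟨τ, h⟩ ⟨τ', h'⟩
        refine ⟨τ * τ', fun i => ?_⟩
        simp [AlgEquiv.mul_apply, h, h']; ring
      neg_mem' := by
        rintro e ⟨τ, h⟩
        refine ⟨τ, fun i => ?_⟩
        rw [h i, Pi.neg_apply, ZMod.neg_eq_self_mod_two] }
  let S : Submodule (ZMod 2) (Fin 3 → ZMod 2) := AddSubgroup.toZModSubmodule 2 H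
  have hS : S = ⊤ := by
    by_contra hne
    obtain ⟨φ, hφ, hle⟩ := S.exists_le_ker_of_lt_top (lt_top_iff_ne_top.2 hne)
    let a : Fin 3 → ZMod 2 := fun i => φ (Pi.single i 1)
    have hφa : ∀ e, φ e = ∑ i, a i * e i := by
      intro e
      rw [LinearMap.pi_apply_eq_sum_univ φ e]
      refine Finset.sum_congr rfl fun i _ => ?_
      rw [smul_eq_mul, mul_comm]
      congr 2
      ext j; simp [Pi.single_apply, eq_comm]
    have ha : a ≠ 0 := by
      intro h0
      apply hφ
      ext i
      have := congrFun h0 i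
      simpa [a] using this
    have sq : ∀ r : ZMod 2, r ^ 2 = r := by decide
    set z : Ω := ∑ i, algebraMap F Ω (c (a i)) * w i with hz
    have hfix : ∀ τ : Ω ≃ₐ[F] Ω, τ z = z := by
      intro τ
      have : ∀ i, ∃ r : ZMod 2, τ (w i) = w i + algebraMap F Ω (c r) := by
        intro i
        have h1 : τ (w i) ^ 2 + τ (w i) = algebraMap F Ω (A i) := by
          rw [← map_pow, ← map_add, hw, AlgEquiv.commutes]
        rcases as_cases h2 (hw i) h1 with h | h
        · exact ⟨0, by simp [h]⟩
        · exact ⟨1, by simp [h]⟩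
      choose r hr using this
      have hrS : r ∈ S := (⟨τ, hr⟩ : r ∈ H)
      have hr0 := hle hrS
      rw [LinearMap.mem_ker, hφa] at hr0
      rw [hz, map_sum]
      simp only [map_mul, AlgEquiv.commutes, hr, mul_add, Finset.sum_add_distrib]
      have : ∑ i, algebraMap F Ω (c (a i)) * algebraMap F Ω (c (r i)) = 0 := by
        simp only [← map_mul, ← map_sum, hr0, map_zero]
      rw [this, add_zero]
    obtain ⟨z0, hz0⟩ := (InfiniteGalois.mem_range_algebraMap_iff_fixed z).2 hfix
    apply hA a ha z0
    apply (algebraMap F Ω).injective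
    have hch : ∀ u v : Ω, (u + v) ^ 2 = u ^ 2 + v ^ 2 := by intro u v; grind
    rw [map_add, map_pow, hz0, hz]
    simp only [Fin.sum_univ_three, hch, mul_pow, ← map_pow, sq, map_add, map_mul, ← hw]
    ring
  have : e ∈ S := hS ▸ Submodule.mem_top
  exact this

theorem ratfunc_nosol (e : Fin 3 → ZMod 2) (he : e ≠ 0) (z : RatFunc (ZMod 2)) :
    z ^ 2 + z ≠ ∑ i, algebraMap (ZMod 2) (RatFunc (ZMod 2)) (e i) *
      (![RatFunc.X + 1, RatFunc.X ^ 3 + RatFunc.X ^ 2, 1] : Fin 3 → RatFunc (ZMod 2)) i := by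
  intro h
  let c : (ZMod 2)[X] := C (e 0) * (X + 1) + C (e 1) * (X ^ 3 + X ^ 2) + C (e 2)
  have hc : algebraMap (ZMod 2)[X] (RatFunc (ZMod 2)) c = z ^ 2 + z := by
    rw [h]
    simp [c, Fin.sum_univ_three, RatFunc.algebraMap_X]
  have hint : IsIntegral (ZMod 2)[X] z := by
    refine ⟨X ^ 2 + X - C c, ?_, ?_⟩
    · monicity!
    · simp [hc]
  obtain ⟨p, rfl⟩ := IsIntegrallyClosed.isIntegral_iff.1 hint
  rw [← map_pow, ← map_add] at hc
  have hp : c = p ^ 2 + p := IsFractionRing.injective (ZMod 2)[X] (RatFunc (ZMod 2)) hc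
  have hc0 : c ≠ 0 := by
    intro h0
    apply he
    have k0 := congrArg (fun q => coeff q 0) h0
    have k1 := congrArg (fun q => coeff q 1) h0
    have k3 := congrArg (fun q => coeff q 3) h0
    simp [c, coeff_X, coeff_one, coeff_X_pow] at k0 k1 k3
    ext i
    fin_cases i <;> simp_all
  have hf : p ^ 2 + p = p * (p + C 1) := by rw [C_1]; ring
  have hp0 : p ≠ 0 := by rintro rfl; exact hc0 (by rw [hp]; simp)
  have hp1 : p + C 1 ≠ 0 := by intro h0; exact hc0 (by rw [hp, hf, h0, mul_zero])
  have hdeg : c.natDegree = 2 * p.natDegree := by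
    rw [hp, hf, natDegree_mul hp0 hp1, natDegree_add_C]; ring
  have two : ∀ r : ZMod 2, r = 0 ∨ r = 1 := by decide
  rcases two (e 1) with h1 | h1
  · rcases two (e 0) with h0 | h0
    · rcases two (e 2) with h3 | h3
      · apply he; ext i; fin_cases i <;> simp_all
      · have c1 : c = 1 := by simp [c, h0, h1, h3]
        rw [c1, natDegree_one] at hdeg
        have : p = C (p.coeff 0) := eq_C_of_natDegree_eq_zero (by omega)
        have k := congrArg (fun q => coeff q 0) hp
        rw [c1, this] at k
        simp only [← C_pow, ← C_add, coeff_C_zero, coeff_one_zero] at k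
        revert k
        generalize p.coeff 0 = r
        revert r; decide
    · have c1 : c.natDegree = 1 := by
        have : c = X + C (1 + e 2) := by simp [c, h0, h1]; ring
        rw [this, natDegree_X_add_C]
      omega
  · have c1 : c.natDegree = 3 := by
      simp only [c, h1]; compute_degree!
    omega

section
variable {F Ω : Type*} [Field F] [Field Ω] [Algebra F Ω]

/-- The `i`-th root. -/
def hxs (t a b : Ω) (p : Ω × Ω × Ω) (i : ZMod 8) : Ω := ((hstep t a b)^[i.val] p).2.2

theorem hxs_natCast (h2 : (2 : Ω) = 0) (t a b : Ω) (p : Ω × Ω × Ω) (n : ℕ) :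
    hxs t a b p (n : ZMod 8) = ((hstep t a b)^[n] p).2.2 := by
  rw [hxs, ZMod.val_natCast, ← hstep_mod h2]

theorem hsol_iter (h2 : (2 : Ω) = 0) {t a b : Ω} (ha : a ^ 2 + a = t + 1)
    (hb : b ^ 2 + b = t ^ 3 + t ^ 2) {p : Ω × Ω × Ω} (hp : hsol t p) (n : ℕ) :
    hsol t ((hstep t a b)^[n] p) := by
  induction n with
  | zero => exact hp
  | succ n ih => rw [Function.iterate_succ_apply']; exact hstep_sol h2 ha hb ih

theorem hact (h2 : (2 : Ω) = 0) (t0 : F) {a b : Ω} {p : Ω × Ω × Ω}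
    (ha : a ^ 2 + a = algebraMap F Ω t0 + 1)
    (hb : b ^ 2 + b = algebraMap F Ω t0 ^ 3 + algebraMap F Ω t0 ^ 2)
    (hp : hsol (algebraMap F Ω t0) p) (τ : Ω ≃ₐ[F] Ω) (u : (ZMod 8)ˣ)
    (hu : ∀ q, hsol (algebraMap F Ω t0) q → hstep (algebraMap F Ω t0) (τ a) (τ b) q
      = (hstep (algebraMap F Ω t0) a b)^[(u : ZMod 8).val] q) :
    ∃ k : ℕ, τ p.1 = p.1 + k ∧ ∀ i, τ (hxs (algebraMap F Ω t0) a b p i)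
      = hxs (algebraMap F Ω t0) a b p (k + u * i) := by
  set t := algebraMap F Ω t0 with ht
  have hτt : τ t = t := τ.commutes t0
  let m : Ω × Ω × Ω → Ω × Ω × Ω := fun q => (τ q.1, τ q.2.1, τ q.2.2)
  have hm : ∀ q, m (hstep t a b q) = hstep t (τ a) (τ b) (m q) := by
    intro q; simp [m, hstep, hτt]
  have hmp : hsol t (m p) := by
    obtain ⟨h1, h3, h4⟩ := hp
    refine ⟨?_, ?_, ?_⟩
    · simpa [m] using congrArg τ h1
    · simpa [m, hτt] using congrArg τ h3
    · simpa [m, hτt] using congrArg τ h4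
  obtain ⟨k, hk⟩ := hsol_exists h2 ha hb hp hmp
  have key : ∀ n : ℕ, m ((hstep t a b)^[n] p) = (hstep t a b)^[k + (u : ZMod 8).val * n] p := by
    intro n
    induction n with
    | zero => simpa using hk
    | succ n ih =>
      rw [Function.iterate_succ_apply', hm, ih, hu _ (hsol_iter h2 ha hb hp _),
        ← Function.iterate_add_apply]
      congr 1; ring
  refine ⟨k, ?_, fun i => ?_⟩
  · rw [← hstep_fst (T := t) (a := a) (b := b) p k, ← hk]
  · have h1 : (k + u * i : ZMod 8) = ((k + (u : ZMod 8).val * i.val : ℕ) : ZMod 8) := by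
      push_cast; simp
    rw [h1, hxs_natCast h2, ← key]
    rfl
end

theorem as_root {Ω : Type*} [Field Ω] [IsSepClosed Ω] (h2 : (2 : Ω) = 0) (c : Ω) :
    ∃ z : Ω, z ^ 2 + z = c := by
  have hd : (X ^ 2 + X - C c : Polynomial Ω).degree = 2 := by compute_degree!
  have hs : (X ^ 2 + X - C c : Polynomial Ω).Separable := by
    have : derivative (X ^ 2 + X - C c : Polynomial Ω) = 1 := by
      have h3 : (1 + 1 : Polynomial Ω) = 0 := by
        rw [one_add_one_eq_two, ← C_ofNat, h2, C_0]
      simp [h3]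
    rw [separable_def, this]
    exact isCoprime_one_right
  obtain ⟨z, hz⟩ := IsSepClosed.exists_root _ (by rw [hd]; decide) hs
  refine ⟨z, ?_⟩
  simpa [sub_eq_zero] using hz

theorem hol_mul_left (h h' : Multiplicative (ZMod 8) ⋊[hol8Phi] (ZMod 8)ˣ) :
    (h * h').left.toAdd = h.left.toAdd + h.right * h'.left.toAdd := by
  rw [SemidirectProduct.mul_left, toAdd_mul]
  rfl

theorem gal_aux : Nonempty (fK.Gal ≃* Multiplicative (ZMod 8) ⋊[hol8Phi] (ZMod 8)ˣ) := by
  let F := RatFunc (ZMod 2)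
  let Ω := SeparableClosure F
  have h2F : (2 : F) = 0 := by
    have := congrArg (algebraMap (ZMod 2) F) (show (2 : ZMod 2) = 0 by decide)
    rwa [map_ofNat, map_zero] at this
  have h2 : (2 : Ω) = 0 := by
    have := congrArg (algebraMap F Ω) h2F
    rwa [map_ofNat, map_zero] at this
  let t : Ω := algebraMap F Ω T2
  obtain ⟨a, ha⟩ := as_root h2 (t + 1)
  obtain ⟨b, hb⟩ := as_root h2 (t ^ 3 + t ^ 2)
  obtain ⟨g, hg⟩ := as_root h2 (1 : Ω)
  obtain ⟨d, hd⟩ := as_root h2 (g * t)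
  obtain ⟨x, hx⟩ := as_root h2 (t * d * (g + t))
  let p : Ω × Ω × Ω := (g, d, x)
  have hp : hsol t p := ⟨hg, hd, hx⟩
  let xs : ZMod 8 → Ω := hxs t a b p
  let c : ZMod 2 →+* F := algebraMap (ZMod 2) F
  -- prescribed action on the quadratic generators
  have hsurj : ∀ e : Fin 3 → ZMod 2, ∃ τ : Ω ≃ₐ[F] Ω, τ a = a + algebraMap F Ω (c (e 0)) ∧
      τ b = b + algebraMap F Ω (c (e 1)) ∧ τ g = g + algebraMap F Ω (c (e 2)) := by
    intro e
    obtain ⟨τ, hτ⟩ := char_surj (F := F) (Ω := Ω) h2 c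
      ![RatFunc.X + 1, RatFunc.X ^ 3 + RatFunc.X ^ 2, 1] ![a, b, g]
      (by
        intro i
        fin_cases i
        · simpa [t, T2] using ha
        · simpa [t, T2] using hb
        · simpa using hg)
      (fun e he z => ratfunc_nosol e he z) e
    exact ⟨τ, hτ 0, hτ 1, hτ 2⟩
  -- every automorphism acts affinely
  have hu1 : ∀ q, hsol t q → hstep t a b q = (hstep t a b)^[1] q := fun q _ => rfl
  have hall : ∀ τ : Ω ≃ₐ[F] Ω, ∃ h : Multiplicative (ZMod 8) ⋊[hol8Phi] (ZMod 8)ˣ,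
      ∀ i, τ (xs i) = xs (h.left.toAdd + h.right * i) := by
    intro τ
    suffices hs : ∃ u : (ZMod 8)ˣ, ∀ q, hsol t q →
        hstep t (τ a) (τ b) q = (hstep t a b)^[(u : ZMod 8).val] q by
      obtain ⟨u, hu⟩ := hs
      obtain ⟨k, -, hk⟩ := hact h2 T2 ha hb hp τ u hu
      exact ⟨⟨Multiplicative.ofAdd (k : ZMod 8), u⟩, hk⟩
    have hτt : τ t = t := τ.commutes T2
    have ha' : τ a ^ 2 + τ a = t + 1 := by simpa [hτt] using congrArg τ ha
    have hb' : τ b ^ 2 + τ b = t ^ 3 + t ^ 2 := by simpa [hτt] using congrArg τ hb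
    rcases as_cases h2 ha ha' with h | h <;> rcases as_cases h2 hb hb' with h' | h' <;>
      rw [h, h']
    · exact ⟨1, hu1⟩
    · exact ⟨⟨5, 5, by decide, by decide⟩, fun q _ => hstep_b h2 q⟩
    · exact ⟨⟨7, 7, by decide, by decide⟩, fun q hq => hstep_a h2 ha hq⟩
    · exact ⟨⟨3, 3, by decide, by decide⟩, fun q hq => hstep_ab h2 ha hq⟩
  -- every unit occurs
  have hunit : ∀ u : (ZMod 8)ˣ, ∃ (τ : Ω ≃ₐ[F] Ω) (k : ZMod 8),
      ∀ i, τ (xs i) = xs (k + u * i) := by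
    intro u
    suffices hs : ∃ τ : Ω ≃ₐ[F] Ω, ∀ q, hsol t q →
        hstep t (τ a) (τ b) q = (hstep t a b)^[(u : ZMod 8).val] q by
      obtain ⟨τ, hu⟩ := hs
      obtain ⟨k, -, hk⟩ := hact h2 T2 ha hb hp τ u hu
      exact ⟨τ, k, hk⟩
    have hc : ∀ u : (ZMod 8)ˣ, (u : ZMod 8).val = 1 ∨ (u : ZMod 8).val = 5 ∨
        (u : ZMod 8).val = 7 ∨ (u : ZMod 8).val = 3 := by decide
    rcases hc u with h | h | h | h <;> rw [h]
    · exact ⟨1, hu1⟩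
    · obtain ⟨τ, h1, h3, -⟩ := hsurj ![0, 1, 0]
      refine ⟨τ, fun q hq => ?_⟩
      rw [h1, h3, ← hstep_b h2]; simp
    · obtain ⟨τ, h1, h3, -⟩ := hsurj ![1, 0, 0]
      refine ⟨τ, fun q hq => ?_⟩
      rw [h1, h3, ← hstep_a h2 ha hq]; simp
    · obtain ⟨τ, h1, h3, -⟩ := hsurj ![1, 1, 0]
      refine ⟨τ, fun q hq => ?_⟩
      rw [h1, h3, ← hstep_ab h2 ha hq]; simp
  -- every translation occurs
  have htrans : ∀ j : ZMod 8, ∃ ρ : Ω ≃ₐ[F] Ω, ∀ i, ρ (xs i) = xs (j + i) := by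
    obtain ⟨τ, h1, h3, h4⟩ := hsurj ![0, 0, 1]
    obtain ⟨k, hk, hτ⟩ := hact h2 T2 ha hb hp τ 1 (by
      intro q hq
      rw [h1, h3]
      simp only [Matrix.cons_val_zero, Matrix.cons_val_one, map_zero, add_zero]
      exact hu1 q hq)
    have hodd : (k : ZMod 8) * k = 1 := by
      have h5 : (k : Ω) = 1 := by
        have : g + (k : Ω) = g + 1 := by
          rw [← show τ g = g + k from hk, h4]; simp
        exact add_left_cancel this
      have h6 : k % 2 = 1 := by
        rcases Nat.mod_two_eq_zero_or_one k with h | h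
        · exfalso
          obtain ⟨r, rfl⟩ := Nat.dvd_of_mod_eq_zero h
          push_cast at h5
          rw [h2, zero_mul] at h5
          exact zero_ne_one h5
        · exact h
      obtain ⟨r, rfl⟩ : ∃ r, k = 2 * r + 1 := ⟨k / 2, by omega⟩
      push_cast
      generalize (r : ZMod 8) = s
      revert s; decide
    have hpow : ∀ m : ℕ, ∀ i, (τ ^ m) (xs i) = xs (m * k + i) := by
      intro m
      induction m with
      | zero => intro i; simp
      | succ n ih =>
        intro i
        rw [pow_succ, AlgEquiv.mul_apply, show τ (xs i) = _ from hτ i, ih]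
        congr 1; push_cast; simp; ring
    intro j
    refine ⟨τ ^ (j * k).val, fun i => ?_⟩
    rw [hpow, ZMod.natCast_zmod_val, mul_assoc, hodd, mul_one]
  have hx4 : xs 4 ≠ xs 0 := by
    have h4 : xs 4 = x + 1 := by
      have := hxs_natCast h2 t a b p 4
      rw [hstep_four h2] at this
      exact this
    have h0 : xs 0 = x := rfl
    rw [h4, h0]
    simp
  have hinj : Function.Injective xs := by
    intro i j hij
    by_contra hne
    have hper : ∀ l, xs l = xs (l + (j - i)) := by
      intro l
      obtain ⟨ρ, hρ⟩ := htrans (l - i)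
      have := congrArg ρ hij
      rw [hρ, hρ] at this
      convert this using 2 <;> ring
    have hd0 : j - i ≠ 0 := sub_ne_zero.2 (Ne.symm hne)
    generalize j - i = e at hper hd0
    have hm : ∀ m : ℕ, xs 0 = xs (m * e) := by
      intro m
      induction m with
      | zero => simp
      | succ n ih => rw [ih, hper]; congr 1; push_cast; ring
    have hcs : ∀ e : ZMod 8, e ≠ 0 → ((1 : ℕ) : ZMod 8) * e = 4 ∨ ((2 : ℕ) : ZMod 8) * e = 4 ∨
        ((4 : ℕ) : ZMod 8) * e = 4 := by decide
    rcases hcs e hd0 with h | h | h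
    · exact hx4 (by rw [← h, ← hm])
    · exact hx4 (by rw [← h, ← hm])
    · exact hx4 (by rw [← h, ← hm])
  have huniq : ∀ h h' : Multiplicative (ZMod 8) ⋊[hol8Phi] (ZMod 8)ˣ,
      (∀ i, xs (h.left.toAdd + h.right * i) = xs (h'.left.toAdd + h'.right * i)) → h = h' := by
    intro h h' hh
    have e0 := hinj (hh 0)
    have e1 := hinj (hh 1)
    simp only [mul_zero, add_zero] at e0
    rw [e0] at e1
    have e2 := add_left_cancel e1
    simp only [mul_one] at e2
    exact SemidirectProduct.ext (Multiplicative.toAdd.injective e0) (Units.ext e2)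
  choose Φ hΦ using hall
  let Ψ : (Ω ≃ₐ[F] Ω) →* Multiplicative (ZMod 8) ⋊[hol8Phi] (ZMod 8)ˣ :=
    MonoidHom.mk' Φ (by
      intro τ τ'
      apply huniq
      intro i
      rw [← hΦ, AlgEquiv.mul_apply, hΦ τ', hΦ τ, hol_mul_left, SemidirectProduct.mul_right]
      congr 1
      push_cast
      ring)
  have hΨs : Function.Surjective Ψ := by
    intro h
    obtain ⟨τ, k, hτ⟩ := hunit h.right
    obtain ⟨ρ, hρ⟩ := htrans (h.left.toAdd - k)
    refine ⟨ρ * τ, ?_⟩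
    apply huniq
    intro i
    change xs ((Φ (ρ * τ)).left.toAdd + (Φ (ρ * τ)).right * i) = _
    rw [← hΦ, AlgEquiv.mul_apply, hτ, hρ]
    congr 1; ring
  -- the roots
  have hmonic : fK.Monic := by unfold fK; monicity!
  have hdeg : fK.natDegree = 8 := by unfold fK; compute_degree!
  have hf0 : fK.map (algebraMap F Ω) ≠ 0 := (hmonic.map _).ne_zero
  have hroot : ∀ i, aeval (xs i) fK = 0 := by
    intro i
    have := hsol_root h2 (hsol_iter h2 ha hb hp i.val)
    rw [← this]
    simp only [fK, map_add, map_mul, map_pow, aeval_X, aeval_C, map_one]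
    rfl
  have hroots : (Finset.univ : Finset (ZMod 8)).val.map xs = (fK.map (algebraMap F Ω)).roots := by
    apply Multiset.eq_of_le_of_card_le
    · rw [Multiset.le_iff_subset (Finset.univ.nodup.map hinj)]
      intro y hy
      obtain ⟨i, -, rfl⟩ := Multiset.mem_map.1 hy
      rw [mem_roots hf0, IsRoot.def, eval_map_algebraMap]
      exact hroot i
    · refine (card_roots' _).trans ?_
      rw [hmonic.natDegree_map, hdeg]
      simp
  have hsplit : (fK.map (algebraMap F Ω)).Splits := by
    rw [splits_iff_card_roots, ← hroots, hmonic.natDegree_map, hdeg]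
    simp
  have : Fact ((fK.map (algebraMap F Ω)).Splits) := ⟨hsplit⟩
  let R := Gal.restrict fK Ω
  have hRs : Function.Surjective R := Gal.restrict_surjective fK Ω
  have hker : R.ker = Ψ.ker := by
    ext τ
    rw [MonoidHom.mem_ker, MonoidHom.mem_ker]
    constructor
    · intro hτ
      apply huniq
      intro i
      change xs ((Φ τ).left.toAdd + (Φ τ).right * i) = _
      rw [← hΦ]
      have hm : xs i ∈ fK.rootSet Ω := by
        rw [mem_rootSet_of_ne hmonic.ne_zero]; exact hroot i
      have := Gal.restrict_smul (p := fK) τ (⟨xs i, hm⟩ : fK.rootSet Ω)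
      rw [← this, show Gal.restrict fK Ω τ = 1 from hτ, one_smul]
      simp
    · intro hτ
      apply Gal.galActionHom_injective fK Ω
      refine Equiv.ext fun y => Subtype.ext ?_
      rw [map_one, Gal.galActionHom_restrict]
      obtain ⟨y, hy⟩ := y
      have hy' : y ∈ (fK.map (algebraMap F Ω)).roots := by
        rw [mem_roots hf0, IsRoot.def, eval_map_algebraMap]
        exact (mem_rootSet_of_ne hmonic.ne_zero).1 hy
      rw [← hroots] at hy'
      obtain ⟨i, -, rfl⟩ := Multiset.mem_map.1 hy'
      change τ (xs i) = xs i
      rw [hΦ, show Φ τ = 1 from hτ]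
      simp
  exact ⟨(QuotientGroup.quotientKerEquivOfSurjective R hRs).symm.trans
    ((QuotientGroup.quotientMulEquivOfEq hker).trans
      (QuotientGroup.quotientKerEquivOfSurjective Ψ hΨs))⟩

/-- The Galois group of the splitting field `N` of `f_K` over `𝔽₂(T)` has order `32` and is
isomorphic to the holomorph `C₈ ⋊ (ℤ/8ℤ)ˣ` of `ℤ/8ℤ` (the transitive group 8T15). -/
theorem gal_fK_eq_holomorph_zmod8 :
    Nat.card fK.Gal = 32 ∧
    Nonempty (fK.Gal ≃* Multiplicative (ZMod 8) ⋊[hol8Phi] (ZMod 8)ˣ) := by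
  obtain ⟨e⟩ := gal_aux
  refine ⟨?_, ⟨e⟩⟩
  rw [Nat.card_congr e.toEquiv, Nat.card_congr SemidirectProduct.equivProd, Nat.card_prod]
  have h1 : Nat.card (Multiplicative (ZMod 8)) = 8 := by
    rw [Nat.card_congr Multiplicative.toAdd, Nat.card_zmod]
  have h2 : Nat.card (ZMod 8)ˣ = 4 := by
    rw [Nat.card_eq_fintype_card, ZMod.card_units_eq_totient]
    decide
  rw [h1, h2]
end

section
/- The polynomial X⁴ + (T+1)X² + TX + T² ∈ 𝔽_2(T)[X] is irreducible over 𝔽_2(T), and the Galois group of its splitting field over 𝔽_2(T) is isomorphic to the dihedral group D₄ of order 8. -/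
open Polynomial

/-- The quartic polynomial `X⁴ + (T+1)X² + TX + T²` over `𝔽₂(T)`. -/
noncomputable def quarticF : Polynomial (RatFunc (ZMod 2)) :=
  X ^ 4 + C (T2 + 1) * X ^ 2 + C T2 * X + C (T2 ^ 2)

instance : CharP (RatFunc (ZMod 2)) 2 := charP_of_injective_algebraMap (algebraMap (ZMod 2) (RatFunc (ZMod 2))).injective 2

theorem as_step {K L : Type*} [Field K] [Field L] [Algebra K L] [FiniteDimensional K L]
    (E : IntermediateField K L) (x : L) (hx : x ^ 2 + x ∈ E) (hxE : x ∉ E) :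
    ∃ E' : IntermediateField K L, E ≤ E' ∧ x ∈ E' ∧
      Module.finrank K E' = 2 * Module.finrank K E ∧
      ∀ z ∈ E', ∃ c ∈ E, ∃ d ∈ E, z = c + d * x := by
  have hint : IsIntegral E x := IsIntegral.of_finite E x
  let p : E[X] := X ^ 2 + X - C ⟨_, hx⟩
  have hp : p.Monic := by unfold p; monicity!
  have hpd : p.natDegree = 2 := by unfold p; compute_degree!
  have hpx : aeval x p = 0 := by simp [p, IntermediateField.algebraMap_apply]
  have h2 : (minpoly E x).natDegree = 2 := by
    apply le_antisymm
    · rw [← hpd]; exact natDegree_le_of_dvd (minpoly.dvd _ _ hpx) hp.ne_zero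
    · rw [minpoly.two_le_natDegree_iff hint]
      rintro ⟨y, rfl⟩
      exact hxE y.2
  let F := IntermediateField.adjoin E {x}
  refine ⟨F.restrictScalars K, ?_, ?_, ?_, ?_⟩
  · intro y hy
    exact F.algebraMap_mem ⟨y, hy⟩
  · exact IntermediateField.mem_adjoin_simple_self E x
  · have h1 : Module.finrank E F = 2 := by rw [IntermediateField.adjoin.finrank hint, h2]
    have := Module.finrank_mul_finrank K E F
    rw [h1] at this
    rw [mul_comm, this]; rfl
  · intro z hz
    have hz' : z ∈ IntermediateField.adjoin E {x} := hz
    rw [← IntermediateField.mem_toSubalgebra, IntermediateField.adjoin_simple_toSubalgebra_of_isAlgebraic hint.isAlgebraic, Algebra.adjoin_singleton_eq_range_aeval] at hz'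
    obtain ⟨q, rfl⟩ := hz'
    have hm : aeval x q = aeval x (q %ₘ p) := by
      conv_lhs => rw [← modByMonic_add_div q p]
      simp [hpx]
    have hd : (q %ₘ p).natDegree ≤ 1 := by
      have := natDegree_modByMonic_lt q hp (by intro h; rw [h] at hpd; simp at hpd)
      omega
    obtain ⟨a, b, hab⟩ := exists_eq_X_add_C_of_natDegree_le_one hd
    refine ⟨b, b.2, a, a.2, ?_⟩
    change aeval x q = _
    rw [hm, hab]; simp [IntermediateField.algebraMap_apply, add_comm]

theorem poly_of_sq (u : RatFunc (ZMod 2)) (c : (ZMod 2)[X]) (h : u ^ 2 + u = algebraMap _ _ c) :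
    ∃ p : (ZMod 2)[X], p ^ 2 + p = c := by
  have : IsIntegral (ZMod 2)[X] u := by
    refine ⟨X ^ 2 + X - C c, by monicity!, ?_⟩
    simp [h]
  obtain ⟨p, rfl⟩ := IsIntegrallyClosed.isIntegral_iff.1 this
  refine ⟨p, IsFractionRing.injective (ZMod 2)[X] (RatFunc (ZMod 2)) ?_⟩
  simpa using h

theorem no_omega (u : RatFunc (ZMod 2)) (h : u ^ 2 + u = 1) : False := by
  obtain ⟨p, hp⟩ := poly_of_sq u 1 (by simpa using h)
  have := congrArg (eval 0) hp
  simp only [eval_add, eval_pow, eval_one] at this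
  generalize eval 0 p = a at this
  revert a; decide

theorem no_T (e : ZMod 2) (u : RatFunc (ZMod 2)) (h : u ^ 2 + u = T2 + RatFunc.C e) : False := by
  obtain ⟨p, hp⟩ := poly_of_sq u (X + C e) (by simpa [T2] using h)
  have h1 : p ^ 2 + p = p * (p + C 1) := by rw [C_1]; ring
  rw [h1] at hp
  have := congrArg natDegree hp
  rw [natDegree_X_add_C, natDegree_mul', natDegree_add_C] at this
  · omega
  · rw [← leadingCoeff_mul', hp, leadingCoeff_X_add_C]; exact one_ne_zero
    intro h0
    have := mul_eq_zero.1 h0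
    rw [leadingCoeff_eq_zero, leadingCoeff_eq_zero] at this
    rw [mul_eq_zero.2 this] at hp
    exact X_add_C_ne_zero e hp.symm

def d4perm : DihedralGroup 4 →* Equiv.Perm (ZMod 4) where
  toFun
    | .r i => ⟨fun x => x + i, fun x => x - i, fun x => by simp, fun x => by simp⟩
    | .sr i => ⟨fun x => -x - i, fun x => -x - i, fun x => by simp, fun x => by simp⟩
  map_one' := by ext x; revert x; decide
  map_mul' := by decide

theorem d4perm_inj : Function.Injective d4perm := by decide
theorem d4_of {G : Type*} [Group G] {S : Type*} [Finite S] (hS : Nat.card S = 4) (hG : Nat.card G = 8)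
    (f : G →* Equiv.Perm S) (hf : Function.Injective f) : Nonempty (G ≃* DihedralGroup 4) := by
  have e : S ≃ ZMod 4 := (Finite.equivFinOfCardEq hS).trans (Equiv.refl (Fin 4))
  let g : G →* Equiv.Perm (ZMod 4) := (e.permCongrHom : _ →* _).comp f
  have hg : Function.Injective g := e.permCongrHom.injective.comp hf
  have : Fact (Nat.Prime 2) := ⟨Nat.prime_two⟩
  have e1 := MonoidHom.ofInjective hg
  have e2 := MonoidHom.ofInjective d4perm_inj
  have hc : Nat.card (Equiv.Perm (ZMod 4)) = 24 := by
    rw [Nat.card_perm]; simp; rfl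
  have hfac : Nat.factorization 24 2 = 3 := by
    rw [Nat.factorization_def _ Nat.prime_two, show 24 = 2^3*3 by norm_num,
      padicValNat.mul (by norm_num) (by norm_num), padicValNat.prime_pow,
      padicValNat.eq_zero_of_not_dvd (by norm_num)]
  let P : Sylow 2 (Equiv.Perm (ZMod 4)) := Sylow.ofCard g.range (by
    rw [← Nat.card_congr e1.toEquiv, hG, hc, hfac]; norm_num)
  let Q : Sylow 2 (Equiv.Perm (ZMod 4)) := Sylow.ofCard d4perm.range (by
    rw [← Nat.card_congr e2.toEquiv, hc, hfac, DihedralGroup.nat_card]; norm_num)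
  exact ⟨(e1.trans (P.equiv Q)).trans e2.symm⟩

theorem indep {K L : Type*} [Field K] [Field L] [Algebra K L] (w : L)
    (hw : w ∉ (⊥ : IntermediateField K L)) (a b : K)
    (h : algebraMap K L a + algebraMap K L b * w = 0) : a = 0 ∧ b = 0 := by
  have hb : b = 0 := by
    by_contra hb
    apply hw
    rw [IntermediateField.mem_bot]
    refine ⟨-a / b, ?_⟩
    have : algebraMap K L b ≠ 0 := by simpa using hb
    rw [map_div₀, map_neg, div_eq_iff this]
    linear_combination -h
  subst hb
  simpa using h

theorem key {K L : Type*} [Field K] [Field L] [Algebra K L] [CharP L 2] (w : L)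
    (hw : w ∉ (⊥ : IntermediateField K L)) (hw2 : w ^ 2 + w = 1) (c d p q : K)
    (h : (algebraMap K L c + algebraMap K L d * w) ^ 2 + (algebraMap K L c + algebraMap K L d * w)
      = algebraMap K L p + algebraMap K L q * w) :
    c ^ 2 + c + d ^ 2 = p ∧ d ^ 2 + d = q := by
  have h2 : (2 : L) = 0 := CharTwo.two_eq_zero
  have := indep w hw (c ^ 2 + c + d ^ 2 - p) (d ^ 2 + d - q) (by
    simp only [map_sub, map_add, map_pow]
    linear_combination h - (algebraMap K L d) ^ 2 * hw2 + ((algebraMap K L d) ^ 2 * w - algebraMap K L c * algebraMap K L d * w) * h2)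
  exact ⟨sub_eq_zero.1 this.1, sub_eq_zero.1 this.2⟩

theorem T2_ne : T2 ≠ 0 := RatFunc.X_ne_zero

theorem quartic_monic : quarticF.Monic := by unfold quarticF; monicity!
theorem quartic_deg : quarticF.natDegree = 4 := by unfold quarticF; compute_degree!
theorem quartic_sep : quarticF.Separable := by
  have h2 : (2 : (RatFunc (ZMod 2))[X]) = 0 := CharTwo.two_eq_zero
  have : derivative quarticF = C T2 := by
    simp only [quarticF, derivative_add, derivative_mul, derivative_C, derivative_X_pow,
      derivative_X]
    simp only [map_natCast]
    push_cast
    linear_combination (2 * X ^ 3 + C (T2 + 1) * X) * h2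
  rw [separable_def, this]
  exact ⟨0, C T2⁻¹, by rw [zero_mul, zero_add, ← C_mul, inv_mul_cancel₀ T2_ne, C_1]⟩
 
theorem quartic_fac {L : Type*} [Field L] [Algebra (RatFunc (ZMod 2)) L] [CharP L 2] (w : L)
    (hw2 : w ^ 2 + w = 1) :
    quarticF.map (algebraMap (RatFunc (ZMod 2)) L) =
      (X ^ 2 + X + C (w * algebraMap (RatFunc (ZMod 2)) L T2)) *
        (X ^ 2 + X + C ((w + 1) * algebraMap (RatFunc (ZMod 2)) L T2)) := by
  have h2' : (2 : L[X]) = 0 := CharTwo.two_eq_zero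
  have hw2' : (C w : L[X]) ^ 2 + C w = 1 := by rw [← C_pow, ← C_add, hw2, C_1]
  simp only [quarticF, Polynomial.map_add, Polynomial.map_mul, Polynomial.map_pow, map_X, map_C,
    RingHom.map_add, RingHom.map_one, Polynomial.map_one, RingHom.map_pow, C_mul, C_add, C_1]
  generalize C (algebraMap (RatFunc (ZMod 2)) L T2) = t
  linear_combination (-t ^ 2) * hw2' + (- X ^ 3 - C w * t * X ^ 2 - C w * t * X) * h2'

theorem main_aux : Irreducible quarticF ∧
    Module.finrank (RatFunc (ZMod 2)) quarticF.SplittingField = 8 := by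
  set K := RatFunc (ZMod 2) with hK
  set L := quarticF.SplittingField with hL
  have : CharP L 2 := charP_of_injective_algebraMap (algebraMap K L).injective 2
  have h2 : (2 : L) = 0 := CharTwo.two_eq_zero
  set t : L := algebraMap K L T2 with ht
  have ht0 : t ≠ 0 := by simpa [ht] using T2_ne
  have hsp := SplittingField.splits quarticF
  have hev : ∀ z : L, aeval z quarticF = z ^ 4 + (t + 1) * z ^ 2 + t * z + t ^ 2 := by
    intro z; simp [quarticF, ht]; rfl
  obtain ⟨α, hα⟩ := hsp.exists_eval_eq_zero (by
    rw [degree_map, degree_eq_natDegree quartic_monic.ne_zero, quartic_deg]; norm_num)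
  rw [eval_map_algebraMap] at hα
  have hα' := hα
  rw [hev] at hα'
  obtain ⟨w, hw⟩ : ∃ w, α ^ 2 + α = w * t := ⟨(α ^ 2 + α) / t, by field_simp⟩
  have hw2 : w ^ 2 + w = 1 := by
    have : t ^ 2 * (w ^ 2 + w - 1) = 0 := by
      linear_combination hα' - (α ^ 2 + α + w * t + t) * hw - (-α^3 + t^2) * h2
    have := (mul_eq_zero.1 this).resolve_left (pow_ne_zero _ ht0)
    exact sub_eq_zero.1 this
  -- factorisation
  have hfac : quarticF.map (algebraMap K L) =
      (X ^ 2 + X + C (w * t)) * (X ^ 2 + X + C ((w + 1) * t)) :=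
    quartic_fac w hw2
  obtain ⟨β, hβ⟩ : ∃ β : L, β ^ 2 + β + (w + 1) * t = 0 := by
    have hd : (X ^ 2 + X + C ((w + 1) * t) : L[X]).natDegree = 2 := by compute_degree!
    have hs : (X ^ 2 + X + C ((w + 1) * t) : L[X]).Splits :=
      Splits.of_dvd hsp (quartic_monic.map _).ne_zero (hfac ▸ dvd_mul_left _ _)
    obtain ⟨β, hβ⟩ := hs.exists_eval_eq_zero (by
      intro h; rw [natDegree_eq_of_degree_eq_some h] at hd; norm_num at hd)
    exact ⟨β, by simpa using hβ⟩
  have hwK : w ∉ (⊥ : IntermediateField K L) := by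
    rw [IntermediateField.mem_bot]
    rintro ⟨u, rfl⟩
    apply no_omega u
    apply (algebraMap K L).injective
    simpa using hw2
  obtain ⟨E1, h01, hwE, hr1, hE1⟩ := as_step (⊥ : IntermediateField K L) w
    (by rw [hw2]; exact one_mem _) hwK
  have tE : t ∈ E1 := E1.algebraMap_mem _
  have hE1' : ∀ z ∈ E1, ∃ c d : K, z = algebraMap K L c + algebraMap K L d * w := by
    intro z hz
    obtain ⟨c, hc, d, hd, h⟩ := hE1 z hz
    rw [IntermediateField.mem_bot] at hc hd
    obtain ⟨c, rfl⟩ := hc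
    obtain ⟨d, rfl⟩ := hd
    exact ⟨c, d, h⟩
  have n1 : ∀ z ∈ E1, z ^ 2 + z ≠ w * t := by
    intro z hz h
    obtain ⟨c, d, rfl⟩ := hE1' z hz
    have := (key w hwK hw2 c d 0 T2 (by rw [h, map_zero, zero_add, mul_comm])).2
    exact no_T 0 d (by simpa using this)
  have n2 : ∀ z ∈ E1, z ^ 2 + z ≠ (w + 1) * t := by
    intro z hz h
    obtain ⟨c, d, rfl⟩ := hE1' z hz
    have := (key w hwK hw2 c d T2 T2 (by rw [h]; ring)).2
    exact no_T 0 d (by simpa using this)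
  have n3 : ∀ z ∈ E1, z ^ 2 + z ≠ t := by
    intro z hz h
    obtain ⟨c, d, rfl⟩ := hE1' z hz
    obtain ⟨k1, k2⟩ := key w hwK hw2 c d T2 0 (by rw [h, map_zero, zero_mul, add_zero])
    have : d * (d + 1) = 0 := by linear_combination k2
    rcases mul_eq_zero.1 this with hd | hd
    · exact no_T 0 c (by rw [map_zero]; linear_combination k1 - d * hd)
    · have h2K : (2 : RatFunc (ZMod 2)) = 0 := CharTwo.two_eq_zero
      exact no_T 1 c (by rw [map_one]; linear_combination k1 - (d - 1) * hd - h2K)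
  have hαE : α ∉ E1 := fun h => n1 α h hw
  obtain ⟨E2, h12, hαE2, hr2, hE2⟩ := as_step E1 α (by rw [hw]; exact mul_mem hwE tE) hαE
  have hβ' : β ^ 2 + β = (w + 1) * t := by linear_combination hβ - (w + 1) * t * h2
  have hβE : β ∉ E2 := by
    intro h
    obtain ⟨c, hc, d, hd, rfl⟩ := hE2 β h
    have e : (c ^ 2 + c + d ^ 2 * (w * t) - (w + 1) * t) + (d ^ 2 + d) * α = 0 := by
      linear_combination hβ' - d ^ 2 * hw + (d ^ 2 * α - c * d * α) * h2
    have hdd : d ^ 2 + d = 0 := by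
      by_contra hne
      apply hαE
      have : α = - (c ^ 2 + c + d ^ 2 * (w * t) - (w + 1) * t) / (d ^ 2 + d) := by
        rw [eq_div_iff hne]; linear_combination e
      rw [this]
      exact div_mem (neg_mem (sub_mem (add_mem (add_mem (pow_mem hc _) hc)
        (mul_mem (pow_mem hd _) (mul_mem hwE tE))) (mul_mem (add_mem hwE (one_mem _)) tE)))
        (add_mem (pow_mem hd _) hd)
    have : d * (d + 1) = 0 := by linear_combination hdd
    rcases mul_eq_zero.1 this with hd | hd
    · exact n2 c hc (by linear_combination e - α * hdd - d * w * t * hd)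
    · exact n3 c hc (by linear_combination e - α * hdd - (d - 1) * w * t * hd)
  obtain ⟨E3, h23, hβE3, hr3, hE3⟩ := as_step E2 β
    (by rw [hβ']; exact h12 (mul_mem (add_mem hwE (one_mem _)) tE)) hβE
  have hbot : Module.finrank K (⊥ : IntermediateField K L) = 1 := IntermediateField.finrank_bot
  constructor
  · have hint : IsIntegral K α := IsIntegral.of_finite K α
    have hle : E2 ≤ IntermediateField.adjoin K {α} := by
      have ha := IntermediateField.mem_adjoin_simple_self K α
      have hwa : w ∈ IntermediateField.adjoin K {α} := by
        have : w = (α ^ 2 + α) / t := by rw [eq_div_iff ht0, hw]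
        rw [this]
        exact div_mem (add_mem (pow_mem ha _) ha) (IntermediateField.algebraMap_mem _ _)
      have h1a : E1 ≤ IntermediateField.adjoin K {α} := by
        intro z hz
        obtain ⟨c, d, rfl⟩ := hE1' z hz
        exact add_mem (IntermediateField.algebraMap_mem _ _)
          (mul_mem (IntermediateField.algebraMap_mem _ _) hwa)
      intro z hz
      obtain ⟨c, hc, d, hd, rfl⟩ := hE2 z hz
      exact add_mem (h1a hc) (mul_mem (h1a hd) ha)
    have h4 : 4 ≤ (minpoly K α).natDegree := by
      rw [← IntermediateField.adjoin.finrank hint]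
      calc 4 = Module.finrank K E2 := by rw [hr2, hr1, hbot]
        _ ≤ _ := IntermediateField.finrank_le_of_le_right hle
    have : quarticF = minpoly K α := by
      refine (eq_of_monic_of_dvd_of_natDegree_le (minpoly.monic hint) quartic_monic
        (minpoly.dvd _ _ hα) ?_)
      rw [quartic_deg]; exact h4
    rw [this]
    exact minpoly.irreducible hint
  · have htop : E3 = ⊤ := by
      have hroot : quarticF.rootSet L ⊆ E3.toSubalgebra := by
        intro z hz
        have hz := aeval_eq_zero_of_mem_rootSet hz
        rw [← eval_map_algebraMap, hfac, eval_mul, mul_eq_zero] at hz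
        simp only [eval_add, eval_pow, eval_X, eval_C] at hz
        change z ∈ E3
        rcases hz with hz | hz
        · have : (z - α) * (z - α + 1) = 0 := by
            linear_combination hz - hw + (α ^ 2 - z * α - w * t) * h2
          rcases mul_eq_zero.1 this with h | h
          · rw [sub_eq_zero.1 h]; exact h23 hαE2
          · rw [show z = α - 1 by linear_combination h]; exact sub_mem (h23 hαE2) (one_mem _)
        · have : (z - β) * (z - β + 1) = 0 := by
            linear_combination hz - hβ' + (β ^ 2 - z * β - (w + 1) * t) * h2
          rcases mul_eq_zero.1 this with h | h
          · rw [sub_eq_zero.1 h]; exact hβE3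
          · rw [show z = β - 1 by linear_combination h]; exact sub_mem hβE3 (one_mem _)
      have := Algebra.adjoin_le hroot
      rw [SplittingField.adjoin_rootSet] at this
      rw [eq_top_iff]
      intro z _
      exact this (Algebra.mem_top)
    have : Module.finrank K E3 = 8 := by rw [hr3, hr2, hr1, hbot]
    rw [htop, IntermediateField.finrank_top'] at this
    exact this

/-- The polynomial `X⁴ + (T+1)X² + TX + T²` is irreducible over `𝔽₂(T)` and the Galois
group of its splitting field over `𝔽₂(T)` is the dihedral group of order `8`. -/
theorem quartic_gal_eq_dihedral :
    Irreducible quarticF ∧ Nonempty (quarticF.Gal ≃* DihedralGroup 4) := by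
  obtain ⟨hirr, hrank⟩ := main_aux
  refine ⟨hirr, ?_⟩
  have : Fact ((quarticF.map (algebraMap (RatFunc (ZMod 2)) quarticF.SplittingField)).Splits) :=
    ⟨SplittingField.splits quarticF⟩
  refine d4_of (S := quarticF.rootSet quarticF.SplittingField) ?_ ?_
    (Gal.galActionHom quarticF quarticF.SplittingField) (Gal.galActionHom_injective _ _)
  · rw [Nat.card_eq_fintype_card,
      card_rootSet_eq_natDegree quartic_sep (SplittingField.splits quarticF), quartic_deg]
  · rw [Gal.card_of_separable quartic_sep, hrank]
end

section
/- The polynomial X⁸ + (T⁴+T³+1)X⁴ + T⁵X² + (T⁵+T⁴+T³)X + (T¹⁰+T⁸+T⁵) ∈ 𝔽_2(T)[X] is irreducible over 𝔽_2(T), and the Galois group of its splitting field over 𝔽_2(T) has order 16 and is isomorphic to the direct product D₄ × C₂ of the dihedral group of order 8 with a cyclic group of order 2. -/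
open Polynomial

/-- The octic polynomial `X⁸ + (T⁴+T³+1)X⁴ + T⁵X² + (T⁵+T⁴+T³)X + (T¹⁰+T⁸+T⁵)`
over `𝔽₂(T)`. -/
noncomputable def fGamma : Polynomial (RatFunc (ZMod 2)) :=
  X ^ 8 + C (T2 ^ 4 + T2 ^ 3 + 1) * X ^ 4 + C (T2 ^ 5) * X ^ 2
    + C (T2 ^ 5 + T2 ^ 4 + T2 ^ 3) * X + C (T2 ^ 10 + T2 ^ 8 + T2 ^ 5)

set_option linter.unusedSimpArgs false
theorem tower_facts {F : Type*} [Field F] [CharP F 2] (T ω μ t δ ε ζ x y z : F)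
   (hω : ω^2 = ω+1) (hμ : μ^4 = μ + T) (ht : t^2 = t+T^3)
   (hδ : δ^2=δ) (hε : ε^2 = ε) (hζ : ζ^2=ζ)
   (hx : x = t + T*(μ^2+μ)+T+μ^3+ω*μ^2+(ω+1)*μ + δ + ε * (μ^2+μ) + ζ * (T + ω*μ^2+(ω+1)*μ))
   (hy : y = T * (T*(μ^2+μ)+T+μ+ω+ε+ζ*(T+ω)))
   (hz : z = T^2*(T^2+T+1)*(μ^2+μ+T+ζ)+T^2) :
   x^2 + x = y ∧ y^2 + T * y = z ∧ z^2 + (T^4+T^3+T^2)*z = T^10+T^8+T^5 := by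
  have h2 : (2:F) = 0 := CharTwo.two_eq_zero
  have sq : ∀ a b : F, (a+b)^2 = a^2+b^2 := fun a b => CharTwo.add_sq a b
  refine ⟨?_, ?_, ?_⟩
  · rw [hx, hy]; simp only [sq, mul_pow, hδ, hε, hζ, hω, ht]
    grind
  · rw [hy, hz]; simp only [sq, mul_pow, hδ, hε, hζ, hω, ht]
    grind
  · rw [hz]; simp only [sq, mul_pow, hδ, hε, hζ, hω, ht]
    grind

theorem poly_decomp {F : Type*} [Field F] [CharP F 2] (T x y z : F)
   (hy : y = x^2+x) (hz : z = y^2 + T * y) :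
   x^8+(T^4+T^3+1)*x^4+T^5*x^2+(T^5+T^4+T^3)*x+(T^10+T^8+T^5) =
     z^2 + (T^4+T^3+T^2)*z + (T^10+T^8+T^5) := by
  have h2 : (2:F) = 0 := CharTwo.two_eq_zero
  subst hz hy
  grind

theorem quad_eq {F : Type*} [Field F] [CharP F 2] (r a b : F) (h : a^2 + r * a = b^2 + r * b) :
    a = b ∨ a = b + r := by
  have h2 : (2:F) = 0 := CharTwo.two_eq_zero
  have : (a - b) * (a - (b + r)) = 0 := by grind
  rcases mul_eq_zero.1 this with h | h
  · left; exact sub_eq_zero.1 h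
  · right; exact sub_eq_zero.1 h

theorem quad_eq_one {F : Type*} [Field F] [CharP F 2] (a b : F) (h : a^2 + a = b^2 + b) :
    a = b ∨ a = b + 1 :=
  quad_eq 1 a b (by rw [one_mul, one_mul]; exact h)

theorem is_root {F : Type*} [Field F] [CharP F 2] (T ω μ t δ ε ζ x : F)
   (hω : ω^2 = ω+1) (hμ : μ^4 = μ + T) (ht : t^2 = t+T^3)
   (hδ : δ^2=δ) (hε : ε^2 = ε) (hζ : ζ^2=ζ)
   (hx : x = t + T*(μ^2+μ)+T+μ^3+ω*μ^2+(ω+1)*μ + δ + ε * (μ^2+μ) + ζ * (T + ω*μ^2+(ω+1)*μ)) :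
   x^8+(T^4+T^3+1)*x^4+T^5*x^2+(T^5+T^4+T^3)*x+(T^10+T^8+T^5) = 0 := by
  obtain ⟨h1, h2, h3⟩ := tower_facts T ω μ t δ ε ζ x _ _ hω hμ ht hδ hε hζ hx rfl rfl
  rw [poly_decomp T x _ _ h1.symm h2.symm, h3, CharTwo.add_self_eq_zero]

theorem roots_all {F : Type*} [Field F] [CharP F 2] (T ω μ t x : F)
   (hω : ω^2 = ω+1) (hμ : μ^4 = μ + T) (ht : t^2 = t+T^3)
   (hx : x^8+(T^4+T^3+1)*x^4+T^5*x^2+(T^5+T^4+T^3)*x+(T^10+T^8+T^5) = 0) :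
   ∃ δ ε ζ : F, (δ = 0 ∨ δ = 1) ∧ (ε = 0 ∨ ε = 1) ∧ (ζ = 0 ∨ ζ = 1) ∧
     x = t + T*(μ^2+μ)+T+μ^3+ω*μ^2+(ω+1)*μ + δ + ε * (μ^2+μ) + ζ * (T + ω*μ^2+(ω+1)*μ) := by
  have sqz : ∀ a : F, (a = 0 ∨ a = 1) → a^2 = a := by
    rintro a (rfl | rfl) <;> ring
  have TF := fun δ ε ζ (hδ : δ = 0 ∨ δ = 1) (hε : ε = 0 ∨ ε = 1) (hζ : ζ = 0 ∨ ζ = 1) =>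
    tower_facts T ω μ t δ ε ζ _ _ _ hω hμ ht (sqz _ hδ) (sqz _ hε) (sqz _ hζ) rfl rfl rfl
  rw [poly_decomp T x _ _ rfl rfl, CharTwo.add_eq_zero] at hx
  have o : (1:F) = 0 ∨ (1:F) = 1 := Or.inr rfl
  have n : (0:F) = 0 ∨ (0:F) = 1 := Or.inl rfl
  obtain ⟨ζ, hζ, h⟩ : ∃ ζ : F, (ζ = 0 ∨ ζ = 1) ∧
      (x^2+x)^2+T*(x^2+x) = T^2*(T^2+T+1)*(μ^2+μ+T+ζ)+T^2 := by
    rcases quad_eq _ _ _ (hx.trans (TF 0 0 0 n n n).2.2.symm) with h | h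
    · exact ⟨0, n, h⟩
    · refine ⟨1, o, h.trans ?_⟩; ring
  obtain ⟨ε, hε, h⟩ : ∃ ε : F, (ε = 0 ∨ ε = 1) ∧
      (x^2+x) = T * (T*(μ^2+μ)+T+μ+ω+ε+ζ*(T+ω)) := by
    rcases quad_eq _ _ _ (h.trans (TF 0 0 ζ n n hζ).2.1.symm) with h | h
    · exact ⟨0, n, h⟩
    · refine ⟨1, o, h.trans ?_⟩; ring
  obtain ⟨δ, hδ, h⟩ : ∃ δ : F, (δ = 0 ∨ δ = 1) ∧
      x = t + T*(μ^2+μ)+T+μ^3+ω*μ^2+(ω+1)*μ + δ + ε * (μ^2+μ) + ζ * (T + ω*μ^2+(ω+1)*μ) := by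
    have := h.trans (TF 0 ε ζ n hε hζ).1.symm
    rcases quad_eq_one _ _ this with h | h
    · exact ⟨0, n, h⟩
    · refine ⟨1, o, h.trans ?_⟩; ring
  exact ⟨δ, ε, ζ, hδ, hε, hζ, h⟩

/-- Non-solvability of Artin–Schreier equations. -/
theorem no_AS (p : (ZMod 2)[X]) (hp : Odd p.natDegree ∨ p.eval 0 ≠ 0) (y : RatFunc (ZMod 2)) :
    y^2 + y ≠ algebraMap _ _ p := by
  intro h
  have hi : IsIntegral (ZMod 2)[X] y := by
    refine ⟨X^2 + X - C p, by monicity!, ?_⟩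
    simp [h]
  obtain ⟨q, rfl⟩ := IsIntegrallyClosed.isIntegral_iff.1 hi
  have h' : q^2 + q = p := by
    apply IsFractionRing.injective (ZMod 2)[X] (RatFunc (ZMod 2))
    simpa using h
  rcases hp with hp | hp
  · by_cases hq : q.natDegree = 0
    · rw [natDegree_eq_zero] at hq
      obtain ⟨c, rfl⟩ := hq
      rw [← h'] at hp
      rw [← C_pow, ← C_add, natDegree_C] at hp
      simp at hp
    · have : p.natDegree = 2 * q.natDegree := by
        rw [← h', natDegree_add_eq_left_of_natDegree_lt, natDegree_pow]
        rw [natDegree_pow]; omega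
      rw [this] at hp
      exact absurd hp (by simp)
  · apply hp
    rw [← h', eval_add, eval_pow]
    generalize q.eval 0 = u
    revert u; decide

theorem no_comb (a b d : ZMod 2) (h : ¬ (a = 0 ∧ b = 0 ∧ d = 0)) (y : RatFunc (ZMod 2)) :
    y^2 + y ≠ algebraMap _ _ (C a + C b * X + C d * X^3 : (ZMod 2)[X]) := by
  apply no_AS
  by_cases hd : d = 0
  · by_cases hb : b = 0
    · right; subst hd hb; simpa using h
    · left
      have : (C a + C b * X + C d * X^3 : (ZMod 2)[X]).natDegree = 1 := by
        subst hd; simp; compute_degree!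
      rw [this]; decide
  · left
    have : (C a + C b * X + C d * X^3 : (ZMod 2)[X]).natDegree = 3 := by compute_degree!
    rw [this]; decide

open DihedralGroup in
/-- The Heisenberg parametrisation of `D₄`. -/
def e3 (a b c : ZMod 2) : DihedralGroup 4 :=
  (sr 0)^(a.val) * (sr 1)^(b.val) * (r 2)^((c + a*b).val)

theorem e3_mul : ∀ a b c a' b' c' : ZMod 2,
    e3 a b c * e3 a' b' c' = e3 (a+a') (b+b') (c+c'+a*b') := by
  decide
theorem e3_surj : ∀ g, ∃ a b c, e3 a b c = g := by decide
theorem e3_inj : ∀ a b c a' b' c', e3 a b c = e3 a' b' c' → a = a' ∧ b = b' ∧ c = c' := by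
  decide

theorem fGamma_natDegree : fGamma.natDegree = 8 := by
  unfold fGamma; compute_degree!

theorem fGamma_monic : fGamma.Monic := by
  unfold fGamma; monicity!

theorem alg_T2 : algebraMap (ZMod 2)[X] (RatFunc (ZMod 2)) X = T2 := by
  simp [T2]

theorem fGamma_separable : fGamma.Separable := by
  have h2 : (2 : (RatFunc (ZMod 2))[X]) = 0 := CharTwo.two_eq_zero
  have hd : derivative fGamma = C (T2 ^ 5 + T2 ^ 4 + T2 ^ 3) := by
    unfold fGamma
    simp only [derivative_add, derivative_mul, derivative_C, derivative_X_pow, derivative_X]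
    have h8 : ((8 : ℕ) : RatFunc (ZMod 2)) = 0 := by
      rw [CharP.cast_eq_zero_iff (RatFunc (ZMod 2)) 2]; norm_num
    have h4 : ((4 : ℕ) : RatFunc (ZMod 2)) = 0 := by
      rw [CharP.cast_eq_zero_iff (RatFunc (ZMod 2)) 2]; norm_num
    have h2 : ((2 : ℕ) : RatFunc (ZMod 2)) = 0 := by
      rw [CharP.cast_eq_zero_iff (RatFunc (ZMod 2)) 2]
    rw [h8, h4, h2]; simp
  have hne : (T2 ^ 5 + T2 ^ 4 + T2 ^ 3) ≠ 0 := by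
    rw [← alg_T2, ← map_pow, ← map_pow, ← map_pow, ← map_add, ← map_add]
    intro h
    rw [map_eq_zero_iff _ (IsFractionRing.injective (ZMod 2)[X] (RatFunc (ZMod 2)))] at h
    have := congrArg (fun p => coeff p 5) h
    simp [coeff_X_pow] at this
  rw [Polynomial.Separable, hd]
  exact ⟨0, C (T2 ^ 5 + T2 ^ 4 + T2 ^ 3)⁻¹, by rw [zero_mul, zero_add, ← C_mul, inv_mul_cancel₀ hne, C_1]⟩

theorem aeval_fGamma {F : Type*} [Field F] [Algebra (RatFunc (ZMod 2)) F] (x T : F)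
    (hT : T = algebraMap _ F T2) :
    aeval x fGamma =
      x^8+(T^4+T^3+1)*x^4+T^5*x^2+(T^5+T^4+T^3)*x+(T^10+T^8+T^5) := by
  subst hT; simp [fGamma]

theorem alg_omega {F : Type*} [Field F] [CharP F 2] (T ω μ : F)
    (hω : ω^2 = ω+1) (hμ : μ^4 = μ + T) :
    (T + ω*μ^2+(ω+1)*μ)^2 + (T + ω*μ^2+(ω+1)*μ) + T^2 = ω * T := by
  have h2 : (2:F) = 0 := CharTwo.two_eq_zero
  grind

theorem alg_mu {F : Type*} [Field F] [CharP F 2] (T ω μ : F) :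
    (T + ω*μ^2+(ω+1)*μ) + T + ω * (μ^2+μ) = μ := by
  have h2 : (2:F) = 0 := CharTwo.two_eq_zero
  grind

theorem alg_t {F : Type*} [Field F] [CharP F 2] (T ω μ t : F) :
    t + T*(μ^2+μ)+T+μ^3+ω*μ^2+(ω+1)*μ + 0 + 0 * (μ^2+μ) + 0 * (T + ω*μ^2+(ω+1)*μ)
      + (T*(μ^2+μ)+T+μ^3+ω*μ^2+(ω+1)*μ) = t := by
  have h2 : (2:F) = 0 := CharTwo.two_eq_zero
  grind

theorem alg_fix {F : Type*} [Field F] [CharP F 2] (ω μ t α β γ a b c d : F)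
    (hω : ω^2 = ω+1) (hb : b^2 = b) (hc : c^2 = c) (h : a * α + b * β + d * γ = 0) :
    α * (ω + a) + β * ((μ + b * ω + c)^2 + (μ + b * ω + c)) + γ * (t + d) =
      α * ω + β * (μ^2+μ) + γ * t := by
  have h2 : (2:F) = 0 := CharTwo.two_eq_zero
  grind

theorem alg_AS {F : Type*} [Field F] [CharP F 2] (T ω μ t α β γ : F)
    (hω : ω^2 = ω+1) (hμ : μ^4 = μ + T) (ht : t^2 = t+T^3)
    (ha : α^2 = α) (hb : β^2 = β) (hc : γ^2 = γ) :
    (α * ω + β * (μ^2+μ) + γ * t)^2 + (α * ω + β * (μ^2+μ) + γ * t) = α + β * T + γ * T^3 := by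
  have h2 : (2:F) = 0 := CharTwo.two_eq_zero
  have sq : ∀ a b : F, (a+b)^2 = a^2+b^2 := fun a b => CharTwo.add_sq a b
  simp only [sq, mul_pow, ha, hb, hc, hω, ht]
  grind

theorem comm_aux : ∀ c c' q1 q2 q3 q4 : ZMod 2,
    ((1:ZMod 2) + 0, (0:ZMod 2) + 1, c + c' + 1 * 1, (0:ZMod 2) + 0) =
      (q1 + (0 + 1), q2 + (1 + 0), q3 + (c' + c + 0 * 0) + q1 * (1 + 0), q4 + (0 + 0)) →
    (q1, q2, q3, q4) = ((0, 0, 1, 0) : ZMod 2 × ZMod 2 × ZMod 2 × ZMod 2) := by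
  decide

theorem ne_aux : ∀ z b : ZMod 2, z ≠ b → z = b + 1 := by decide
theorem ne_aux' : ∀ c' c : ZMod 2, c' ≠ c → c = 1 + c' := by decide

theorem exists_gens (E : Type*) [Field E] [Algebra (RatFunc (ZMod 2)) E]
    [IsSplittingField (RatFunc (ZMod 2)) E fGamma] [CharP E 2] (T : E)
    (hT : T = algebraMap _ E T2) :
    ∃ ω μ t : E, ω^2 = ω+1 ∧ μ^4 = μ + T ∧ t^2 = t+T^3 := by
  have hT0 : T ≠ 0 := by rw [hT]; simpa using T2_ne
  let Ω := AlgebraicClosure E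
  let ι := algebraMap E Ω
  have : CharP Ω 2 := charP_of_injective_algebraMap (algebraMap E Ω).injective 2
  have ext : ∀ p : Polynomial Ω, p.degree ≠ 0 → ∃ x, p.eval x = 0 := fun p hp =>
    IsAlgClosed.exists_root p hp
  obtain ⟨ω, hω⟩ := ext (X^2 + X + 1) (by
    have : (X^2 + X + 1 : Polynomial Ω).degree = 2 := by compute_degree!
    rw [this]; decide)
  obtain ⟨μ, hμ⟩ := ext (X^4 + X + C (ι T)) (by
    have : (X^4 + X + C (ι T) : Polynomial Ω).degree = 4 := by compute_degree!
    rw [this]; decide)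
  obtain ⟨t, ht⟩ := ext (X^2 + X + C (ι T ^ 3)) (by
    have : (X^2 + X + C (ι T ^ 3) : Polynomial Ω).degree = 2 := by compute_degree!
    rw [this]; decide)
  simp only [eval_add, eval_pow, eval_X, eval_C, eval_one, add_assoc] at hω hμ ht
  rw [CharTwo.add_eq_zero] at hω hμ ht
  have hιT : ι T = algebraMap (RatFunc (ZMod 2)) Ω T2 := by
    rw [hT, IsScalarTower.algebraMap_apply (RatFunc (ZMod 2)) E Ω]
  have key : ∀ x : Ω, aeval x fGamma = 0 → ∃ y : E, ι y = x := by
    intro x hx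
    have hs := IsSplittingField.splits E fGamma
    have := hs.mem_range_of_isRoot (fGamma_monic.map _).ne_zero (i := ι) (x := x) (by
      rw [IsRoot.def, eval_map, eval₂_map]
      rw [aeval_def] at hx
      exact hx)
    simpa using this
  have R := fun δ ε ζ hδ hε hζ => key _ ((aeval_fGamma _ _ hιT).trans
    (is_root (ι T) ω μ t δ ε ζ _ hω hμ ht hδ hε hζ rfl))
  have h0 : (0:Ω)^2 = 0 := by ring
  have h1 : (1:Ω)^2 = 1 := by ring
  obtain ⟨x0, hx0⟩ := R 0 0 0 h0 h0 h0
  obtain ⟨x1, hx1⟩ := R 0 1 0 h0 h1 h0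
  obtain ⟨x2, hx2⟩ := R 0 0 1 h0 h0 h1
  have hιT0 : ι T ≠ 0 := by simpa using hT0
  have cancel : ∀ a b : Ω, a + b + a = b := fun a b => by
    rw [add_comm a b, add_assoc, CharTwo.add_self_eq_zero, add_zero]
  have hθ : ι (x1 + x0) = μ^2+μ := by
    rw [map_add, hx0, hx1]; simp only [zero_mul, one_mul, add_zero]; exact cancel _ _
  have hφ : ι (x2 + x0) = ι T + ω*μ^2+(ω+1)*μ := by
    rw [map_add, hx0, hx2]; simp only [zero_mul, one_mul, add_zero]; exact cancel _ _
  have h2 : (2:Ω) = 0 := CharTwo.two_eq_zero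
  obtain ⟨ω', hω'⟩ : ∃ ω', ι ω' = ω := by
    refine ⟨((x2+x0)^2+(x2+x0)+T^2)/T, ?_⟩
    rw [map_div₀, map_add, map_add, map_pow, map_pow, hφ, div_eq_iff hιT0]
    exact alg_omega _ _ _ hω hμ
  obtain ⟨μ', hμ'⟩ : ∃ μ', ι μ' = μ := by
    refine ⟨(x2+x0) + T + ω' * (x1 + x0), ?_⟩
    rw [map_add, map_add, map_mul, hφ, hθ, hω']
    exact alg_mu _ _ _
  obtain ⟨t', ht'⟩ : ∃ t', ι t' = t := by
    refine ⟨x0 + (T*(μ'^2+μ')+T+μ'^3+ω'*μ'^2+(ω'+1)*μ'), ?_⟩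
    simp only [map_add, map_mul, map_pow, map_one, hω', hμ', hx0]
    exact alg_t _ _ _ _
  refine ⟨ω', μ', t', ι.injective ?_, ι.injective ?_, ι.injective ?_⟩
  · rw [map_pow, map_add, hω', map_one, hω]
  · rw [map_pow, map_add, hμ', hμ]
  · rw [map_pow, map_add, ht', map_pow, ht]

theorem main_aux_s18 (E : Type*) [Field E] [Algebra (RatFunc (ZMod 2)) E]
    [IsSplittingField (RatFunc (ZMod 2)) E fGamma] :
    Irreducible fGamma ∧
    Nonempty ((E ≃ₐ[RatFunc (ZMod 2)] E) ≃* DihedralGroup 4 × Multiplicative (ZMod 2)) := by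
  have : CharP E 2 :=
    charP_of_injective_algebraMap (algebraMap (RatFunc (ZMod 2)) E).injective 2
  have h2 : (2:E) = 0 := CharTwo.two_eq_zero
  obtain ⟨T, hT⟩ : ∃ T : E, T = algebraMap _ E T2 := ⟨_, rfl⟩
  obtain ⟨ω, μ, t, hω, hμ, ht⟩ := exists_gens E T hT
  have hfd : FiniteDimensional (RatFunc (ZMod 2)) E := IsSplittingField.finiteDimensional E fGamma
  have hgal : IsGalois (RatFunc (ZMod 2)) E :=
    IsGalois.of_separable_splitting_field fGamma_separable
  let G := E ≃ₐ[RatFunc (ZMod 2)] E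
  have hσT : ∀ σ : G, σ T = T := fun σ => by rw [hT]; exact σ.commutes _
  let i : ZMod 2 →+* E := ZMod.castHom dvd_rfl E
  have iinj : Function.Injective i := i.injective
  have isq : ∀ a, i a ^ 2 = i a := by
    intro a; rw [← map_pow]; congr 1; revert a; decide
  have hσi : ∀ (σ : G) a, σ (i a) = i a := fun σ a =>
    RingHom.congr_fun (Subsingleton.elim ((σ : E →+* E).comp i) i) a
  have h01 : ∀ a : ZMod 2, a = 0 ∨ a = 1 := by decide
  have hωi : ∀ a, ω ≠ i a := by
    intro a h
    have := isq a
    rw [← h, hω] at this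
    simp at this
  -- parameters
  have hA : ∀ σ : G, ∃ p : ZMod 2 × ZMod 2 × ZMod 2 × ZMod 2, σ ω = ω + i p.1 ∧
      σ μ = μ + i p.2.1 * ω + i p.2.2.1 ∧ σ t = t + i p.2.2.2 := by
    intro σ
    have e1 : (σ ω)^2 = σ ω + 1 := by rw [← map_pow, hω, map_add, map_one]
    have e2 : (σ μ)^4 = σ μ + T := by rw [← map_pow, hμ, map_add, hσT]
    have e3 : (σ t)^2 = σ t + T^3 := by rw [← map_pow, ht, map_add, map_pow, hσT]
    obtain ⟨a, ha⟩ : ∃ a, σ ω = ω + i a := by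
      rcases quad_eq_one (σ ω) ω (by grind) with h | h
      · exact ⟨0, by simp [h]⟩
      · exact ⟨1, by simp [h]⟩
    obtain ⟨d, hd⟩ : ∃ a, σ t = t + i a := by
      rcases quad_eq_one (σ t) t (by grind) with h | h
      · exact ⟨0, by simp [h]⟩
      · exact ⟨1, by simp [h]⟩
    obtain ⟨b, c, hbc⟩ : ∃ b c, σ μ = μ + i b * ω + i c := by
      rcases quad_eq_one ((σ μ)^2 + σ μ) (μ^2+μ) (by grind) with h | h
      · rcases quad_eq_one (σ μ) μ h with h | h
        · exact ⟨0, 0, by simp [h]⟩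
        · exact ⟨0, 1, by simp [h]⟩
      · rcases quad_eq_one (σ μ) (μ + ω) (by grind) with h | h
        · exact ⟨1, 0, by simp [h]⟩
        · exact ⟨1, 1, by simp [h]⟩
    exact ⟨(a, b, c, d), ha, hbc, hd⟩
  choose p hpω hpμ hpt using hA
  have hu : ∀ (σ : G) a b c d, σ ω = ω + i a → σ μ = μ + i b * ω + i c → σ t = t + i d →
      p σ = (a, b, c, d) := by
    intro σ a b c d h1 h3 h4
    have q1 : (p σ).1 = a := iinj (add_left_cancel ((hpω σ).symm.trans h1))
    have q4 : (p σ).2.2.2 = d := iinj (add_left_cancel ((hpt σ).symm.trans h4))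
    have q23 := (hpμ σ).symm.trans h3
    have q2 : (p σ).2.1 = b := by
      by_contra hne
      have hb : (p σ).2.1 = b + 1 := ne_aux _ _ hne
      rw [hb, map_add, map_one] at q23
      apply hωi (c + (p σ).2.2.1)
      rw [map_add]; grind
    have q3 : (p σ).2.2.1 = c := by
      rw [q2] at q23; exact iinj (add_left_cancel q23)
    ext <;> assumption
  have pmul : ∀ σ τ : G, p (σ * τ) = ((p σ).1 + (p τ).1, (p σ).2.1 + (p τ).2.1,
      (p σ).2.2.1 + (p τ).2.2.1 + (p σ).1 * (p τ).2.1, (p σ).2.2.2 + (p τ).2.2.2) := by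
    intro σ τ
    apply hu
    · rw [AlgEquiv.mul_apply, hpω τ, map_add, hσi, hpω σ, map_add]; ring
    · rw [AlgEquiv.mul_apply, hpμ τ, map_add, map_add, map_mul, hσi, hσi, hpω σ, hpμ σ]
      simp only [map_add, map_mul]; ring
    · rw [AlgEquiv.mul_apply, hpt τ, map_add, hσi, hpt σ, map_add]; ring
  have pone : p 1 = (0, 0, 0, 0) := by
    apply hu
    · show ω = ω + i 0
      rw [map_zero, add_zero]
    · show μ = μ + i 0 * ω + i 0
      rw [map_zero, zero_mul, add_zero, add_zero]
    · show t = t + i 0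
      rw [map_zero, add_zero]
  have hroots : ∀ x ∈ fGamma.rootSet E, ∃ δ ε ζ : E, (δ = 0 ∨ δ = 1) ∧ (ε = 0 ∨ ε = 1) ∧
      (ζ = 0 ∨ ζ = 1) ∧ x = t + T*(μ^2+μ)+T+μ^3+ω*μ^2+(ω+1)*μ + δ + ε * (μ^2+μ)
        + ζ * (T + ω*μ^2+(ω+1)*μ) := by
    intro x hx
    rw [mem_rootSet, aeval_fGamma x T hT] at hx
    exact roots_all T ω μ t x hω hμ ht hx.2
  have pinj : ∀ σ τ : G, p σ = p τ → σ = τ := by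
    intro σ τ h
    have w1 : σ ω = τ ω := by rw [hpω, hpω, h]
    have w2 : σ μ = τ μ := by rw [hpμ, hpμ, h]
    have w3 : σ t = τ t := by rw [hpt, hpt, h]
    have : (σ : E →ₐ[RatFunc (ZMod 2)] E) = τ := by
      refine AlgHom.ext_of_adjoin_eq_top (IsSplittingField.adjoin_rootSet E fGamma) ?_
      intro x hx
      obtain ⟨δ, ε, ζ, hδ, hε, hζ, rfl⟩ := hroots x hx
      have f01 : ∀ a : E, a = 0 ∨ a = 1 → σ a = τ a := by
        rintro a (rfl | rfl) <;> simp
      show σ _ = τ _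
      simp only [map_add, map_mul, map_pow, map_one, w1, w2, w3, f01 _ hδ, f01 _ hε, f01 _ hζ, hσT]
    exact AlgEquiv.coe_toAlgHom_injective this
  let Φ : G →* DihedralGroup 4 × Multiplicative (ZMod 2) := MonoidHom.mk'
    (fun σ => (e3 (p σ).1 (p σ).2.1 (p σ).2.2.1, Multiplicative.ofAdd (p σ).2.2.2)) (by
      intro σ τ
      simp only [pmul, Prod.mk_mul_mk, e3_mul, ofAdd_add])
  have hΦ : ∀ σ, Φ σ = (e3 (p σ).1 (p σ).2.1 (p σ).2.2.1, Multiplicative.ofAdd (p σ).2.2.2) :=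
    fun σ => rfl
  have Φinj : Function.Injective Φ := by
    intro σ τ h
    rw [hΦ, hΦ, Prod.mk.injEq] at h
    obtain ⟨q1, q2, q3⟩ := e3_inj _ _ _ _ _ _ h.1
    have q4 := Multiplicative.ofAdd.injective h.2
    exact pinj _ _ (by ext <;> assumption)
  -- the Frattini quotient
  let S : Submodule (ZMod 2) (ZMod 2 × ZMod 2 × ZMod 2) :=
    { carrier := {v | ∃ σ : G, ((p σ).1, (p σ).2.1, (p σ).2.2.2) = v}
      add_mem' := by
        rintro _ _ ⟨σ, rfl⟩ ⟨τ, rfl⟩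
        exact ⟨σ * τ, by rw [pmul]; rfl⟩
      zero_mem' := ⟨1, by rw [pone]; rfl⟩
      smul_mem' := by
        rintro c _ ⟨σ, rfl⟩
        rcases h01 c with rfl | rfl
        · exact ⟨1, by rw [pone, zero_smul]; rfl⟩
        · exact ⟨σ, by rw [one_smul]⟩ }
  have hS : S = ⊤ := by
    by_contra hne
    obtain ⟨f, hf0, hf⟩ := Submodule.exists_le_ker_of_lt_top S (lt_top_iff_ne_top.2 hne)
    have hfe : ∀ a b d, f (a, b, d) = a * f (1,0,0) + b * f (0,1,0) + d * f (0,0,1) := by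
      intro a b d
      rw [← smul_eq_mul, ← smul_eq_mul, ← smul_eq_mul, ← map_smul, ← map_smul, ← map_smul,
        ← map_add, ← map_add]
      simp
    generalize f (1,0,0) = α at hfe
    generalize f (0,1,0) = β at hfe
    generalize f (0,0,1) = γ at hfe
    have hn : ¬ (α = 0 ∧ β = 0 ∧ γ = 0) := by
      rintro ⟨rfl, rfl, rfl⟩
      apply hf0
      apply LinearMap.ext
      rintro ⟨a, b, d⟩
      rw [hfe]; simp
    have hfix : ∀ σ : G, σ (i α * ω + i β * (μ^2+μ) + i γ * t)
        = (i α * ω + i β * (μ^2+μ) + i γ * t) := by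
      intro σ
      have hk : f ((p σ).1, (p σ).2.1, (p σ).2.2.2) = 0 := hf ⟨σ, rfl⟩
      rw [hfe] at hk
      have hk' := congrArg i hk
      simp only [map_add, map_mul, map_pow, map_zero, hσi, hpω, hpμ, hpt] at hk' ⊢
      exact alg_fix _ _ _ _ _ _ _ _ _ _ hω (isq _) (isq _) hk'
    obtain ⟨y, hy⟩ := (IsGalois.mem_range_algebraMap_iff_fixed _).2 hfix
    apply no_comb α β γ hn y
    apply (algebraMap (RatFunc (ZMod 2)) E).injective
    have hC : ∀ a, algebraMap (RatFunc (ZMod 2)) E (algebraMap (ZMod 2)[X] _ (C a)) = i a :=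
      fun a => RingHom.congr_fun (Subsingleton.elim
        (((algebraMap (RatFunc (ZMod 2)) E).comp (algebraMap (ZMod 2)[X] _)).comp C) i) a
    rw [map_add, map_pow, hy]
    rw [map_add, map_add, map_mul, map_mul, map_pow]
    simp only [map_add, map_mul, map_pow, hC, alg_T2, ← hT]
    exact alg_AS _ _ _ _ _ _ _ hω hμ ht (isq _) (isq _) (isq _)
  have hex : ∀ a b d, ∃ (σ : G) (c : ZMod 2), p σ = (a, b, c, d) := by
    intro a b d
    have : (a, b, d) ∈ S := by rw [hS]; trivial
    obtain ⟨σ, hσ⟩ := this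
    simp only [Prod.mk.injEq] at hσ
    obtain ⟨q1, q2, q3⟩ := hσ
    exact ⟨σ, (p σ).2.2.1, by ext <;> simp [q1, q2, q3]⟩
  have hκ : ∃ κ : G, p κ = (0, 0, 1, 0) := by
    obtain ⟨σ, c, hσ⟩ := hex 1 0 0
    obtain ⟨τ, c', hτ⟩ := hex 0 1 0
    refine ⟨(σ * τ) * (τ * σ)⁻¹, ?_⟩
    have h := pmul ((σ * τ) * (τ * σ)⁻¹) (τ * σ)
    rw [inv_mul_cancel_right, pmul σ τ, pmul τ σ, hσ, hτ] at h
    generalize p ((σ * τ) * (τ * σ)⁻¹) = q at h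
    obtain ⟨q1, q2, q3, q4⟩ := q
    dsimp only at h
    exact comm_aux c c' q1 q2 q3 q4 h
  obtain ⟨κ, hκ⟩ := hκ
  have hfull : ∀ a b c d, ∃ σ : G, p σ = (a, b, c, d) := by
    intro a b c d
    obtain ⟨σ, c', hσ⟩ := hex a b d
    by_cases h : c' = c
    · exact ⟨σ, by rw [hσ, h]⟩
    · refine ⟨κ * σ, ?_⟩
      rw [pmul, hκ, hσ]
      have : c = 1 + c' := ne_aux' _ _ h
      simp [this]
  have Φsurj : Function.Surjective Φ := by
    rintro ⟨g, d⟩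
    obtain ⟨a, b, c, rfl⟩ := e3_surj g
    obtain ⟨σ, hσ⟩ := hfull a b c (Multiplicative.toAdd d)
    exact ⟨σ, by rw [hΦ, hσ]; rfl⟩
  refine ⟨?_, ⟨MulEquiv.ofBijective Φ ⟨Φinj, Φsurj⟩⟩⟩
  -- irreducibility
  obtain ⟨x0, hx0⟩ : ∃ x0, x0 = t + T*(μ^2+μ)+T+μ^3+ω*μ^2+(ω+1)*μ := ⟨_, rfl⟩
  have hx0r : aeval x0 fGamma = 0 := by
    rw [aeval_fGamma x0 T hT]
    exact is_root T ω μ t 0 0 0 x0 hω hμ ht (by ring) (by ring) (by ring) (by rw [hx0]; ring)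
  have htrans : ∀ x ∈ fGamma.rootSet E, ∃ σ : G, σ x0 = x := by
    intro x hx
    obtain ⟨δ, ε, ζ, hδ, hε, hζ, rfl⟩ := hroots x hx
    have act : ∀ b c d, ∃ σ : G, σ x0 = (t + i d) + T*((μ + i b * ω + i c)^2+(μ + i b * ω + i c))
        +T+(μ + i b * ω + i c)^3+ω*(μ + i b * ω + i c)^2+(ω+1)*(μ + i b * ω + i c) := by
      intro b c d
      obtain ⟨σ, hσ⟩ := hfull 0 b c d
      refine ⟨σ, ?_⟩
      rw [hx0]
      simp only [map_add, map_mul, map_pow, map_one, hσT, hpω, hpμ, hpt, hσ, map_zero, add_zero]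
    have i0 : i 0 = 0 := map_zero i
    have i1 : i 1 = 1 := map_one i
    rcases hζ with rfl | rfl
    · rcases hε with rfl | rfl <;> rcases hδ with rfl | rfl
      · obtain ⟨σ, h⟩ := act 0 0 0; exact ⟨σ, by rw [h]; simp only [i0, i1]; grind⟩
      · obtain ⟨σ, h⟩ := act 0 0 1; exact ⟨σ, by rw [h]; simp only [i0, i1]; grind⟩
      · obtain ⟨σ, h⟩ := act 0 1 0; exact ⟨σ, by rw [h]; simp only [i0, i1]; grind⟩
      · obtain ⟨σ, h⟩ := act 0 1 1; exact ⟨σ, by rw [h]; simp only [i0, i1]; grind⟩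
    · rcases hε with rfl | rfl <;> rcases hδ with rfl | rfl
      · obtain ⟨σ, h⟩ := act 1 0 1; exact ⟨σ, by rw [h]; simp only [i0, i1]; grind⟩
      · obtain ⟨σ, h⟩ := act 1 0 0; exact ⟨σ, by rw [h]; simp only [i0, i1]; grind⟩
      · obtain ⟨σ, h⟩ := act 1 1 0; exact ⟨σ, by rw [h]; simp only [i0, i1]; grind⟩
      · obtain ⟨σ, h⟩ := act 1 1 1; exact ⟨σ, by rw [h]; simp only [i0, i1]; grind⟩
  have hint : IsIntegral (RatFunc (ZMod 2)) x0 := ⟨fGamma, fGamma_monic, hx0r⟩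
  have hm0 := minpoly.ne_zero hint
  have hsub : fGamma.rootSet E ⊆ (minpoly (RatFunc (ZMod 2)) x0).rootSet E := by
    intro x hx
    obtain ⟨σ, rfl⟩ := htrans x hx
    rw [mem_rootSet]
    refine ⟨hm0, ?_⟩
    rw [aeval_algHom_apply σ x0, minpoly.aeval, map_zero]
  have hle : fGamma.natDegree ≤ (minpoly (RatFunc (ZMod 2)) x0).natDegree := by
    rw [← card_rootSet_eq_natDegree (K := E) fGamma_separable (IsSplittingField.splits E fGamma)]
    refine (Set.card_le_card hsub).trans ?_
    rw [← Nat.card_eq_fintype_card, Nat.card_coe_set_eq]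
    exact ncard_rootSet_le _ _
  have := eq_of_monic_of_dvd_of_natDegree_le (minpoly.monic hint) fGamma_monic
    (minpoly.dvd _ _ hx0r) hle
  rw [this]
  exact minpoly.irreducible hint

/-- The polynomial `fGamma` is irreducible over `𝔽₂(T)` and the Galois group of its
splitting field over `𝔽₂(T)` has order `16` and is isomorphic to `D₄ × C₂`. -/
theorem fGamma_gal_eq_dihedral_times_C2 :
    Irreducible fGamma ∧ Nat.card fGamma.Gal = 16 ∧
    Nonempty (fGamma.Gal ≃* DihedralGroup 4 × Multiplicative (ZMod 2)) := by
  obtain ⟨h1, ⟨e⟩⟩ := main_aux_s18 fGamma.SplittingField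
  have e' : fGamma.Gal ≃* DihedralGroup 4 × Multiplicative (ZMod 2) := e
  refine ⟨h1, ?_, ⟨e'⟩⟩
  rw [Nat.card_congr e'.toEquiv, Nat.card_prod, DihedralGroup.nat_card]
  simp
end
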